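/- Let E ⊆ C^n be a domain, L : C^s → C a linear form, Ψ_L(x,v) = (x, L(v)), and let Z ⊆ E × C^s be an analytic subset of pure dimension n with proper projection π onto E such that the generic fiber cardinality s(π|_Z) of Z over E equals the generic fiber cardinality s(π̃|_{Ψ_L(Z)}) of Ψ_L(Z) ⊆ E × C over E. Then for every irreducible analytic component Σ of Ψ_L(Z) there exists an irreducible analytic component Γ of Z with Ψ_L(Γ) = Σ and s(π|_Γ) = s(π̃|_Σ). -/

import Mathlib

open Filter Topology

/-- `X` is an analytic subset of `Ω`: near every point of `Ω` it is the common zero set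
of finitely many holomorphic functions. -/
def IsAnalyticIn {E : Type} [NormedAddCommGroup E] [NormedSpace ℂ E] (Ω X : Set E) : Prop :=
  X ⊆ Ω ∧ ∀ z ∈ Ω, ∃ U : Set E, IsOpen U ∧ z ∈ U ∧ ∃ (N : ℕ) (g : Fin N → E → ℂ),
    (∀ i, DifferentiableOn ℂ (g i) U) ∧ X ∩ U = {x ∈ U | ∀ i, g i x = 0}

/-- `x` is a regular point of `X` of (complex) dimension `d`: near `x`, after a
`ℂ`-linear change of coordinates, `X` is the graph of a holomorphic map defined on an
open subset of `ℂ^d`. -/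
def IsRegPtOfDim {E : Type} [NormedAddCommGroup E] [NormedSpace ℂ E]
    (d : ℕ) (X : Set E) (x : E) : Prop :=
  ∃ U : Set E, IsOpen U ∧ x ∈ U ∧
    ∃ (e : ℕ) (L : E ≃L[ℂ] ((Fin d → ℂ) × (Fin e → ℂ)))
      (Ω : Set (Fin d → ℂ)) (g : (Fin d → ℂ) → (Fin e → ℂ)),
      IsOpen Ω ∧ DifferentiableOn ℂ g Ω ∧
      L '' (X ∩ U) = {p : (Fin d → ℂ) × (Fin e → ℂ) | p.1 ∈ Ω ∧ p.2 = g p.1}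

/-- `X` has pure dimension `d`: regular points (necessarily of dimension `d`) are dense in `X`. -/
def PureDim {E : Type} [NormedAddCommGroup E] [NormedSpace ℂ E] (X : Set E) (d : ℕ) : Prop :=
  (∀ x ∈ X, x ∈ closure {y | y ∈ X ∧ IsRegPtOfDim d X y}) ∧
  (∀ e : ℕ, ∀ x ∈ X, IsRegPtOfDim e X x → e = d)

/-- `d` is the dimension of `X`: the maximum of the dimensions at regular points. -/
def SetDimIs {E : Type} [NormedAddCommGroup E] [NormedSpace ℂ E] (X : Set E) (d : ℕ) : Prop :=
  (∃ x ∈ X, IsRegPtOfDim d X x) ∧ ∀ e : ℕ, ∀ x ∈ X, IsRegPtOfDim e X x → e ≤ d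

/-- The natural projection restricted to `Y` is proper over `U`. -/
def ProperProjOn {A B : Type} [TopologicalSpace A] [TopologicalSpace B]
    (U : Set A) (Y : Set (A × B)) : Prop :=
  ∀ K ⊆ U, IsCompact K → IsCompact {p | p ∈ Y ∧ p.1 ∈ K}

/-- The projection `π|_Y` is regular (an analytic isomorphism) at `p`:
near `p`, `Y` is the graph of a holomorphic map. -/
def ProjRegularAt {A B : Type} [NormedAddCommGroup A] [NormedSpace ℂ A]
    [NormedAddCommGroup B] [NormedSpace ℂ B] (Y : Set (A × B)) (p : A × B) : Prop :=
  ∃ W : Set A, IsOpen W ∧ p.1 ∈ W ∧ ∃ g : A → B, DifferentiableOn ℂ g W ∧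
    ∃ V : Set (A × B), IsOpen V ∧ p ∈ V ∧
      Y ∩ V = {q : A × B | q.1 ∈ W ∧ q.2 = g q.1} ∩ V

/-- The set `S(Y, π)` of singular points of the projection `π|_Y`. -/
def SingProj {A B : Type} [NormedAddCommGroup A] [NormedSpace ℂ A]
    [NormedAddCommGroup B] [NormedSpace ℂ B] (Y : Set (A × B)) : Set (A × B) :=
  {p | p ∈ Y ∧ ¬ ProjRegularAt Y p}

/-- `X` is irreducible as an analytic subset of `Ω`. -/
def IrredAnalyticIn {E : Type} [NormedAddCommGroup E] [NormedSpace ℂ E] (Ω X : Set E) : Prop :=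
  IsAnalyticIn Ω X ∧ X.Nonempty ∧
    ∀ X₁ X₂ : Set E, IsAnalyticIn Ω X₁ → IsAnalyticIn Ω X₂ → X = X₁ ∪ X₂ → X = X₁ ∨ X = X₂

/-- `C` is an irreducible analytic component of `X` (inside `Ω`). -/
def IsIrredComp {E : Type} [NormedAddCommGroup E] [NormedSpace ℂ E] (Ω X C : Set E) : Prop :=
  IrredAnalyticIn Ω C ∧ C ⊆ X ∧
    ∀ C' : Set E, IrredAnalyticIn Ω C' → C ⊆ C' → C' ⊆ X → C' = C

/-- `Z` has generic fiber cardinality `s` over `E`: outside a proper analytic subset of `E`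
every fiber of the projection has exactly `s` points. -/
def GenFiberCard {A B : Type} [NormedAddCommGroup A] [NormedSpace ℂ A]
    (E : Set A) (Z : Set (A × B)) (s : ℕ) : Prop :=
  ∃ T : Set A, IsAnalyticIn E T ∧ T ≠ E ∧ ∀ x ∈ E \ T, Set.ncard {v : B | (x, v) ∈ Z} = s

/-- An algebraic subset of `ℂ^N`. -/
def IsAlgSet (N : ℕ) (V : Set (Fin N → ℂ)) : Prop :=
  ∃ (q : ℕ) (ps : Fin q → MvPolynomial (Fin N) ℂ),
    V = {y | ∀ i, MvPolynomial.eval y (ps i) = 0}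

/-- A Nash function on an open set `U ⊆ ℂ^N`. -/
def NashFn (N : ℕ) (U : Set (Fin N → ℂ)) (f : (Fin N → ℂ) → ℂ) : Prop :=
  DifferentiableOn ℂ f U ∧ ∀ x₀ ∈ U, ∃ V : Set (Fin N → ℂ), IsOpen V ∧ x₀ ∈ V ∧
    ∃ P : Polynomial (MvPolynomial (Fin N) ℂ), P ≠ 0 ∧
      ∀ x ∈ V ∩ U, Polynomial.eval₂ (MvPolynomial.eval x) (f x) P = 0

/-- `X` is a Nash subset of `Ω ⊆ ℂ^N`. -/
def IsNashIn (N : ℕ) (Ω X : Set (Fin N → ℂ)) : Prop :=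
  X ⊆ Ω ∧ ∀ z ∈ Ω, ∃ U : Set (Fin N → ℂ), IsOpen U ∧ z ∈ U ∧
    ∃ (q : ℕ) (g : Fin q → (Fin N → ℂ) → ℂ),
      (∀ i, NashFn N U (g i)) ∧ X ∩ U = {x ∈ U | ∀ i, g i x = 0}

section Parametric

variable {V : Type} [NormedAddCommGroup V] [NormedSpace ℂ V]

theorem continuous_deriv_circleMap (c : ℂ) (r : ℝ) : Continuous (deriv (circleMap c r)) := by
  have : deriv (circleMap c r) = fun θ => circleMap 0 r θ * Complex.I :=
    funext fun θ => deriv_circleMap c r θ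
  rw [this]
  fun_prop

theorem continuousOn_circleIntegral_param {X : Type*} [TopologicalSpace X]
    [FirstCountableTopology X] {S : Set X} {c : ℂ} {r : ℝ} (hr : 0 ≤ r) {G : X → ℂ → ℂ}
    (hG : ContinuousOn (Function.uncurry G) (S ×ˢ Metric.sphere c r)) :
    ContinuousOn (fun x => ∮ z in C(c, r), G x z) S := by
  rw [continuousOn_iff_continuous_domRestrict]
  have h : Continuous (Function.uncurry fun (x : S) (θ : ℝ) =>
      deriv (circleMap c r) θ • G x (circleMap c r θ)) := by
    refine Continuous.smul ((continuous_deriv_circleMap c r).comp continuous_snd) ?_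
    exact hG.comp_continuous (f := fun p : S × ℝ => ((p.1 : X), circleMap c r p.2))
      (by fun_prop) fun p => ⟨p.1.2, circleMap_mem_sphere c hr p.2⟩
  exact intervalIntegral.continuous_parametric_intervalIntegral_of_continuous' h 0 (2 * Real.pi)

theorem fderiv_apply_eq_circleIntegral {W : Set V} (hW : IsOpen W) {f : V → ℂ}
    (hf : DifferentiableOn ℂ f W) {x d : V} {r : ℝ} (hr : 0 < r)
    (h : ∀ z : ℂ, ‖z‖ ≤ r → x + z • d ∈ W) :
    fderiv ℂ f x d =
      (2 * Real.pi * Complex.I : ℂ)⁻¹ • ∮ z in C(0, r), (z ^ 2)⁻¹ • f (x + z • d) := by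
  have hU : IsOpen {z : ℂ | x + z • d ∈ W} := hW.preimage (by fun_prop)
  have hφ : DifferentiableOn ℂ (fun z : ℂ => f (x + z • d)) {z : ℂ | x + z • d ∈ W} :=
    hf.comp (by fun_prop) fun z hz => hz
  have h0 : x ∈ W := by simpa using h 0 (by simpa using hr.le)
  have := Complex.two_pi_I_inv_smul_circleIntegral_sub_sq_inv_smul_of_differentiable hU
    (c := 0) (w₀ := 0) (R := r) (fun z hz => h z (by simpa using hz)) hφ (by simpa using hr)
  simp only [sub_zero] at this
  rw [this]
  have hd : HasFDerivAt f (fderiv ℂ f x) (x + (0 : ℂ) • d) := by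
    simpa using (hf.differentiableAt (hW.mem_nhds h0)).hasFDerivAt
  have h1 : HasDerivAt (fun z : ℂ => x + z • d) d 0 := by
    simpa using ((hasDerivAt_id (0 : ℂ)).smul_const d).const_add x
  exact (hd.comp_hasDerivAt (0 : ℂ) h1).deriv.symm

theorem exists_ball_add_smul_mem {W : Set V} (hW : IsOpen W) {x : V} (hx : x ∈ W) (d : V) :
    ∃ ρ > 0, ∃ r > 0, ∀ y ∈ Metric.ball x ρ, ∀ z : ℂ, ‖z‖ ≤ r → y + z • d ∈ W := by
  obtain ⟨ε, hε, hb⟩ := Metric.isOpen_iff.1 hW x hx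
  refine ⟨ε / 2, by positivity, ε / 2 / (‖d‖ + 1), by positivity, fun y hy z hz => hb ?_⟩
  have h1 : ‖z • d‖ < ε / 2 := by
    rw [norm_smul]
    calc ‖z‖ * ‖d‖ ≤ ε / 2 / (‖d‖ + 1) * ‖d‖ := by gcongr
      _ < ε / 2 / (‖d‖ + 1) * (‖d‖ + 1) := by
        apply mul_lt_mul_of_pos_left (by linarith) (by positivity)
      _ = ε / 2 := by field_simp
  rw [Metric.mem_ball, dist_eq_norm] at *
  calc ‖y + z • d - x‖ = ‖(y - x) + z • d‖ := by congr 1; abel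
    _ ≤ ‖y - x‖ + ‖z • d‖ := norm_add_le _ _
    _ < ε := by linarith

variable [FiniteDimensional ℂ V]

theorem continuousOn_fderiv_param {P : Type*} [TopologicalSpace P] [FirstCountableTopology P]
    {W : Set V} (hW : IsOpen W) {S : Set P} {F : V → P → ℂ}
    (hF : ContinuousOn (Function.uncurry F) (W ×ˢ S))
    (hd : ∀ θ ∈ S, DifferentiableOn ℂ (fun x => F x θ) W) :
    ContinuousOn (fun p : V × P => fderiv ℂ (fun x => F x p.2) p.1) (W ×ˢ S) := by
  rw [continuousOn_clm_apply]
  rintro d ⟨x₀, θ₀⟩ ⟨hx₀, hθ₀⟩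
  obtain ⟨ρ, hρ, r, hr, hmem⟩ := exists_ball_add_smul_mem hW hx₀ d
  have hxW : ∀ y ∈ Metric.ball x₀ ρ, y ∈ W := fun y hy => by
    simpa using hmem y hy 0 (by simpa using hr.le)
  have key : ContinuousOn (fun p : V × P => (2 * Real.pi * Complex.I : ℂ)⁻¹ •
      ∮ z in C(0, r), (z ^ 2)⁻¹ • F (p.1 + z • d) p.2) (Metric.ball x₀ ρ ×ˢ S) := by
    suffices h : ContinuousOn (fun p : V × P => ∮ z in C(0, r), (z ^ 2)⁻¹ • F (p.1 + z • d) p.2)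
      (Metric.ball x₀ ρ ×ˢ S) from h.fun_const_smul _
    refine continuousOn_circleIntegral_param (X := V × P)
      (G := fun p z => (z ^ 2)⁻¹ • F (p.1 + z • d) p.2) hr.le ?_
    have h1 : ContinuousOn (fun q : (V × P) × ℂ => (q.2 ^ 2)⁻¹)
        ((Metric.ball x₀ ρ ×ˢ S) ×ˢ Metric.sphere (0 : ℂ) r) := by
      refine ContinuousOn.inv₀ (by fun_prop) ?_
      rintro ⟨p, z⟩ ⟨-, hz⟩
      have : ‖z‖ = r := by simpa using hz
      have : z ≠ 0 := norm_pos_iff.1 (this ▸ hr)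
      exact pow_ne_zero 2 this
    have h2 : ContinuousOn (fun q : (V × P) × ℂ => F (q.1.1 + q.2 • d) q.1.2)
        ((Metric.ball x₀ ρ ×ˢ S) ×ˢ Metric.sphere (0 : ℂ) r) := by
      refine hF.comp (f := fun q : (V × P) × ℂ => (q.1.1 + q.2 • d, q.1.2)) (by fun_prop) ?_
      rintro ⟨⟨y, θ⟩, z⟩ ⟨⟨hy, hθ⟩, hz⟩
      exact ⟨hmem y hy z (mem_sphere_zero_iff_norm.1 hz).le, hθ⟩
    exact h1.smul h2
  have key2 : ContinuousOn (fun p : V × P => fderiv ℂ (fun x => F x p.2) p.1 d)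
      (Metric.ball x₀ ρ ×ˢ S) := by
    refine key.congr ?_
    rintro ⟨y, θ⟩ ⟨hy, hθ⟩
    exact fderiv_apply_eq_circleIntegral hW (hd θ hθ) hr (hmem y hy)
  refine (key2 (x₀, θ₀) ⟨Metric.mem_ball_self hρ, hθ₀⟩).mono_of_mem_nhdsWithin ?_
  have : Metric.ball x₀ ρ ×ˢ (Set.univ : Set P) ∈ 𝓝 (x₀, θ₀) :=
    prod_mem_nhds (Metric.ball_mem_nhds _ hρ) univ_mem
  refine mem_nhdsWithin_iff_exists_mem_nhds_inter.2 ⟨_, this, ?_⟩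
  rintro ⟨y, θ⟩ ⟨⟨hy, -⟩, -, hθ⟩
  exact ⟨hy, hθ⟩

theorem differentiableOn_circleIntegral_param {W : Set V} (hW : IsOpen W) {c : ℂ} {r : ℝ}
    (hr : 0 ≤ r) {G : V → ℂ → ℂ}
    (hG : ContinuousOn (Function.uncurry G) (W ×ˢ Metric.sphere c r))
    (hd : ∀ z ∈ Metric.sphere c r, DifferentiableOn ℂ (fun x => G x z) W) :
    DifferentiableOn ℂ (fun x => ∮ z in C(c, r), G x z) W := by
  intro x₀ hx₀
  set F : V → ℝ → ℂ := fun x θ => deriv (circleMap c r) θ • G x (circleMap c r θ) with hFdef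
  have hF : ContinuousOn (Function.uncurry F) (W ×ˢ Set.univ) := by
    refine ContinuousOn.smul ((continuous_deriv_circleMap c r).comp continuous_snd).continuousOn ?_
    exact hG.comp (f := fun p : V × ℝ => (p.1, circleMap c r p.2)) (by fun_prop)
      fun p hp => ⟨hp.1, circleMap_mem_sphere c hr p.2⟩
  have hFd : ∀ θ ∈ (Set.univ : Set ℝ), DifferentiableOn ℂ (fun x => F x θ) W := fun θ _ =>
    (hd _ (circleMap_mem_sphere c hr θ)).fun_const_smul _
  have hF' := continuousOn_fderiv_param hW hF hFd
  have hlc : ProperSpace V := FiniteDimensional.proper ℂ V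
  obtain ⟨K, hK, hxK, hKW⟩ := exists_compact_subset hW hx₀
  obtain ⟨C, hC⟩ := (hK.prod (isCompact_uIcc (a := (0 : ℝ)) (b := 2 * Real.pi))).exists_bound_of_continuousOn
    (hF'.mono (Set.prod_mono hKW (Set.subset_univ _)))
  have hcont : ∀ x ∈ W, Continuous (F x) := fun x hx =>
    hF.comp_continuous (f := fun θ : ℝ => (x, θ)) (by fun_prop) fun θ => ⟨hx, trivial⟩
  refine DifferentiableAt.differentiableWithinAt ?_
  have := intervalIntegral.hasFDerivAt_integral_of_dominated_of_fderiv_le (𝕜 := ℂ)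
    (μ := MeasureTheory.volume) (a := 0) (b := 2 * Real.pi) (F := F)
    (F' := fun x θ => fderiv ℂ (fun x => F x θ) x) (x₀ := x₀) (s := interior K)
    (bound := fun _ => C) (isOpen_interior.mem_nhds hxK)
    (by
      filter_upwards [hW.mem_nhds hx₀] with x hx
      exact (hcont x hx).aestronglyMeasurable)
    ((hcont x₀ hx₀).intervalIntegrable _ _)
    (by
      have : Continuous (fun θ => fderiv ℂ (fun x => F x θ) x₀) :=
        hF'.comp_continuous (f := fun θ : ℝ => (x₀, θ)) (by fun_prop) fun θ => ⟨hx₀, trivial⟩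
      exact this.aestronglyMeasurable)
    (by
      refine Filter.Eventually.of_forall fun θ hθ x hx => ?_
      exact hC (x, θ) ⟨interior_subset hx, Set.uIoc_subset_uIcc hθ⟩)
    (by simp)
    (by
      refine Filter.Eventually.of_forall fun θ hθ x hx => ?_
      exact ((hFd θ trivial).differentiableAt
        (hW.mem_nhds (hKW (interior_subset hx)))).hasFDerivAt)
  exact this.differentiableAt

theorem DifferentiableOn.fderiv_apply_of_isOpen {W : Set V} (hW : IsOpen W) {f : V → ℂ}
    (hf : DifferentiableOn ℂ f W) (d : V) :
    DifferentiableOn ℂ (fun x => fderiv ℂ f x d) W := by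
  intro x₀ hx₀
  obtain ⟨ρ, hρ, r, hr, hmem⟩ := exists_ball_add_smul_mem hW hx₀ d
  have key : DifferentiableOn ℂ (fun x : V => (2 * Real.pi * Complex.I : ℂ)⁻¹ •
      ∮ z in C(0, r), (z ^ 2)⁻¹ • f (x + z • d)) (Metric.ball x₀ ρ) := by
    suffices h : DifferentiableOn ℂ (fun x : V => ∮ z in C(0, r), (z ^ 2)⁻¹ • f (x + z • d))
      (Metric.ball x₀ ρ) from h.fun_const_smul _
    refine differentiableOn_circleIntegral_param (V := V)
      (G := fun x z => (z ^ 2)⁻¹ • f (x + z • d)) Metric.isOpen_ball hr.le ?_ ?_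
    · change ContinuousOn (fun q : V × ℂ => (q.2 ^ 2)⁻¹ • f (q.1 + q.2 • d)) _
      have h1 : ContinuousOn (fun q : V × ℂ => (q.2 ^ 2)⁻¹)
          (Metric.ball x₀ ρ ×ˢ Metric.sphere (0 : ℂ) r) := by
        refine ContinuousOn.inv₀ (by fun_prop) ?_
        rintro ⟨p, z⟩ ⟨-, hz⟩
        have : ‖z‖ = r := by simpa using hz
        have : z ≠ 0 := norm_pos_iff.1 (this ▸ hr)
        exact pow_ne_zero 2 this
      have h2 : ContinuousOn (fun q : V × ℂ => f (q.1 + q.2 • d))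
          (Metric.ball x₀ ρ ×ˢ Metric.sphere (0 : ℂ) r) := by
        refine hf.continuousOn.comp (by fun_prop) ?_
        rintro ⟨y, z⟩ ⟨hy, hz⟩
        exact hmem y hy z (mem_sphere_zero_iff_norm.1 hz).le
      exact h1.smul h2
    · intro z hz
      refine DifferentiableOn.fun_const_smul (hf.comp (by fun_prop) fun y hy => ?_) _
      exact hmem y hy z (mem_sphere_zero_iff_norm.1 hz).le
  have : DifferentiableOn ℂ (fun x => fderiv ℂ f x d) (Metric.ball x₀ ρ) :=
    key.congr fun y hy => fderiv_apply_eq_circleIntegral hW hf hr (hmem y hy)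
  exact (this.differentiableAt (Metric.ball_mem_nhds _ hρ)).differentiableWithinAt

theorem DifferentiableOn.continuousOn_fderiv_of_isOpen {W : Set V} (hW : IsOpen W) {f : V → ℂ}
    (hf : DifferentiableOn ℂ f W) : ContinuousOn (fderiv ℂ f) W := by
  rw [continuousOn_clm_apply]
  exact fun d => (hf.fderiv_apply_of_isOpen hW d).continuousOn

end Parametric

section AnalyticSets

variable {V : Type} [NormedAddCommGroup V] [NormedSpace ℂ V]
  {V' : Type} [NormedAddCommGroup V'] [NormedSpace ℂ V']

theorem IsAnalyticIn.of_finite {Ω X : Set V} (h : X ⊆ Ω)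
    (H : ∀ z ∈ Ω, ∃ U : Set V, IsOpen U ∧ z ∈ U ∧ ∃ (ι : Type) (_ : Finite ι) (g : ι → V → ℂ),
      (∀ i, DifferentiableOn ℂ (g i) U) ∧ ∀ x ∈ U, x ∈ X ↔ ∀ i, g i x = 0) :
    IsAnalyticIn Ω X := by
  refine ⟨h, fun z hz => ?_⟩
  obtain ⟨U, hU, hzU, ι, hι, g, hg, hX⟩ := H z hz
  obtain ⟨N, ⟨e⟩⟩ := Finite.exists_equiv_fin ι
  refine ⟨U, hU, hzU, N, fun i => g (e.symm i), fun i => hg _, ?_⟩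
  ext x
  constructor
  · rintro ⟨hx, hxU⟩
    exact ⟨hxU, fun i => (hX x hxU).1 hx _⟩
  · rintro ⟨hxU, hx⟩
    refine ⟨(hX x hxU).2 fun i => ?_, hxU⟩
    simpa using hx (e i)

theorem IsAnalyticIn.exists_eqns {Ω X : Set V} (h : IsAnalyticIn Ω X) {z : V} (hz : z ∈ Ω) :
    ∃ U : Set V, IsOpen U ∧ z ∈ U ∧ ∃ (N : ℕ) (g : Fin N → V → ℂ),
      (∀ i, DifferentiableOn ℂ (g i) U) ∧ ∀ x ∈ U, x ∈ X ↔ ∀ i, g i x = 0 := by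
  obtain ⟨U, hU, hzU, N, g, hg, hX⟩ := h.2 z hz
  refine ⟨U, hU, hzU, N, g, hg, fun x hx => ?_⟩
  have : x ∈ X ∩ U ↔ x ∈ {x ∈ U | ∀ i, g i x = 0} := by rw [hX]
  simpa [hx] using this

theorem IsAnalyticIn.exists_eqns_ball {Ω X : Set V} (h : IsAnalyticIn Ω X) {z : V} (hz : z ∈ Ω) :
    ∃ r > 0, ∃ (N : ℕ) (g : Fin N → V → ℂ),
      (∀ i, DifferentiableOn ℂ (g i) (Metric.ball z r)) ∧
        ∀ x ∈ Metric.ball z r, x ∈ X ↔ ∀ i, g i x = 0 := by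
  obtain ⟨U, hU, hzU, N, g, hg, hX⟩ := h.exists_eqns hz
  obtain ⟨r, hr, hb⟩ := Metric.isOpen_iff.1 hU z hzU
  exact ⟨r, hr, N, g, fun i => (hg i).mono hb, fun x hx => hX x (hb hx)⟩

theorem IsAnalyticIn.union {Ω X Y : Set V} (hX : IsAnalyticIn Ω X) (hY : IsAnalyticIn Ω Y) :
    IsAnalyticIn Ω (X ∪ Y) := by
  refine .of_finite (Set.union_subset hX.1 hY.1) fun z hz => ?_
  obtain ⟨U, hU, hzU, N, g, hg, hgX⟩ := hX.exists_eqns hz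
  obtain ⟨U', hU', hzU', N', g', hg', hgY⟩ := hY.exists_eqns hz
  refine ⟨U ∩ U', hU.inter hU', ⟨hzU, hzU'⟩, Fin N × Fin N', inferInstance,
    fun i x => g i.1 x * g' i.2 x, fun i => ((hg i.1).mono Set.inter_subset_left).mul
      ((hg' i.2).mono Set.inter_subset_right), fun x hx => ?_⟩
  rw [Set.mem_union, hgX x hx.1, hgY x hx.2]
  constructor
  · rintro (h | h) i
    · simp [h]
    · simp [h]
  · intro h
    by_contra! hc
    obtain ⟨⟨i, hi⟩, j, hj⟩ := hc
    exact (mul_ne_zero hi hj) (h (i, j))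

theorem IsAnalyticIn.inter {Ω X Y : Set V} (hX : IsAnalyticIn Ω X) (hY : IsAnalyticIn Ω Y) :
    IsAnalyticIn Ω (X ∩ Y) := by
  refine .of_finite (Set.inter_subset_left.trans hX.1) fun z hz => ?_
  obtain ⟨U, hU, hzU, N, g, hg, hgX⟩ := hX.exists_eqns hz
  obtain ⟨U', hU', hzU', N', g', hg', hgY⟩ := hY.exists_eqns hz
  refine ⟨U ∩ U', hU.inter hU', ⟨hzU, hzU'⟩, Fin N ⊕ Fin N', inferInstance,
    Sum.elim g g', ?_, fun x hx => ?_⟩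
  · rintro (i | i)
    · exact (hg i).mono Set.inter_subset_left
    · exact (hg' i).mono Set.inter_subset_right
  · rw [Set.mem_inter_iff, hgX x hx.1, hgY x hx.2]
    simp

theorem IsAnalyticIn.empty (Ω : Set V) : IsAnalyticIn Ω ∅ :=
  .of_finite (Set.empty_subset _) fun z _ => ⟨Set.univ, isOpen_univ, trivial, Unit, inferInstance,
    fun _ _ => 1, fun _ => differentiableOn_const _, by simp⟩

theorem IsAnalyticIn.biUnion {Ω : Set V} {ι : Type*} {s : Set ι} (hs : s.Finite) {X : ι → Set V}
    (h : ∀ i ∈ s, IsAnalyticIn Ω (X i)) : IsAnalyticIn Ω (⋃ i ∈ s, X i) := by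
  induction s, hs using Set.Finite.induction_on with
  | empty => simpa using IsAnalyticIn.empty Ω
  | insert _ _ ih =>
    rw [Set.biUnion_insert]
    exact (h _ (Set.mem_insert _ _)).union (ih fun i hi => h i (Set.mem_insert_of_mem _ hi))

theorem IsAnalyticIn.preimage {Ω X : Set V} (hX : IsAnalyticIn Ω X) {Ω' : Set V'}
    (hΩ' : IsOpen Ω') {f : V' → V} (hf : DifferentiableOn ℂ f Ω') (hmap : Set.MapsTo f Ω' Ω) :
    IsAnalyticIn Ω' (Ω' ∩ f ⁻¹' X) := by
  refine .of_finite Set.inter_subset_left fun z hz => ?_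
  obtain ⟨U, hU, hzU, N, g, hg, hgX⟩ := hX.exists_eqns (hmap hz)
  refine ⟨Ω' ∩ f ⁻¹' U, hf.continuousOn.isOpen_inter_preimage hΩ' hU, ⟨hz, hzU⟩, Fin N,
    inferInstance, fun i => g i ∘ f, fun i => (hg i).comp (hf.mono Set.inter_subset_left)
      fun x hx => hx.2, fun x hx => ?_⟩
  rw [Set.mem_inter_iff, Set.mem_preimage, hgX _ hx.2]
  simp [hx.1]

theorem IsAnalyticIn.restrict {Ω X Ω' : Set V} (hX : IsAnalyticIn Ω X) (hΩ' : IsOpen Ω')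
    (h : Ω' ⊆ Ω) : IsAnalyticIn Ω' (Ω' ∩ X) :=
  hX.preimage hΩ' (f := id) differentiableOn_id h

theorem IsAnalyticIn.isOpen_diff {Ω X : Set V} (hX : IsAnalyticIn Ω X) (hΩ : IsOpen Ω) :
    IsOpen (Ω \ X) := by
  rw [isOpen_iff_mem_nhds]
  rintro z ⟨hz, hzX⟩
  obtain ⟨U, hU, hzU, N, g, hg, hgX⟩ := hX.exists_eqns hz
  have : ∃ i, g i z ≠ 0 := by simpa [hgX z hzU] using hzX
  obtain ⟨i, hi⟩ := this
  filter_upwards [((hg i).continuousOn.continuousAt (hU.mem_nhds hzU)).eventually_ne hi,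
    hU.mem_nhds hzU, hΩ.mem_nhds hz] with x h1 h2 h3
  refine ⟨h3, fun hx => h1 ((hgX x h2).1 hx i)⟩

/-- An open cover by sets where `X` is analytic. -/
theorem IsAnalyticIn.of_local {Ω X : Set V} (h : X ⊆ Ω)
    (H : ∀ z ∈ Ω, ∃ U : Set V, IsOpen U ∧ z ∈ U ∧ IsAnalyticIn U (U ∩ X)) :
    IsAnalyticIn Ω X := by
  refine .of_finite h fun z hz => ?_
  obtain ⟨U, hU, hzU, hX⟩ := H z hz
  obtain ⟨U', hU', hzU', N, g, hg, hgX⟩ := hX.exists_eqns hzU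
  refine ⟨U ∩ U', hU.inter hU', ⟨hzU, hzU'⟩, Fin N, inferInstance, g,
    fun i => (hg i).mono Set.inter_subset_right, fun x hx => ?_⟩
  rw [← hgX x hx.2]
  simp [hx.1]

theorem DifferentiableOn.eqOn_zero_of_convex {C : Set V} (hC : IsOpen C) (hconv : Convex ℝ C)
    {f : V → ℂ} (hf : DifferentiableOn ℂ f C) {a : V} (ha : a ∈ C) (h0 : ∀ᶠ x in 𝓝 a, f x = 0) :
    ∀ x ∈ C, f x = 0 := by
  intro y hy
  set ℓ : ℂ → V := fun t => a + t • (y - a) with hℓ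
  have hc : Continuous ℓ := by fun_prop
  have hO : IsOpen (ℓ ⁻¹' C) := hC.preimage hc
  have hconv' : Convex ℝ (ℓ ⁻¹' C) := by
    intro s hs t ht p q hp hq hpq
    have : ℓ (p • s + q • t) = p • ℓ s + q • ℓ t := by
      simp only [hℓ, smul_add, add_smul, smul_assoc]
      have : a = p • a + q • a := by rw [← add_smul, hpq, one_smul]
      nth_rewrite 1 [this]
      abel
    change ℓ (p • s + q • t) ∈ C
    rw [this]
    exact hconv hs ht hp hq hpq
  have hd : DifferentiableOn ℂ (f ∘ ℓ) (ℓ ⁻¹' C) := hf.comp (by fun_prop) fun t ht => ht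
  have h0' : (f ∘ ℓ) =ᶠ[𝓝 0] 0 := by
    have : Tendsto ℓ (𝓝 0) (𝓝 a) := by simpa [hℓ] using hc.tendsto 0
    exact this.eventually h0
  have := (hd.analyticOnNhd hO).eqOn_zero_of_preconnected_of_eventuallyEq_zero
    hconv'.isPreconnected (z₀ := 0) (by simpa [hℓ] using ha) h0'
  have h1 := this (x := 1) (by simpa [hℓ] using hy)
  simpa [hℓ] using h1

theorem IsAnalyticIn.eq_of_interior_nonempty {W A : Set V} (hA : IsAnalyticIn W A)
    (hc : IsPreconnected W) (h : (interior A).Nonempty) : A = W := by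
  have hsub : W ⊆ interior A := by
    refine hc.subset_of_closure_inter_subset isOpen_interior ?_ ?_
    · obtain ⟨x, hx⟩ := h
      exact ⟨x, hA.1 (interior_subset hx), hx⟩
    · rintro z ⟨hz, hzW⟩
      obtain ⟨r, hr, N, g, hg, hgX⟩ := hA.exists_eqns_ball hzW
      obtain ⟨a, ha, har⟩ := Metric.mem_closure_iff.1 hz r hr
      rw [dist_comm, ← Metric.mem_ball] at har
      rw [mem_interior]
      refine ⟨Metric.ball z r, fun x hx => (hgX x hx).2 fun i => ?_, Metric.isOpen_ball,
        Metric.mem_ball_self hr⟩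
      refine (hg i).eqOn_zero_of_convex Metric.isOpen_ball (convex_ball z r) har ?_ x hx
      filter_upwards [isOpen_interior.mem_nhds ha, Metric.isOpen_ball.mem_nhds har] with y hy hy'
      exact (hgX y hy').1 (interior_subset hy) i
  exact hA.1.antisymm (hsub.trans interior_subset)

theorem IsAnalyticIn.interior_eq_empty {W A : Set V} (hA : IsAnalyticIn W A)
    (hc : IsPreconnected W) (h : A ≠ W) : interior A = ∅ := by
  by_contra hne
  exact h (hA.eq_of_interior_nonempty hc (Set.nonempty_iff_ne_empty.2 hne))

theorem IsAnalyticIn.interior_union_eq_empty {W A B : Set V} (hW : IsOpen W)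
    (hA : IsAnalyticIn W A) (hB : B ⊆ W) (hA' : interior A = ∅) (hB' : interior B = ∅) :
    interior (A ∪ B) = ∅ := by
  by_contra hne
  obtain ⟨x, hx⟩ := Set.nonempty_iff_ne_empty.2 hne
  have h1 : IsOpen (interior (A ∪ B) ∩ (W \ A)) :=
    isOpen_interior.inter (hA.isOpen_diff hW)
  have h2 : interior (A ∪ B) ∩ (W \ A) ⊆ interior B := by
    refine interior_maximal ?_ h1
    rintro y ⟨hy, -, hyA⟩
    exact (interior_subset hy).resolve_left hyA
  rw [hB'] at h2
  have h3 : interior (A ∪ B) ⊆ interior A := by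
    refine interior_maximal (fun y hy => ?_) isOpen_interior
    by_contra hyA
    exact h2 ⟨hy, Set.union_subset hA.1 hB (interior_subset hy), hyA⟩
  rw [hA'] at h3
  exact h3 hx

end AnalyticSets

section Riemann

theorem exists_differentiableOn_extension_of_isolated {O S : Set ℂ} (hO : IsOpen O)
    (hS : ∀ z ∈ O, ∀ᶠ w in 𝓝[≠] z, w ∉ S) {f : ℂ → ℂ} (hf : ∀ z ∈ O \ S, DifferentiableAt ℂ f z)
    {M : ℝ} (hM : ∀ z ∈ O \ S, ‖f z‖ ≤ M) :
    ∃ F : ℂ → ℂ, DifferentiableOn ℂ F O ∧ ∀ z ∈ O \ S, F z = f z := by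
  have hlim : ∀ z ∈ O \ S, limUnder (𝓝[≠] z) f = f z := fun z hz =>
    ((hf z hz).continuousAt.tendsto.mono_left nhdsWithin_le_nhds).limUnder_eq
  refine ⟨fun z => limUnder (𝓝[≠] z) f, fun z hz => ?_, hlim⟩
  obtain ⟨s, hs, hsO⟩ : ∃ s ∈ 𝓝 z, ∀ w ∈ s, w ≠ z → w ∈ O \ S := by
    have := hS z hz
    rw [eventually_nhdsWithin_iff] at this
    exact ⟨_, Filter.inter_mem this (hO.mem_nhds hz), fun w hw hne => ⟨hw.2, hw.1 hne⟩⟩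
  have hd := Complex.differentiableOn_update_limUnder_of_bddAbove (f := f) hs
    (fun w hw => (hf w (hsO w hw.1 hw.2)).differentiableWithinAt)
    ⟨M, by rintro _ ⟨w, hw, rfl⟩; exact hM w (hsO w hw.1 hw.2)⟩
  have hd' := hd.differentiableAt hs
  refine (hd'.congr_of_eventuallyEq ?_).differentiableWithinAt
  filter_upwards [hs] with w hw
  by_cases h : w = z
  · subst h; simp
  · rw [Function.update_of_ne h, hlim w (hsO w hw h)]

variable {V : Type} [NormedAddCommGroup V] [NormedSpace ℂ V] [FiniteDimensional ℂ V]

theorem exists_local_extension {W T : Set V} (hW : IsOpen W) (hT : IsAnalyticIn W T)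
    (hT' : interior T = ∅) {f : V → ℂ} (hf : DifferentiableOn ℂ f (W \ T)) {M : ℝ}
    (hM : ∀ x ∈ W \ T, ‖f x‖ ≤ M) {x₀ : V} (hx₀ : x₀ ∈ W) :
    ∃ ρ > 0, Metric.ball x₀ ρ ⊆ W ∧ ∃ F : V → ℂ, DifferentiableOn ℂ F (Metric.ball x₀ ρ) ∧
      ∀ x ∈ Metric.ball x₀ ρ \ T, F x = f x := by
  have hWT := hT.isOpen_diff hW
  obtain ⟨r₁, hr₁, hb₁⟩ := Metric.isOpen_iff.1 hW x₀ hx₀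
  obtain ⟨r₂, hr₂, N, g, hg, hgT⟩ := hT.exists_eqns_ball hx₀
  set R := min r₁ r₂
  have hR : 0 < R := lt_min hr₁ hr₂
  have hBW : Metric.ball x₀ R ⊆ W := (Metric.ball_subset_ball (min_le_left _ _)).trans hb₁
  have hB2 : Metric.ball x₀ R ⊆ Metric.ball x₀ r₂ := Metric.ball_subset_ball (min_le_right _ _)
  obtain ⟨a, haB, haT⟩ : ∃ a ∈ Metric.ball x₀ R, a ∉ T := by
    by_contra! hc
    have : Metric.ball x₀ R ⊆ interior T := interior_maximal hc Metric.isOpen_ball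
    rw [hT'] at this
    exact this (Metric.mem_ball_self hR)
  obtain ⟨i, hi⟩ : ∃ i, g i a ≠ 0 := by simpa [hgT a (hB2 haB)] using haT
  have hgi : DifferentiableOn ℂ (g i) (Metric.ball x₀ R) := (hg i).mono hB2
  have hTg : ∀ x ∈ Metric.ball x₀ R, g i x ≠ 0 → x ∉ T := fun x hx h hxT =>
    h ((hgT x (hB2 hx)).1 hxT i)
  set d := a - x₀
  -- slices in the direction `d`
  have hslice : ∀ x : V, IsOpen {z : ℂ | x + z • d ∈ Metric.ball x₀ R} := fun x =>
    Metric.isOpen_ball.preimage (by fun_prop)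
  have hsliceconv : ∀ x : V, Convex ℝ {z : ℂ | x + z • d ∈ Metric.ball x₀ R} := by
    intro x s hs t ht p q hp hq hpq
    have : x + (p • s + q • t) • d = p • (x + s • d) + q • (x + t • d) := by
      simp only [smul_add, add_smul, smul_assoc]
      have : x = p • x + q • x := by rw [← add_smul, hpq, one_smul]
      nth_rewrite 1 [this]
      abel
    change x + (p • s + q • t) • d ∈ Metric.ball x₀ R
    rw [this]
    exact convex_ball x₀ R hs ht hp hq hpq
  have hsliced : ∀ x : V, DifferentiableOn ℂ (fun z : ℂ => g i (x + z • d))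
      {z : ℂ | x + z • d ∈ Metric.ball x₀ R} := fun x =>
    hgi.comp (by fun_prop) fun z hz => hz
  have hisol : ∀ x : V, ∀ z₁ : ℂ, x + z₁ • d ∈ Metric.ball x₀ R → g i (x + z₁ • d) ≠ 0 →
      ∀ z : ℂ, x + z • d ∈ Metric.ball x₀ R → ∀ᶠ w in 𝓝[≠] z, g i (x + w • d) ≠ 0 := by
    intro x z₁ hz₁ hne z hz
    refine ((hsliced x).analyticOnNhd (hslice x) z hz).eventually_eq_zero_or_eventually_ne_zero.resolve_left
      fun h0 => hne ?_
    exact (hsliced x).eqOn_zero_of_convex (hslice x) (hsliceconv x) hz h0 z₁ hz₁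
  obtain ⟨ρ₁, hρ₁, r₃, hr₃, hmem⟩ := exists_ball_add_smul_mem Metric.isOpen_ball
    (Metric.mem_ball_self hR : x₀ ∈ Metric.ball x₀ R) d
  obtain ⟨r, hr, hrr₃, hrne⟩ : ∃ r > 0, r ≤ r₃ ∧ ∀ z : ℂ, ‖z‖ = r → g i (x₀ + z • d) ≠ 0 := by
    have := hisol x₀ 1 (by simpa [d] using haB) (by simpa [d] using hi) 0
      (by simpa using hR)
    rw [eventually_nhdsWithin_iff, Metric.eventually_nhds_iff] at this
    obtain ⟨ε, hε, h⟩ := this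
    refine ⟨min r₃ (ε / 2), by positivity, min_le_left _ _, fun z hz => h ?_ ?_⟩
    · rw [dist_zero_right, hz]
      exact lt_of_le_of_lt (min_le_right _ _) (by linarith)
    · rw [Set.mem_compl_singleton_iff, ← norm_pos_iff, hz]
      positivity
  obtain ⟨ρ, hρ, hρle, hρne⟩ : ∃ ρ > 0, ρ ≤ ρ₁ ∧ ∀ x ∈ Metric.ball x₀ ρ, ∀ z : ℂ, ‖z‖ = r →
      g i (x + z • d) ≠ 0 := by
    have hopen : IsOpen ({q : V × ℂ | q.1 + q.2 • d ∈ Metric.ball x₀ R} ∩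
        (fun q : V × ℂ => g i (q.1 + q.2 • d)) ⁻¹' {0}ᶜ) := by
      refine ContinuousOn.isOpen_inter_preimage ?_ (Metric.isOpen_ball.preimage (by fun_prop))
        isOpen_compl_singleton
      exact hgi.continuousOn.comp (by fun_prop) fun q hq => hq
    have hsub : ({x₀} : Set V) ×ˢ Metric.sphere (0 : ℂ) r ⊆
        {q : V × ℂ | q.1 + q.2 • d ∈ Metric.ball x₀ R} ∩
        (fun q : V × ℂ => g i (q.1 + q.2 • d)) ⁻¹' {0}ᶜ := by
      rintro ⟨x, z⟩ ⟨hx, hz⟩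
      obtain rfl : x = x₀ := hx
      have hz' : ‖z‖ = r := mem_sphere_zero_iff_norm.1 hz
      exact ⟨hmem x (Metric.mem_ball_self hρ₁) z (hz'.trans_le hrr₃), hrne z hz'⟩
    obtain ⟨u, v, hu, hv, hxu, hsv, huv⟩ := generalized_tube_lemma isCompact_singleton
      (isCompact_sphere (0 : ℂ) r) hopen hsub
    obtain ⟨ε, hε, hεu⟩ := Metric.isOpen_iff.1 hu x₀ (hxu rfl)
    refine ⟨min ε ρ₁, by positivity, min_le_right _ _, fun x hx z hz => ?_⟩
    exact (huv (Set.mk_mem_prod (hεu (Metric.ball_subset_ball (min_le_left _ _) hx))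
      (hsv (mem_sphere_zero_iff_norm.2 hz)))).2
  have hmem' : ∀ x ∈ Metric.ball x₀ ρ, ∀ z : ℂ, ‖z‖ ≤ r → x + z • d ∈ Metric.ball x₀ R :=
    fun x hx z hz => hmem x (Metric.ball_subset_ball hρle hx) z (hz.trans hrr₃)
  have hballW : Metric.ball x₀ ρ ⊆ W := fun x hx => hBW (by
    simpa using hmem' x hx 0 (by simpa using hr.le))
  have hcirc : ∀ x ∈ Metric.ball x₀ ρ, ∀ z ∈ Metric.sphere (0 : ℂ) r, x + z • d ∈ W \ T := by
    intro x hx z hz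
    have hz' : ‖z‖ = r := mem_sphere_zero_iff_norm.1 hz
    have h1 := hmem' x hx z hz'.le
    exact ⟨hBW h1, hTg _ h1 (hρne x hx z hz')⟩
  refine ⟨ρ, hρ, hballW,
    fun x => (2 * Real.pi * Complex.I : ℂ)⁻¹ • ∮ z in C(0, r), (z - 0)⁻¹ • f (x + z • d), ?_, ?_⟩
  · suffices h : DifferentiableOn ℂ (fun x : V => ∮ z in C(0, r), (z - 0)⁻¹ • f (x + z • d))
      (Metric.ball x₀ ρ) from h.fun_const_smul _
    refine differentiableOn_circleIntegral_param (V := V)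
      (G := fun x z => (z - 0)⁻¹ • f (x + z • d)) Metric.isOpen_ball hr.le ?_ ?_
    · have h1 : ContinuousOn (fun q : V × ℂ => (q.2 - 0)⁻¹)
          (Metric.ball x₀ ρ ×ˢ Metric.sphere (0 : ℂ) r) := by
        refine ContinuousOn.inv₀ (by fun_prop) ?_
        rintro ⟨p, z⟩ ⟨-, hz⟩
        have : ‖z‖ = r := by simpa using hz
        have : z ≠ 0 := norm_pos_iff.1 (this ▸ hr)
        simpa using this
      have h2 : ContinuousOn (fun q : V × ℂ => f (q.1 + q.2 • d))
          (Metric.ball x₀ ρ ×ˢ Metric.sphere (0 : ℂ) r) :=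
        hf.continuousOn.comp (by fun_prop) fun q hq => hcirc q.1 hq.1 q.2 hq.2
      exact h1.smul h2
    · intro z hz
      exact DifferentiableOn.fun_const_smul (hf.comp (by fun_prop) fun y hy => hcirc y hy z hz) _
  · rintro x ⟨hx, hxT⟩
    obtain ⟨F, hF, hFeq⟩ := exists_differentiableOn_extension_of_isolated (hslice x)
      (S := {z : ℂ | x + z • d ∈ T}) (f := fun z => f (x + z • d)) (M := M)
      (by
        intro z hz
        have hn : ‖(r : ℂ)‖ = r := by simp [abs_of_pos hr]
        filter_upwards [hisol x r (hmem' x hx r hn.le) (hρne x hx r hn) z hz,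
          nhdsWithin_le_nhds ((hslice x).mem_nhds hz)] with w hw hw'
        exact hTg _ hw' hw)
      (by
        rintro z ⟨hz, hzT⟩
        have : DifferentiableAt ℂ f (x + z • d) :=
          hf.differentiableAt (hWT.mem_nhds ⟨hBW hz, hzT⟩)
        exact this.comp (f := fun z : ℂ => x + z • d) z (by fun_prop))
      (by
        rintro z ⟨hz, hzT⟩
        exact hM _ ⟨hBW hz, hzT⟩)
    have hcl : Metric.closedBall (0 : ℂ) r ⊆ {z : ℂ | x + z • d ∈ Metric.ball x₀ R} :=
      fun z hz => hmem' x hx z (mem_closedBall_zero_iff.1 hz)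
    have hC := (hF.mono hcl).circleIntegral_sub_inv_smul (w := 0) (by simpa using hr)
    have hintgr : (∮ z in C(0, r), (z - 0)⁻¹ • f (x + z • d)) = ∮ z in C(0, r), (z - 0)⁻¹ • F z := by
      refine circleIntegral.integral_congr hr.le fun z hz => ?_
      have := hFeq z ⟨hcl (Metric.sphere_subset_closedBall hz), (hcirc x hx z hz).2⟩
      simp [this]
    have h0 : F 0 = f x := by
      have := hFeq 0 ⟨hcl (by simpa using hr.le), by simpa using hxT⟩
      simpa using this
    simp only
    rw [hintgr, hC, h0, smul_smul, inv_mul_cancel₀, one_smul]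
    simp [Real.pi_ne_zero]

end Riemann

section Zeros

theorem exists_factor_of_isolated_zero {O : Set ℂ} (hO : IsOpen O) {φ : ℂ → ℂ}
    (hφ : DifferentiableOn ℂ φ O) {a : ℂ} (ha : a ∈ O) (h : ∀ᶠ w in 𝓝[≠] a, φ w ≠ 0) :
    ∃ (k : ℕ) (u : ℂ → ℂ), DifferentiableOn ℂ u O ∧ u a ≠ 0 ∧ ∀ w, φ w = (w - a) ^ k * u w := by
  have han : AnalyticAt ℂ φ a := hφ.analyticAt (hO.mem_nhds ha)
  have hne : ¬ ∀ᶠ w in 𝓝 a, φ w = 0 := fun h0 => by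
    obtain ⟨w, hw, hw'⟩ := (h.and (h0.filter_mono nhdsWithin_le_nhds)).exists
    exact hw hw'
  obtain ⟨k, g, hg, hga, hgφ⟩ := han.exists_eventuallyEq_pow_smul_nonzero_iff.2 hne
  refine ⟨k, fun w => if w = a then g a else φ w / (w - a) ^ k, ?_, by simpa using hga, ?_⟩
  · intro z hz
    by_cases hza : z = a
    · subst hza
      refine (hg.differentiableAt.congr_of_eventuallyEq ?_).differentiableWithinAt
      filter_upwards [hgφ] with w hw
      by_cases hwz : w = z
      · simp [hwz]
      · have : (w - z) ^ k ≠ 0 := pow_ne_zero _ (sub_ne_zero.2 hwz)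
        simp only [hwz, if_false, hw, smul_eq_mul]
        field_simp
    · have : DifferentiableAt ℂ (fun w => φ w / (w - a) ^ k) z := by
        refine (hφ.differentiableAt (hO.mem_nhds hz)).div (by fun_prop) ?_
        exact pow_ne_zero _ (sub_ne_zero.2 hza)
      refine (this.congr_of_eventuallyEq ?_).differentiableWithinAt
      filter_upwards [isOpen_ne.mem_nhds hza] with w hw
      simp [show w ≠ a from hw]
  · intro w
    by_cases hwa : w = a
    · subst hwa
      simpa using hgφ.self_of_nhds
    · have : (w - a) ^ k ≠ 0 := pow_ne_zero _ (sub_ne_zero.2 hwa)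
      simp only [hwa, if_false]
      field_simp

theorem exists_zeros_multiset_aux {O : Set ℂ} (hO : IsOpen O) {c : ℂ} {r : ℝ} (hr : 0 < r)
    (hsub : Metric.closedBall c r ⊆ O) (s : Finset ℂ) : ∀ {φ : ℂ → ℂ},
    DifferentiableOn ℂ φ O → (∀ w ∈ Metric.sphere c r, φ w ≠ 0) →
    (∀ w ∈ Metric.closedBall c r, φ w = 0 ↔ w ∈ s) →
    ∃ m : Multiset ℂ, (∀ w ∈ m, w ∈ Metric.ball c r) ∧
      (∀ w ∈ Metric.closedBall c r, φ w = 0 ↔ w ∈ m) ∧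
      ∀ h : ℂ → ℂ, DifferentiableOn ℂ h O →
        (∮ w in C(c, r), h w * logDeriv φ w) = 2 * Real.pi * Complex.I * (m.map h).sum := by
  have hderiv : ∀ {φ : ℂ → ℂ}, DifferentiableOn ℂ φ O → DifferentiableOn ℂ (deriv φ) O :=
    fun h => h.deriv hO
  have hintgr : ∀ {φ h : ℂ → ℂ}, DifferentiableOn ℂ φ O → DifferentiableOn ℂ h O →
      (∀ w ∈ Metric.sphere c r, φ w ≠ 0) →
      CircleIntegrable (fun w => h w * logDeriv φ w) c r := by
    intro φ h hφ hh h0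
    refine ContinuousOn.circleIntegrable hr.le ?_
    have hs := Metric.sphere_subset_closedBall.trans hsub
    exact (hh.continuousOn.mono hs).mul
      (((hderiv hφ).continuousOn.mono hs).div (hφ.continuousOn.mono hs) h0)
  induction hn : s.card using Nat.strong_induction_on generalizing s with
  | _ n ih =>
  intro φ hφ h0 hs
  rcases s.eq_empty_or_nonempty with rfl | ⟨a, has⟩
  · refine ⟨0, by simp, by simpa using hs, fun h hh => ?_⟩
    have hd : DifferentiableOn ℂ (fun w => h w * logDeriv φ w) (Metric.closedBall c r) :=
      (hh.mono hsub).mul (((hderiv hφ).mono hsub).div (hφ.mono hsub) fun w hw => by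
        simpa using hs w hw)
    simpa using (hd.diffContOnCl_ball subset_rfl).circleIntegral_eq_zero hr.le
  by_cases hac : a ∈ Metric.closedBall c r
  swap
  · refine ih _ ?_ (s.erase a) rfl hφ h0 fun w hw => ?_
    · rw [← hn]; exact Finset.card_erase_lt_of_mem has
    · rw [hs w hw, Finset.mem_erase]
      exact ⟨fun h => ⟨by rintro rfl; exact hac hw, h⟩, fun h => h.2⟩
  have hφa : φ a = 0 := (hs a hac).2 has
  have hab : a ∈ Metric.ball c r := by
    rcases (Metric.mem_closedBall.1 hac).lt_or_eq with h | h
    · exact h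
    · exact absurd hφa (h0 a h)
  have hiso : ∀ᶠ w in 𝓝[≠] a, φ w ≠ 0 := by
    rw [eventually_nhdsWithin_iff]
    have : IsOpen ((s.erase a : Finset ℂ) : Set ℂ)ᶜ := (Finset.finite_toSet _).isClosed.isOpen_compl
    filter_upwards [this.mem_nhds (by simp : a ∈ ((s.erase a : Finset ℂ) : Set ℂ)ᶜ),
      Metric.isOpen_ball.mem_nhds hab] with w hw hwb hwa h
    exact hw (Finset.mem_coe.2 (Finset.mem_erase.2
      ⟨hwa, (hs w (Metric.ball_subset_closedBall hwb)).1 h⟩))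
  obtain ⟨k, u, hu, hua, hfac⟩ := exists_factor_of_isolated_zero hO hφ (hsub hac) hiso
  have hk : k ≠ 0 := by
    rintro rfl
    exact hua (by simpa [hφa] using (hfac a).symm)
  have hsa : ∀ w ∈ Metric.sphere c r, w ≠ a := by
    rintro w hw rfl
    exact h0 w hw hφa
  have hu0 : ∀ w ∈ Metric.sphere c r, u w ≠ 0 := fun w hw h => h0 w hw (by rw [hfac, h, mul_zero])
  obtain ⟨m, hmb, hmz, hmi⟩ := ih _ (hn ▸ Finset.card_erase_lt_of_mem has) (s.erase a) rfl hu hu0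
    (by
      intro w hw
      rw [Finset.mem_erase, ← hs w hw, hfac]
      constructor
      · intro h
        exact ⟨by rintro rfl; exact hua h, by rw [h, mul_zero]⟩
      · rintro ⟨hwa, h⟩
        exact (mul_eq_zero.1 h).resolve_left (pow_ne_zero _ (sub_ne_zero.2 hwa)))
  refine ⟨Multiset.replicate k a + m, ?_, ?_, fun h hh => ?_⟩
  · intro w hw
    rcases Multiset.mem_add.1 hw with hw | hw
    · rw [Multiset.eq_of_mem_replicate hw]; exact hab
    · exact hmb w hw
  · intro w hw
    rw [Multiset.mem_add, ← hmz w hw, hfac, mul_eq_zero, pow_eq_zero_iff hk, sub_eq_zero,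
      Multiset.mem_replicate]
    simp [hk]
  · have h1 : ∀ w ∈ Metric.sphere c r, h w * logDeriv φ w =
        (k : ℂ) • ((w - a)⁻¹ • h w) + h w * logDeriv u w := by
      intro w hw
      have hwO := hsub (Metric.sphere_subset_closedBall hw)
      have hφe : φ = fun w => (w - a) ^ k * u w := funext hfac
      rw [hφe, logDeriv_mul (f := fun w => (w - a) ^ k) w
        (pow_ne_zero k (sub_ne_zero.2 (hsa w hw))) (hu0 w hw) (by fun_prop)
        (hu.differentiableAt (hO.mem_nhds hwO)), logDeriv_fun_pow (by fun_prop)]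
      have : logDeriv (fun w : ℂ => w - a) w = (w - a)⁻¹ := by
        simp [logDeriv_apply]
      rw [this, smul_eq_mul, smul_eq_mul]
      ring
    have hi1 : CircleIntegrable (fun w => (w - a)⁻¹ • h w) c r := by
      refine ContinuousOn.circleIntegrable hr.le ?_
      refine ContinuousOn.smul (ContinuousOn.inv₀ (by fun_prop) fun w hw =>
        sub_ne_zero.2 (hsa w hw)) ?_
      exact hh.continuousOn.mono (Metric.sphere_subset_closedBall.trans hsub)
    rw [circleIntegral.integral_congr hr.le h1, circleIntegral.integral_add
      (hi1.const_fun_smul (a := (k : ℂ))) (hintgr hu hh hu0), hmi h hh,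
      circleIntegral.integral_smul,
      (hh.mono hsub).circleIntegral_sub_inv_smul hab]
    simp
    ring

theorem exists_zeros_multiset {O : Set ℂ} (hO : IsOpen O) {c : ℂ} {r : ℝ} (hr : 0 < r)
    (hsub : Metric.closedBall c r ⊆ O) {φ : ℂ → ℂ}
    (hφ : DifferentiableOn ℂ φ O) (h0 : ∀ w ∈ Metric.sphere c r, φ w ≠ 0) :
    ∃ m : Multiset ℂ, (∀ w ∈ m, w ∈ Metric.ball c r) ∧
      (∀ w ∈ Metric.closedBall c r, φ w = 0 ↔ w ∈ m) ∧
      ∀ h : ℂ → ℂ, DifferentiableOn ℂ h O →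
        (∮ w in C(c, r), h w * logDeriv φ w) = 2 * Real.pi * Complex.I * (m.map h).sum := by
  have hfin : {w | w ∈ Metric.closedBall c r ∧ φ w = 0}.Finite := by
    by_contra hinf
    obtain ⟨z, hz, hacc⟩ := Set.Infinite.exists_accPt_of_subset_isCompact hinf
      (isCompact_closedBall c r) fun w hw => hw.1
    rw [accPt_iff_frequently_nhdsNE] at hacc
    have han : AnalyticOnNhd ℂ φ (Metric.closedBall c r) := fun w hw =>
      hφ.analyticAt (hO.mem_nhds (hsub hw))
    have h2 := (han z hz).frequently_zero_iff_eventually_zero.1 (hacc.mono fun w hw => hw.2)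
    have hcr : c + r ∈ Metric.sphere c r := by simp [abs_of_pos hr]
    exact h0 _ hcr (han.eqOn_zero_of_preconnected_of_eventuallyEq_zero
      (convex_closedBall c r).isPreconnected hz h2 (Metric.sphere_subset_closedBall hcr))
  refine exists_zeros_multiset_aux hO hr hsub hfin.toFinset hφ h0 fun w hw => ?_
  simp only [Set.Finite.mem_toFinset, Set.mem_ofPred_eq, hw, true_and]

end Zeros

section LocalRoots

variable {V : Type} [NormedAddCommGroup V] [NormedSpace ℂ V]

theorem differentiableOn_prod_of_sum_pow {B : Set V} {d : ℕ} {β : V → Fin d → ℂ}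
    (h : ∀ k : ℕ, DifferentiableOn ℂ (fun y => ∑ i, β y i ^ k) B) :
    DifferentiableOn ℂ (fun y => ∏ i, β y i) B := by
  have key : ∀ k : ℕ, DifferentiableOn ℂ
      (fun y => MvPolynomial.aeval (β y) (MvPolynomial.esymm (Fin d) ℂ k)) B := by
    intro k
    induction k using Nat.strong_induction_on with
    | _ k ih =>
    rcases Nat.eq_zero_or_pos k with rfl | hk
    · simp
    have hN : ∀ y, MvPolynomial.aeval (β y) (MvPolynomial.esymm (Fin d) ℂ k) =
        (k : ℂ)⁻¹ * ((-1) ^ (k + 1) * ∑ a ∈ Finset.HasAntidiagonal.antidiagonal k with a.1 < k,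
          (-1) ^ a.1 * MvPolynomial.aeval (β y) (MvPolynomial.esymm (Fin d) ℂ a.1) *
            ∑ i, β y i ^ a.2) := by
      intro y
      have h1 := congrArg (MvPolynomial.aeval (β y)) (MvPolynomial.mul_esymm_eq_sum (Fin d) ℂ k)
      simp only [map_mul, map_natCast, map_sum, map_pow, map_neg, map_one, MvPolynomial.psum,
        MvPolynomial.aeval_X] at h1
      rw [← h1]
      have : (k : ℂ) ≠ 0 := by exact_mod_cast hk.ne'
      field_simp
    simp only [hN]
    refine DifferentiableOn.const_mul (DifferentiableOn.const_mul ?_ _) _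
    refine DifferentiableOn.fun_sum fun a ha => ?_
    rw [Finset.mem_filter] at ha
    exact ((ih a.1 ha.2).const_mul _).mul (h a.2)
  refine (key d).congr fun y _ => ?_
  have : MvPolynomial.esymm (Fin d) ℂ d = ∏ i, MvPolynomial.X i := by
    rw [MvPolynomial.esymm]
    have := Finset.powersetCard_self (Finset.univ : Finset (Fin d))
    rw [Finset.card_univ, Fintype.card_fin] at this
    rw [this]
    simp
  rw [this]
  simp

variable [FiniteDimensional ℂ V]

theorem exists_fin_of_card_eq {d : ℕ} {m : Multiset ℂ} (hm : m.card = d) :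
    ∃ α : Fin d → ℂ, (Finset.univ.val.map α : Multiset ℂ) = m := by
  subst hm
  induction m using Quotient.inductionOn with
  | _ l => exact ⟨l.get, by
      exact (Fin.univ_val_map _).trans (by rw [List.ofFn_get]; rfl)⟩

/-- The roots in the last variable of a holomorphic function, near a point where it does not
vanish identically along the fibre. -/
theorem exists_local_roots {O : Set (V × ℂ)} (hO : IsOpen O) {f : V × ℂ → ℂ}
    (hf : DifferentiableOn ℂ f O) {y₀ : V} {w₀ : ℂ} (h₀ : (y₀, w₀) ∈ O)
    (hne : ¬ ∀ᶠ w in 𝓝 w₀, f (y₀, w) = 0) {ε : ℝ} (hε : 0 < ε) :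
    ∃ r > 0, r < ε ∧ ∃ ρ > 0, Metric.ball y₀ ρ ×ˢ Metric.closedBall w₀ r ⊆ O ∧
      ∃ (d : ℕ) (α : V → Fin d → ℂ),
        (∀ y ∈ Metric.ball y₀ ρ, ∀ i, α y i ∈ Metric.ball w₀ r) ∧
        (∀ y ∈ Metric.ball y₀ ρ, ∀ w ∈ Metric.closedBall w₀ r, f (y, w) = 0 ↔ ∃ i, α y i = w) ∧
        ∀ h : V × ℂ → ℂ, DifferentiableOn ℂ h O →
          DifferentiableOn ℂ (fun y => ∏ i, h (y, α y i)) (Metric.ball y₀ ρ) := by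
  have hslice : ∀ y : V, IsOpen {w : ℂ | (y, w) ∈ O} := fun y => hO.preimage (by fun_prop)
  have hdslice : ∀ {h : V × ℂ → ℂ}, DifferentiableOn ℂ h O → ∀ y : V,
      DifferentiableOn ℂ (fun w => h (y, w)) {w : ℂ | (y, w) ∈ O} := fun hh y =>
    hh.comp (by fun_prop) fun w hw => hw
  -- choice of the radius
  obtain ⟨r, hr, hrε, hrO, hr0⟩ : ∃ r > 0, r < ε ∧ (∀ w ∈ Metric.closedBall w₀ r, (y₀, w) ∈ O) ∧
      ∀ w ∈ Metric.sphere w₀ r, f (y₀, w) ≠ 0 := by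
    have h1 := (((hdslice hf y₀).analyticAt
      ((hslice y₀).mem_nhds h₀)).eventually_eq_zero_or_eventually_ne_zero).resolve_left hne
    rw [eventually_nhdsWithin_iff] at h1
    obtain ⟨δ, hδ, h2⟩ := Metric.eventually_nhds_iff_ball.1 (h1.and ((hslice y₀).mem_nhds h₀))
    refine ⟨min (δ / 2) (ε / 2), by positivity, ?_, fun w hw => (h2 w ?_).2, fun w hw => (h2 w ?_).1 ?_⟩
    · exact (min_le_right _ _).trans_lt (by linarith)
    · exact Metric.closedBall_subset_ball ((min_le_left _ _).trans_lt (by linarith)) hw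
    · exact Metric.closedBall_subset_ball ((min_le_left _ _).trans_lt (by linarith))
        (Metric.sphere_subset_closedBall hw)
    · rintro rfl
      have : (0 : ℝ) = min (δ / 2) (ε / 2) := by simpa using hw
      have : 0 < min (δ / 2) (ε / 2) := by positivity
      linarith
  obtain ⟨ρ₁, hρ₁, hρO⟩ : ∃ ρ > 0, ∀ y ∈ Metric.ball y₀ ρ,
      ∀ w ∈ Metric.closedBall w₀ r, (y, w) ∈ O := by
    obtain ⟨u, v, hu, hv, hyu, hv', huv⟩ := generalized_tube_lemma (isCompact_singleton (x := y₀))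
      (isCompact_closedBall w₀ r) hO (by
        rintro ⟨y, w⟩ ⟨hy, hw⟩
        obtain rfl : y = y₀ := hy
        exact hrO w hw)
    obtain ⟨ρ, hρ, hρu⟩ := Metric.isOpen_iff.1 hu y₀ (hyu rfl)
    exact ⟨ρ, hρ, fun y hy w hw => huv ⟨hρu hy, hv' hw⟩⟩
  obtain ⟨ρ₂, hρ₂, hρ0⟩ : ∃ ρ > 0, ∀ y ∈ Metric.ball y₀ ρ,
      ∀ w ∈ Metric.sphere w₀ r, f (y, w) ≠ 0 := by
    obtain ⟨u, v, hu, hv, hyu, hv', huv⟩ := generalized_tube_lemma (isCompact_singleton (x := y₀))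
      (isCompact_sphere w₀ r)
      (hf.continuousOn.isOpen_inter_preimage hO (isOpen_compl_singleton (x := (0 : ℂ)))) (by
        rintro ⟨y, w⟩ ⟨hy, hw⟩
        obtain rfl : y = y₀ := hy
        exact ⟨hrO w (Metric.sphere_subset_closedBall hw), hr0 w hw⟩)
    obtain ⟨ρ, hρ, hρu⟩ := Metric.isOpen_iff.1 hu y₀ (hyu rfl)
    exact ⟨ρ, hρ, fun y hy w hw => (huv ⟨hρu hy, hv' hw⟩).2⟩
  have hB : Metric.ball y₀ (min ρ₁ ρ₂) ×ˢ Metric.closedBall w₀ r ⊆ O := fun q hq =>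
    hρO q.1 (Metric.ball_subset_ball (min_le_left _ _) hq.1) q.2 hq.2
  have hB0 : ∀ y ∈ Metric.ball y₀ (min ρ₁ ρ₂), ∀ w ∈ Metric.sphere w₀ r, f (y, w) ≠ 0 :=
    fun y hy => hρ0 y (Metric.ball_subset_ball (min_le_right _ _) hy)
  have hmult : ∀ y : V, ∃ m : Multiset ℂ, y ∈ Metric.ball y₀ (min ρ₁ ρ₂) →
      (∀ w ∈ m, w ∈ Metric.ball w₀ r) ∧
      (∀ w ∈ Metric.closedBall w₀ r, f (y, w) = 0 ↔ w ∈ m) ∧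
      ∀ h : V × ℂ → ℂ, DifferentiableOn ℂ h O →
        (∮ w in C(w₀, r), h (y, w) * (fderiv ℂ f (y, w) (0, 1) / f (y, w))) =
          2 * Real.pi * Complex.I * (m.map fun w => h (y, w)).sum := by
    intro y
    by_cases hy : y ∈ Metric.ball y₀ (min ρ₁ ρ₂)
    swap
    · exact ⟨0, fun h => absurd h hy⟩
    obtain ⟨m, h1, h2, h3⟩ := exists_zeros_multiset (hslice y) hr (fun w hw => hB ⟨hy, hw⟩)
      (hdslice hf y) (hB0 y hy)
    refine ⟨m, fun _ => ⟨h1, h2, fun h hh => ?_⟩⟩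
    rw [← h3 _ (hdslice hh y)]
    refine circleIntegral.integral_congr hr.le fun w hw => ?_
    have hwO : (y, w) ∈ O := hB ⟨hy, Metric.sphere_subset_closedBall hw⟩
    have hcomp : HasDerivAt (fun w => f (y, w)) (fderiv ℂ f (y, w) (0, 1)) w := by
      have h4 : HasDerivAt (fun w : ℂ => (y, w)) ((0 : V), (1 : ℂ)) w :=
        (hasDerivAt_const w y).prodMk (hasDerivAt_id w)
      exact (hf.differentiableAt (hO.mem_nhds hwO)).hasFDerivAt.comp_hasDerivAt w h4
    simp only [logDeriv_apply, hcomp.deriv]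
  choose m hm using hmult
  have hfd : DifferentiableOn ℂ (fun q => fderiv ℂ f q ((0 : V), (1 : ℂ))) O :=
    hf.fderiv_apply_of_isOpen hO _
  have hsum : ∀ h : V × ℂ → ℂ, DifferentiableOn ℂ h O →
      DifferentiableOn ℂ (fun y => ((m y).map fun w => h (y, w)).sum)
        (Metric.ball y₀ (min ρ₁ ρ₂)) := by
    intro h hh
    have h1 : DifferentiableOn ℂ (fun y => ∮ w in C(w₀, r),
        h (y, w) * (fderiv ℂ f (y, w) (0, 1) / f (y, w))) (Metric.ball y₀ (min ρ₁ ρ₂)) := by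
      refine differentiableOn_circleIntegral_param (V := V)
        (G := fun y w => h (y, w) * (fderiv ℂ f (y, w) (0, 1) / f (y, w)))
        Metric.isOpen_ball hr.le ?_ ?_
      · have hs : Metric.ball y₀ (min ρ₁ ρ₂) ×ˢ Metric.sphere w₀ r ⊆ O := fun q hq =>
          hB ⟨hq.1, Metric.sphere_subset_closedBall hq.2⟩
        exact (hh.continuousOn.mono hs).mul ((hfd.continuousOn.mono hs).div
          (hf.continuousOn.mono hs) fun q hq => hB0 q.1 hq.1 q.2 hq.2)
      · intro w hw
        have hmaps : Set.MapsTo (fun y : V => (y, w)) (Metric.ball y₀ (min ρ₁ ρ₂)) O :=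
          fun y hy => hB ⟨hy, Metric.sphere_subset_closedBall hw⟩
        have hd : DifferentiableOn ℂ (fun y : V => (y, w)) (Metric.ball y₀ (min ρ₁ ρ₂)) := by
          fun_prop
        have a1 := hh.comp hd hmaps
        have a2 := hfd.comp hd hmaps
        have a3 := hf.comp hd hmaps
        simp only [div_eq_mul_inv]
        exact a1.mul (a2.mul (a3.inv fun y hy => hB0 y hy w hw))
    refine (h1.const_mul (2 * Real.pi * Complex.I)⁻¹).congr fun y hy => ?_
    rw [(hm y hy).2.2 h hh, ← mul_assoc, inv_mul_cancel₀ Complex.two_pi_I_ne_zero, one_mul]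
  obtain ⟨ρ, hρ, hρle, hcard⟩ : ∃ ρ > 0, ρ ≤ min ρ₁ ρ₂ ∧ ∀ y ∈ Metric.ball y₀ ρ,
      (m y).card = (m y₀).card := by
    have hmem : y₀ ∈ Metric.ball y₀ (min ρ₁ ρ₂) := Metric.mem_ball_self (by positivity)
    have h1 := ((hsum (fun _ => 1) (differentiableOn_const _)).continuousOn.continuousAt
      (Metric.isOpen_ball.mem_nhds hmem)).tendsto
    obtain ⟨δ, hδ, h2⟩ := Metric.eventually_nhds_iff_ball.1 (Metric.tendsto_nhds.1 h1 1 one_pos)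
    refine ⟨min δ (min ρ₁ ρ₂), by positivity, min_le_right _ _, fun y hy => ?_⟩
    have h3 := h2 y (Metric.ball_subset_ball (min_le_left _ _) hy)
    simp only [Multiset.map_const', Multiset.sum_replicate, nsmul_eq_mul, mul_one,
      dist_eq_norm] at h3
    have h4 : ‖(((m y).card - (m y₀).card : ℤ) : ℂ)‖ < 1 := by exact_mod_cast h3
    rw [Complex.norm_intCast] at h4
    have h5 : |((m y).card - (m y₀).card : ℤ)| < 1 := by exact_mod_cast h4
    rw [Int.abs_lt_one_iff] at h5
    omega
  have hα : ∀ y : V, ∃ α : Fin (m y₀).card → ℂ, y ∈ Metric.ball y₀ ρ →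
      (Finset.univ.val.map α : Multiset ℂ) = m y := by
    intro y
    by_cases hy : y ∈ Metric.ball y₀ ρ
    · obtain ⟨α, hα⟩ := exists_fin_of_card_eq (hcard y hy)
      exact ⟨α, fun _ => hα⟩
    · exact ⟨0, fun h => absurd h hy⟩
  choose α hα using hα
  have hmemα : ∀ y ∈ Metric.ball y₀ ρ, ∀ w, w ∈ m y ↔ ∃ i, α y i = w := by
    intro y hy w
    rw [← hα y hy]
    simp
  have hsub := Metric.ball_subset_ball (x := y₀) hρle
  refine ⟨r, hr, hrε, ρ, hρ, (Set.prod_mono_left hsub).trans hB, _, α, ?_, ?_, fun h hh => ?_⟩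
  · exact fun y hy i => (hm y (hsub hy)).1 _ ((hmemα y hy _).2 ⟨i, rfl⟩)
  · exact fun y hy w hw => ((hm y (hsub hy)).2.1 w hw).trans (hmemα y hy w)
  · refine differentiableOn_prod_of_sum_pow (β := fun y i => h (y, α y i)) fun k => ?_
    refine ((hsum _ (hh.pow k)).mono hsub).congr fun y hy => ?_
    rw [← hα y hy, Multiset.map_map]
    rfl

end LocalRoots

section Projection

theorem exists_forall_eq_zero_iff_prod {d N : ℕ} (c : Fin d → Fin N → ℂ) :
    (∃ j, ∀ i, c j i = 0) ↔
      ∀ l : Fin (d * N + 1), ∏ j, ∑ i : Fin N, ((l : ℕ) : ℂ) ^ (i : ℕ) * c j i = 0 := by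
  constructor
  · rintro ⟨j, hj⟩ l
    exact Finset.prod_eq_zero (Finset.mem_univ j) (by simp [hj])
  · intro h
    set P : Fin d → Polynomial ℂ := fun j => ∑ i : Fin N, Polynomial.C (c j i) * Polynomial.X ^ (i : ℕ)
      with hP
    have hdeg : (∏ j, P j).natDegree ≤ d * N := by
      refine (Polynomial.natDegree_prod_le _ _).trans ?_
      refine (Finset.sum_le_card_nsmul _ _ N fun j _ => ?_).trans (by simp)
      refine Polynomial.natDegree_sum_le_of_forall_le _ _ fun i _ => ?_
      exact (Polynomial.natDegree_C_mul_X_pow_le _ _).trans i.2.le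
    have h0 : ∏ j, P j = 0 := by
      refine Polynomial.eq_zero_of_natDegree_lt_card_of_eval_eq_zero _
        (f := fun l : Fin (d * N + 1) => ((l : ℕ) : ℂ)) ?_ ?_ ?_
      · intro a b hab
        exact Fin.ext (Nat.cast_injective hab)
      · intro l
        rw [Polynomial.eval_prod, ← h l]
        refine Finset.prod_congr rfl fun j _ => ?_
        rw [hP, Polynomial.eval_finsetSum]
        exact Finset.sum_congr rfl fun i _ => by
          rw [Polynomial.eval_mul, Polynomial.eval_C, Polynomial.eval_pow, Polynomial.eval_X, mul_comm]
      · simpa using Nat.lt_succ_of_le hdeg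
    obtain ⟨j, -, hj⟩ := Finset.prod_eq_zero_iff.1 h0
    refine ⟨j, fun i => ?_⟩
    have := congrArg (fun p => p.coeff (i : ℕ)) hj
    simpa [hP, Polynomial.finsetSum_coeff, Polynomial.coeff_C_mul, Polynomial.coeff_X_pow,
      Fin.val_inj] using this

theorem IsAnalyticIn.finite_of_isCompact {F : Set ℂ} (hA : IsAnalyticIn Set.univ F)
    (hF : IsCompact F) : F.Finite := by
  by_contra hinf
  obtain ⟨z, hz, hacc⟩ := Set.Infinite.exists_accPt_of_subset_isCompact hinf hF subset_rfl
  rw [accPt_iff_frequently_nhdsNE] at hacc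
  obtain ⟨U, hU, hzU, N, g, hg, hgF⟩ := hA.exists_eqns (Set.mem_univ z)
  have h1 : ∀ i, ∀ᶠ w in 𝓝 z, g i w = 0 := fun i => by
    refine ((hg i).analyticAt (hU.mem_nhds hzU)).frequently_zero_iff_eventually_zero.1 ?_
    refine (hacc.and_eventually (nhdsWithin_le_nhds (hU.mem_nhds hzU))).mono fun w hw => ?_
    exact (hgF w hw.2).1 hw.1 i
  have h2 : z ∈ interior F := by
    rw [mem_interior_iff_mem_nhds]
    filter_upwards [eventually_all.2 h1, hU.mem_nhds hzU] with w hw hwU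
    exact (hgF w hwU).2 hw
  have h3 := hA.eq_of_interior_nonempty isPreconnected_univ ⟨z, h2⟩
  exact noncompact_univ ℂ (h3 ▸ hF)

variable {V : Type} [NormedAddCommGroup V] [NormedSpace ℂ V]

theorem IsAnalyticIn.zeroSet {Ω : Set V} (hΩ : IsOpen Ω) {f : V → ℂ} (hf : DifferentiableOn ℂ f Ω) :
    IsAnalyticIn Ω {x ∈ Ω | f x = 0} :=
  .of_finite (fun _ hx => hx.1) fun z hz => ⟨Ω, hΩ, hz, Unit, inferInstance, fun _ => f,
    fun _ => hf, fun x hx => by simp [hx]⟩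

theorem ProperProjOn.isCompact_fiber {A B : Type} [TopologicalSpace A] [TopologicalSpace B]
    {U : Set A} {K : Set (A × B)} (hp : ProperProjOn U K) {y : A} (hy : y ∈ U) :
    IsCompact {w | (y, w) ∈ K} := by
  have h := (hp {y} (by simpa using hy) isCompact_singleton).image continuous_snd
  convert h using 1
  ext w
  constructor
  · intro hw
    exact ⟨(y, w), ⟨hw, rfl⟩, rfl⟩
  · rintro ⟨⟨y', w'⟩, ⟨h1, h2⟩, rfl⟩
    obtain rfl : y' = y := h2
    exact h1

theorem finite_fiber_one {U : Set V} {K : Set (V × ℂ)}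
    (hK : IsAnalyticIn (U ×ˢ Set.univ) K) (hp : ProperProjOn U K) {y : V} (hy : y ∈ U) :
    {w | (y, w) ∈ K}.Finite := by
  refine IsAnalyticIn.finite_of_isCompact ?_ (hp.isCompact_fiber hy)
  have := hK.preimage (Ω' := Set.univ) isOpen_univ (f := fun w : ℂ => (y, w)) (by fun_prop)
    fun w _ => ⟨hy, trivial⟩
  rwa [Set.univ_inter] at this

variable [FiniteDimensional ℂ V]

theorem ProperProjOn.exists_ball {B : Type} [TopologicalSpace B] {U : Set V} (hU : IsOpen U)
    {K : Set (V × B)} (hp : ProperProjOn U K) {y₀ : V} (hy₀ : y₀ ∈ U) {O : Set (V × B)}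
    (hO : IsOpen O) (h : ∀ w, (y₀, w) ∈ K → (y₀, w) ∈ O) :
    ∃ ρ > 0, Metric.ball y₀ ρ ⊆ U ∧ ∀ p ∈ K, p.1 ∈ Metric.ball y₀ ρ → p ∈ O := by
  have := FiniteDimensional.proper ℂ V
  obtain ⟨δ, hδ, hδU⟩ := Metric.nhds_basis_closedBall.mem_iff.1 (hU.mem_nhds hy₀)
  have hC := ((hp _ hδU (isCompact_closedBall y₀ δ)).diff hO).image continuous_fst
  have hmem : y₀ ∈ (Prod.fst '' ({p | p ∈ K ∧ p.1 ∈ Metric.closedBall y₀ δ} \ O))ᶜ := by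
    rintro ⟨⟨y, w⟩, ⟨⟨hK, -⟩, hnO⟩, rfl⟩
    exact hnO (h w hK)
  obtain ⟨ρ, hρ, hρs⟩ := Metric.isOpen_iff.1 hC.isClosed.isOpen_compl y₀ hmem
  refine ⟨min ρ δ, by positivity, ?_, fun p hpK hpb => ?_⟩
  · exact (Metric.ball_subset_ball (min_le_right _ _)).trans (Metric.ball_subset_closedBall.trans hδU)
  · by_contra hpO
    exact hρs (Metric.ball_subset_ball (min_le_left _ _) hpb) ⟨p, ⟨⟨hpK, Metric.ball_subset_closedBall
      (Metric.ball_subset_ball (min_le_right _ _) hpb)⟩, hpO⟩, rfl⟩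

theorem isAnalyticIn_image_fst_one {U : Set V} (hU : IsOpen U) {K : Set (V × ℂ)}
    (hK : IsAnalyticIn (U ×ˢ Set.univ) K) (hp : ProperProjOn U K) :
    IsAnalyticIn U (Prod.fst '' K) := by
  refine .of_local ?_ fun y₀ hy₀ => ?_
  · rintro _ ⟨p, hp, rfl⟩
    exact (hK.1 hp).1
  have hF := finite_fiber_one hK hp hy₀
  have hloc : ∀ a ∈ {w | (y₀, w) ∈ K}, ∃ r > 0, ∃ ρ > 0,
      IsAnalyticIn (Metric.ball y₀ ρ) {y ∈ Metric.ball y₀ ρ | ∃ w ∈ Metric.ball a r, (y, w) ∈ K} := by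
    intro a ha
    obtain ⟨O, hO, haO, N, g, hg, hgK⟩ := hK.exists_eqns (hK.1 ha)
    obtain ⟨i₀, hi₀⟩ : ∃ i, ¬ ∀ᶠ w in 𝓝 a, g i (y₀, w) = 0 := by
      by_contra! hc
      have hO' : ∀ᶠ w in 𝓝 a, (y₀, w) ∈ O := (hO.preimage (by fun_prop :
        Continuous fun w : ℂ => (y₀, w))).mem_nhds haO
      have : {w | (y₀, w) ∈ K} ∈ 𝓝 a := by
        filter_upwards [eventually_all.2 hc, hO'] with w h1 h2
        exact (hgK _ h2).2 h1
      exact infinite_of_mem_nhds a this hF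
    obtain ⟨r, hr, -, ρ, hρ, hsub, d, α, hα, hαz, hαd⟩ :=
      exists_local_roots hO (hg i₀) haO hi₀ one_pos
    refine ⟨r, hr, ρ, hρ, .of_finite (fun _ h => h.1) fun z hz => ⟨_, Metric.isOpen_ball, hz,
      Fin (d * N + 1), inferInstance,
      fun l y => ∏ j, ∑ i : Fin N, ((l : ℕ) : ℂ) ^ (i : ℕ) * g i (y, α y j), fun l => ?_, fun y hy => ?_⟩⟩
    · exact hαd (fun q => ∑ i : Fin N, ((l : ℕ) : ℂ) ^ (i : ℕ) * g i q)
        (DifferentiableOn.fun_sum fun i _ => (hg i).const_mul _)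
    · refine Iff.trans ?_ (exists_forall_eq_zero_iff_prod fun j i => g i (y, α y j))
      constructor
      · rintro ⟨-, w, hw, hwK⟩
        have hw' := Metric.ball_subset_closedBall hw
        have h1 := (hgK _ (hsub ⟨hy, hw'⟩)).1 hwK
        obtain ⟨j, rfl⟩ := (hαz y hy w hw').1 (h1 i₀)
        exact ⟨j, h1⟩
      · rintro ⟨j, hj⟩
        exact ⟨hy, α y j, hα y hy j, (hgK _ (hsub ⟨hy, Metric.ball_subset_closedBall (hα y hy j)⟩)).2 hj⟩
  choose! r hr ρ hρ hA using hloc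
  obtain ⟨ρ', hρ', hρU, hρO⟩ := hp.exists_ball hU hy₀
    (O := ⋃ a ∈ {w | (y₀, w) ∈ K}, Set.univ ×ˢ Metric.ball a (r a))
    (isOpen_biUnion fun a _ => isOpen_univ.prod Metric.isOpen_ball)
    (fun w hw => Set.mem_biUnion hw ⟨trivial, Metric.mem_ball_self (hr w hw)⟩)
  obtain ⟨δ, hδ0, hδρ, hδ⟩ : ∃ δ > 0, δ ≤ ρ' ∧ ∀ a ∈ {w | (y₀, w) ∈ K}, δ ≤ ρ a := by
    have h1 : ∀ᶠ δ : ℝ in 𝓝[>] 0, ∀ a ∈ {w | (y₀, w) ∈ K}, δ ≤ ρ a := by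
      rw [eventually_all_finite hF]
      exact fun a ha => nhdsWithin_le_nhds (ge_mem_nhds (hρ a ha))
    have h2 : ∀ᶠ δ : ℝ in 𝓝[>] 0, δ ≤ ρ' := nhdsWithin_le_nhds (ge_mem_nhds hρ')
    obtain ⟨δ, h2, h3, h4⟩ := (h1.and (h2.and self_mem_nhdsWithin)).exists
    exact ⟨δ, h4, h3, h2⟩
  refine ⟨Metric.ball y₀ δ, Metric.isOpen_ball, Metric.mem_ball_self hδ0, ?_⟩
  have hbi := IsAnalyticIn.biUnion hF fun a ha => (hA a ha).restrict
    (Metric.isOpen_ball (x := y₀) (ε := δ)) (Metric.ball_subset_ball (hδ a ha))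
  convert hbi using 1
  ext y
  rw [Set.mem_iUnion₂]
  constructor
  · rintro ⟨hy, ⟨y, w⟩, hw, rfl⟩
    obtain ⟨a, ha, hwa⟩ := Set.mem_iUnion₂.1 (hρO _ hw (Metric.ball_subset_ball hδρ hy))
    exact ⟨a, ha, hy, Metric.ball_subset_ball (hδ a ha) hy, w, hwa.2, hw⟩
  · rintro ⟨a, ha, hy, -, w, -, hw⟩
    exact ⟨hy, (y, w), hw, rfl⟩

/-- Images of analytic sets under proper projections with fibre in `ℂ^s`. -/
theorem isAnalyticIn_image_fst_and_finite_fiber (s : ℕ) : ∀ {V : Type} [NormedAddCommGroup V]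
    [NormedSpace ℂ V] [FiniteDimensional ℂ V] {U : Set V} (_ : IsOpen U)
    {K : Set (V × (Fin s → ℂ))} (_ : IsAnalyticIn (U ×ˢ Set.univ) K) (_ : ProperProjOn U K),
    IsAnalyticIn U (Prod.fst '' K) ∧ ∀ y ∈ U, {w | (y, w) ∈ K}.Finite := by
  induction s with
  | zero =>
    intro V _ _ _ U hU K hK hp
    refine ⟨?_, fun y _ => Set.toFinite _⟩
    have h := hK.preimage hU (f := fun y : V => (y, (0 : Fin 0 → ℂ))) (by fun_prop)
      fun y hy => ⟨hy, trivial⟩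
    convert h using 1
    ext y
    constructor
    · rintro ⟨⟨y, w⟩, hw, rfl⟩
      rw [Subsingleton.elim w 0] at hw
      exact ⟨(hK.1 hw).1, hw⟩
    · rintro ⟨-, hy⟩
      exact ⟨_, hy, rfl⟩
  | succ s ih =>
    intro V _ _ _ U hU K hK hp
    set θ : (V × (Fin s → ℂ)) × ℂ → V × (Fin (s + 1) → ℂ) := fun q =>
      (q.1.1, Fin.cons q.2 q.1.2) with hθ
    set η : V × (Fin (s + 1) → ℂ) → (V × (Fin s → ℂ)) × ℂ := fun p =>
      ((p.1, Fin.tail p.2), p.2 0) with hη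
    have hθη : ∀ p, θ (η p) = p := fun p => by simp [hθ, hη, Fin.cons_self_tail]
    have hηθ : ∀ q, η (θ q) = q := fun q => by simp [hθ, hη]
    have hθd : Differentiable ℂ θ := by
      refine Differentiable.prodMk (by fun_prop) (differentiable_pi.2 fun i => ?_)
      refine Fin.cases ?_ (fun j => ?_) i
      · simp only [Fin.cons_zero]; fun_prop
      · simp only [Fin.cons_succ]; fun_prop
    have hηc : Continuous η := by
      refine Continuous.prodMk (Continuous.prodMk continuous_fst (continuous_pi fun i => ?_)) ?_
      · simp only [Fin.tail]; fun_prop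
      · fun_prop
    have hU' : IsOpen (U ×ˢ (Set.univ : Set (Fin s → ℂ))) := hU.prod isOpen_univ
    have hK' := hK.preimage (Ω' := (U ×ˢ (Set.univ : Set (Fin s → ℂ))) ×ˢ (Set.univ : Set ℂ))
      (hU'.prod isOpen_univ) (f := θ) hθd.differentiableOn fun q hq => ⟨hq.1.1, trivial⟩
    have hKsub : ((U ×ˢ (Set.univ : Set (Fin s → ℂ))) ×ˢ (Set.univ : Set ℂ)) ∩ θ ⁻¹' K =
        θ ⁻¹' K := Set.inter_eq_right.2 fun q hq => ⟨⟨(hK.1 hq).1, trivial⟩, trivial⟩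
    rw [hKsub] at hK'
    have hp' : ProperProjOn (U ×ˢ (Set.univ : Set (Fin s → ℂ))) (θ ⁻¹' K) := by
      intro C hC hCc
      have h1 := hp (Prod.fst '' C) (by rintro _ ⟨c, hc, rfl⟩; exact (hC hc).1)
        (hCc.image continuous_fst)
      have h2 := ((h1.image hηc).inter_right (hCc.isClosed.preimage continuous_fst))
      convert h2 using 1
      ext q
      constructor
      · rintro ⟨hq, hqC⟩
        exact ⟨⟨θ q, ⟨hq, ⟨_, hqC, rfl⟩⟩, hηθ q⟩, hqC⟩
      · rintro ⟨⟨p, ⟨hpK, -⟩, rfl⟩, hqC⟩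
        exact ⟨by rw [Set.mem_preimage, hθη]; exact hpK, hqC⟩
    have h1 := isAnalyticIn_image_fst_one hU' hK' hp'
    have hmem : ∀ y v, (y, v) ∈ Prod.fst '' (θ ⁻¹' K) ↔ ∃ w : ℂ, (y, Fin.cons w v) ∈ K := by
      intro y v
      constructor
      · rintro ⟨⟨q, w⟩, hq, rfl⟩
        exact ⟨w, hq⟩
      · rintro ⟨w, hw⟩
        exact ⟨((y, v), w), hw, rfl⟩
    have hp'' : ProperProjOn U (Prod.fst '' (θ ⁻¹' K)) := by
      intro C hC hCc
      have h2 := (hp C hC hCc).image (continuous_fst.comp hηc)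
      convert h2 using 1
      ext ⟨y, v⟩
      constructor
      · rintro ⟨h, hy⟩
        obtain ⟨w, hw⟩ := (hmem y v).1 h
        exact ⟨_, ⟨hw, hy⟩, by simp [hη]⟩
      · rintro ⟨p, ⟨hpK, hpC⟩, h⟩
        refine ⟨⟨η p, by rw [Set.mem_preimage, hθη]; exact hpK, h⟩, ?_⟩
        rw [← h]; exact hpC
    obtain ⟨h2, h3⟩ := ih hU h1 hp''
    constructor
    · convert h2 using 1
      rw [Set.image_image]
      ext y
      constructor
      · rintro ⟨p, hpK, rfl⟩
        exact ⟨η p, by rw [Set.mem_preimage, hθη]; exact hpK, rfl⟩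
      · rintro ⟨q, hq, rfl⟩
        exact ⟨θ q, hq, rfl⟩
    · intro y hy
      have h4 : (⋃ v ∈ {v | (y, v) ∈ Prod.fst '' (θ ⁻¹' K)},
          (fun w : ℂ => (Fin.cons w v : Fin (s + 1) → ℂ)) '' {w | ((y, v), w) ∈ θ ⁻¹' K}).Finite :=
        (h3 y hy).biUnion fun v _ => (finite_fiber_one hK' hp' (y := (y, v)) ⟨hy, trivial⟩).image _
      refine h4.subset fun u hu => ?_
      have hu' : (y, (Fin.cons (u 0) (Fin.tail u) : Fin (s + 1) → ℂ)) ∈ K := by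
        rw [Fin.cons_self_tail]; exact hu
      exact Set.mem_biUnion (x := Fin.tail u) ((hmem _ _).2 ⟨_, hu'⟩)
        ⟨u 0, hu', Fin.cons_self_tail u⟩

end Projection

section LinearImage

variable {V : Type} [NormedAddCommGroup V] [NormedSpace ℂ V] [FiniteDimensional ℂ V] {s : ℕ}

theorem IsAnalyticIn.image_linear {U : Set V} (hU : IsOpen U) {K : Set (V × (Fin s → ℂ))}
    (hK : IsAnalyticIn (U ×ˢ Set.univ) K) (hp : ProperProjOn U K) (L : (Fin s → ℂ) →ₗ[ℂ] ℂ) :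
    IsAnalyticIn (U ×ˢ Set.univ) ((fun p : V × (Fin s → ℂ) => (p.1, L p.2)) '' K) := by
  set L' : (Fin s → ℂ) →L[ℂ] ℂ := L.toContinuousLinearMap with hL'
  have hLL : ∀ v, L v = L' v := fun v => rfl
  simp only [hLL]
  have hU' : IsOpen (U ×ˢ (Set.univ : Set ℂ)) := hU.prod isOpen_univ
  have hΩ : IsOpen ((U ×ˢ (Set.univ : Set ℂ)) ×ˢ (Set.univ : Set (Fin s → ℂ))) :=
    hU'.prod isOpen_univ
  have h1 := (hK.preimage hΩ (f := fun q : (V × ℂ) × (Fin s → ℂ) => (q.1.1, q.2))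
    (by fun_prop) fun q hq => ⟨hq.1.1, trivial⟩).inter
    (IsAnalyticIn.zeroSet hΩ (f := fun q => L' q.2 - q.1.2) (by fun_prop))
  have hset : (((U ×ˢ (Set.univ : Set ℂ)) ×ˢ (Set.univ : Set (Fin s → ℂ))) ∩
      (fun q : (V × ℂ) × (Fin s → ℂ) => (q.1.1, q.2)) ⁻¹' K) ∩
      {q ∈ (U ×ˢ (Set.univ : Set ℂ)) ×ˢ (Set.univ : Set (Fin s → ℂ)) | L' q.2 - q.1.2 = 0} =
      (fun p : V × (Fin s → ℂ) => ((p.1, L' p.2), p.2)) '' K := by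
    ext ⟨⟨x, w⟩, v⟩
    constructor
    · rintro ⟨⟨-, h⟩, -, h'⟩
      exact ⟨(x, v), h, by simpa using sub_eq_zero.1 h'⟩
    · rintro ⟨p, hpK, h⟩
      simp only [Prod.mk.injEq] at h
      obtain ⟨⟨rfl, rfl⟩, rfl⟩ := h
      have hx := (hK.1 hpK).1
      exact ⟨⟨⟨⟨hx, trivial⟩, trivial⟩, hpK⟩, ⟨⟨hx, trivial⟩, trivial⟩, sub_self _⟩
  rw [hset] at h1
  have h2 : ProperProjOn (U ×ˢ (Set.univ : Set ℂ))
      ((fun p : V × (Fin s → ℂ) => ((p.1, L' p.2), p.2)) '' K) := by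
    intro C hC hCc
    have a1 := (hp (Prod.fst '' C) (by rintro _ ⟨c, hc, rfl⟩; exact (hC hc).1)
        (hCc.image continuous_fst)).image
        (by fun_prop : Continuous fun p : V × (Fin s → ℂ) => ((p.1, L' p.2), p.2))
    have a2 := a1.inter_right (hCc.isClosed.preimage continuous_fst)
    convert a2 using 1
    ext q
    constructor
    · rintro ⟨⟨p, hpK, rfl⟩, hqC⟩
      exact ⟨⟨p, ⟨hpK, ⟨_, hqC, rfl⟩⟩, rfl⟩, hqC⟩
    · rintro ⟨⟨p, ⟨hpK, -⟩, rfl⟩, hqC⟩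
      exact ⟨⟨p, hpK, rfl⟩, hqC⟩
  have h3 := (isAnalyticIn_image_fst_and_finite_fiber s hU' h1 h2).1
  rwa [Set.image_image] at h3

end LinearImage

section OpenImage

theorem DifferentiableOn.hasStrictFDerivAt_of_isOpen {V : Type} [NormedAddCommGroup V]
    [NormedSpace ℂ V] [FiniteDimensional ℂ V] {Ω : Set V} (hΩ : IsOpen Ω) {f : V → ℂ}
    (hf : DifferentiableOn ℂ f Ω) {t : V} (ht : t ∈ Ω) :
    HasStrictFDerivAt f (fderiv ℂ f t) t := by
  refine hasStrictFDerivAt_of_hasFDerivAt_of_continuousAt (f' := fderiv ℂ f) ?_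
    ((hf.continuousOn_fderiv_of_isOpen hΩ).continuousAt (hΩ.mem_nhds ht))
  filter_upwards [hΩ.mem_nhds ht] with x hx
  exact (hf.differentiableAt (hΩ.mem_nhds hx)).hasFDerivAt

/-- A submersion to `ℂ` is straightened to a linear form by a local change of coordinates. -/
theorem exists_straightening {V : Type} [NormedAddCommGroup V]
    [NormedSpace ℂ V] [FiniteDimensional ℂ V] {Ω : Set V} (hΩ : IsOpen Ω) {ψ : V → ℂ}
    (hψ : DifferentiableOn ℂ ψ Ω) {t₀ : V} (ht₀ : t₀ ∈ Ω) (hne : fderiv ℂ ψ t₀ ≠ 0) :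
    ∃ (ℓ : V →L[ℂ] ℂ) (h : OpenPartialHomeomorph V V), t₀ ∈ h.source ∧ h.source ⊆ Ω ∧
      (∀ t ∈ h.source, ℓ (h t) = ψ t) ∧ ∀ t ∈ h.source, ∃ A : V ≃L[ℂ] V,
        HasFDerivAt h (A : V →L[ℂ] V) t := by
  have := FiniteDimensional.complete ℂ V
  set ℓ := fderiv ℂ ψ t₀ with hℓ
  obtain ⟨e, he⟩ : ∃ e, ℓ e = 1 := by
    obtain ⟨v, hv⟩ := DFunLike.ne_iff.1 hne
    refine ⟨(ℓ v)⁻¹ • v, ?_⟩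
    rw [map_smul, smul_eq_mul]
    exact inv_mul_cancel₀ hv
  set Φ : V → V := fun t => t + (ψ t - ℓ t) • e with hΦ
  set Φ' : V → V →L[ℂ] V := fun t =>
    ContinuousLinearMap.id ℂ V + (fderiv ℂ ψ t - ℓ).smulRight e with hΦ'
  have hd : ∀ t ∈ Ω, HasFDerivAt Φ (Φ' t) t := fun t ht =>
    (hasFDerivAt_id t).add (((hψ.differentiableAt (hΩ.mem_nhds ht)).hasFDerivAt.sub
      ℓ.hasFDerivAt).smul_const e)
  have hΦ'0 : Φ' t₀ = (ContinuousLinearEquiv.refl ℂ V : V →L[ℂ] V) := by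
    ext v
    simp [hΦ', ← hℓ]
  have hcont : ContinuousAt Φ' t₀ := by
    have h1 := (hψ.continuousOn_fderiv_of_isOpen hΩ).continuousAt (hΩ.mem_nhds ht₀)
    have h2 : Continuous fun B : V →L[ℂ] ℂ =>
        ContinuousLinearMap.id ℂ V + (B - ℓ).smulRight e := by
      have : Continuous fun B : V →L[ℂ] ℂ => B.smulRight e :=
        (ContinuousLinearMap.smulRightL ℂ V V).flip e |>.continuous
      exact continuous_const.add (this.comp (continuous_id.sub continuous_const))
    exact h2.continuousAt.comp h1
  have hstrict : HasStrictFDerivAt Φ ((ContinuousLinearEquiv.refl ℂ V : V ≃L[ℂ] V) : V →L[ℂ] V) t₀ := by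
    rw [← hΦ'0]
    refine hasStrictFDerivAt_of_hasFDerivAt_of_continuousAt (f' := Φ') ?_ hcont
    filter_upwards [hΩ.mem_nhds ht₀] with x hx
    exact hd x hx
  have hinv : ∀ᶠ t in 𝓝 t₀, Φ' t ∈ Set.range ((↑) : (V ≃L[ℂ] V) → (V →L[ℂ] V)) :=
    hcont.eventually (by rw [hΦ'0]; exact ContinuousLinearEquiv.nhds _)
  obtain ⟨O, hO, hOo, ht₀O⟩ := mem_nhds_iff.1 (inter_mem hinv (hΩ.mem_nhds ht₀))
  set h := hstrict.toOpenPartialHomeomorph Φ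
  have hcoe : ∀ t, h t = Φ t := fun t => by
    rw [HasStrictFDerivAt.toOpenPartialHomeomorph_coe]
  refine ⟨ℓ, h.restrOpen O hOo, ⟨hstrict.mem_toOpenPartialHomeomorph_source, ht₀O⟩, ?_, ?_, ?_⟩
  · rintro t ⟨-, ht⟩
    exact (hO ht).2
  · rintro t -
    change ℓ (h t) = ψ t
    rw [hcoe]
    simp [hΦ, he]
  · rintro t ⟨-, ht⟩
    obtain ⟨⟨A, hA⟩, htΩ⟩ := hO ht
    refine ⟨A, ?_⟩
    have h1 := hd t htΩ
    rw [← hA] at h1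
    exact h1.congr_of_eventuallyEq (Eventually.of_forall hcoe)

theorem exists_injective_fderiv (m : ℕ) : ∀ {V : Type} [NormedAddCommGroup V]
    [NormedSpace ℂ V] [FiniteDimensional ℂ V] {Ω : Set V} (_ : IsOpen Ω) (_ : Ω.Nonempty)
    {φ : Fin m → V → ℂ} (_ : ∀ i, DifferentiableOn ℂ (φ i) Ω)
    (_ : ∀ c : Fin m → ℂ, {t | t ∈ Ω ∧ ∀ i, φ i t = c i}.Finite),
    ∃ t ∈ Ω, ∀ d : V, (∀ i, fderiv ℂ (φ i) t d = 0) → d = 0 := by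
  induction m with
  | zero =>
    intro V _ _ _ Ω hΩ hne φ hφ hfin
    obtain ⟨t, ht⟩ := hne
    refine ⟨t, ht, fun d _ => ?_⟩
    by_contra hd
    have h1 : {z : ℂ | t + z • d ∈ Ω} ∈ 𝓝 (0 : ℂ) :=
      (hΩ.preimage (by fun_prop : Continuous fun z : ℂ => t + z • d)).mem_nhds (by simpa using ht)
    refine infinite_of_mem_nhds 0 h1 (((hfin 0).preimage (f := fun z : ℂ => t + z • d) ?_).subset ?_)
    · intro a _ b _ hab
      exact smul_left_injective ℂ hd (add_left_cancel hab)
    · intro z hz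
      exact ⟨hz, fun i => i.elim0⟩
  | succ m ih =>
    intro V _ _ _ Ω hΩ hne φ hφ hfin
    by_cases hz : ∀ t ∈ Ω, fderiv ℂ (φ 0) t = 0
    · obtain ⟨t₀, ht₀⟩ := hne
      obtain ⟨r, hr, hb⟩ := Metric.isOpen_iff.1 hΩ t₀ ht₀
      have hconst : ∀ t ∈ Metric.ball t₀ r, φ 0 t = φ 0 t₀ := fun t ht =>
        Metric.isOpen_ball.is_const_of_fderiv_eq_zero (𝕜 := ℂ) (convex_ball t₀ r).isPreconnected
          ((hφ 0).mono hb) (fun x hx => hz x (hb hx)) ht (Metric.mem_ball_self hr)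
      obtain ⟨t, ht, h⟩ := ih (V := V) (Metric.isOpen_ball (x := t₀) (ε := r))
        ⟨t₀, Metric.mem_ball_self hr⟩ (φ := fun i => φ i.succ) (fun i => (hφ _).mono hb)
        (fun c => (hfin (Fin.cons (φ 0 t₀) c)).subset fun t ht =>
          ⟨hb ht.1, Fin.cases (by simpa using hconst t ht.1) fun i => by simpa using ht.2 i⟩)
      exact ⟨t, hb ht, fun d hd => h d fun i => hd _⟩
    · push Not at hz
      obtain ⟨t₀, ht₀, hne0⟩ := hz
      obtain ⟨ℓ, h, ht₀s, hsΩ, hℓ, hA⟩ := exists_straightening hΩ (hφ 0) ht₀ hne0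
      set K := LinearMap.ker (ℓ : V →ₗ[ℂ] ℂ)
      set j : K → V := fun κ => h t₀ + (κ : V) with hj
      have hjc : Continuous j := by fun_prop
      have hjd : ∀ κ, HasFDerivAt j K.subtypeL κ := fun κ =>
        (K.subtypeL.hasFDerivAt (x := κ)).const_add (h t₀)
      have hjℓ : ∀ κ, ℓ (j κ) = ℓ (h t₀) := fun κ => by
        have : ℓ (κ : V) = 0 := κ.2
        simp [hj, this]
      have hsymmd : ∀ a ∈ h.target, ∃ A : V ≃L[ℂ] V, HasFDerivAt h (A : V →L[ℂ] V) (h.symm a) ∧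
          HasFDerivAt h.symm (A.symm : V →L[ℂ] V) a := fun a ha => by
        obtain ⟨A, hA'⟩ := hA (h.symm a) (h.map_target ha)
        exact ⟨A, hA', h.hasFDerivAt_symm ha hA'⟩
      have hcomp : ∀ κ, j κ ∈ h.target → ∃ A : V ≃L[ℂ] V,
          HasFDerivAt h (A : V →L[ℂ] V) (h.symm (j κ)) ∧ ∀ i, HasFDerivAt
          (fun κ => φ i (h.symm (j κ))) ((fderiv ℂ (φ i) (h.symm (j κ))).comp
            ((A.symm : V →L[ℂ] V).comp K.subtypeL)) κ := fun κ hκ => by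
        obtain ⟨A, h1, h2⟩ := hsymmd _ hκ
        refine ⟨A, h1, fun i => ?_⟩
        have h3 : HasFDerivAt (φ i) (fderiv ℂ (φ i) (h.symm (j κ))) (h.symm (j κ)) :=
          ((hφ i).differentiableAt (hΩ.mem_nhds (hsΩ (h.map_target hκ)))).hasFDerivAt
        exact h3.comp κ (h2.comp κ (hjd κ))
      obtain ⟨κ, hκ, hinj⟩ := ih (V := K) (Ω := j ⁻¹' h.target) (h.open_target.preimage hjc)
        ⟨0, by simpa [hj] using h.map_source ht₀s⟩ (φ := fun i κ => φ i.succ (h.symm (j κ)))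
        (fun i κ hκ => by
          obtain ⟨A, -, h2⟩ := hcomp κ hκ
          exact (h2 _).differentiableAt.differentiableWithinAt)
        (fun c => by
          refine Set.Finite.of_injOn (f := fun κ => h.symm (j κ)) ?_ ?_
            (hfin (Fin.cons (ℓ (h t₀)) c))
          · rintro κ ⟨hκ, hκc⟩
            refine ⟨hsΩ (h.map_target hκ), Fin.cases ?_ fun i => ?_⟩
            · rw [← hℓ _ (h.map_target hκ), h.right_inv hκ, hjℓ, Fin.cons_zero]
            · simpa using hκc i
          · rintro a ⟨ha, -⟩ b ⟨hb, -⟩ hab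
            have h1 : j a = j b := h.symm.injOn ha hb hab
            exact Subtype.ext (add_left_cancel h1))
      obtain ⟨A, hA1, hA2⟩ := hcomp κ hκ
      have hts := h.map_target hκ
      refine ⟨h.symm (j κ), hsΩ hts, fun d hd => ?_⟩
      have hℓd : ∀ d, ℓ (A d) = fderiv ℂ (φ 0) (h.symm (j κ)) d := by
        have h1 : HasFDerivAt (fun t => ℓ (h t)) (ℓ.comp (A : V →L[ℂ] V)) (h.symm (j κ)) :=
          ℓ.hasFDerivAt.comp _ hA1
        have h2 : HasFDerivAt (φ 0) (ℓ.comp (A : V →L[ℂ] V)) (h.symm (j κ)) := by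
          refine h1.congr_of_eventuallyEq ?_
          filter_upwards [h.open_source.mem_nhds hts] with t ht
          exact (hℓ t ht).symm
        intro d
        rw [h2.fderiv]
        rfl
      have hdK : ℓ (A d) = 0 := by rw [hℓd, hd]
      have := hinj ⟨A d, hdK⟩ fun i => by
        rw [(hA2 i.succ).fderiv]
        simpa using hd i.succ
      have h3 : A d = 0 := congrArg Subtype.val this
      simpa using h3

theorem exists_image_mem_nhds {n : ℕ} {Ω : Set (Fin n → ℂ)} (hΩ : IsOpen Ω) (hne : Ω.Nonempty)
    {φ : (Fin n → ℂ) → (Fin n → ℂ)} (hφ : DifferentiableOn ℂ φ Ω)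
    (hfin : ∀ c, {t | t ∈ Ω ∧ φ t = c}.Finite) : ∃ c, φ '' Ω ∈ 𝓝 c := by
  have hφi : ∀ i, DifferentiableOn ℂ (fun t => φ t i) Ω := fun i => differentiableOn_pi.1 hφ i
  obtain ⟨t, ht, hinj⟩ := exists_injective_fderiv n hΩ hne hφi
    (fun c => (hfin c).subset fun t ht => ⟨ht.1, funext ht.2⟩)
  have hstrict : HasStrictFDerivAt φ (ContinuousLinearMap.pi fun i => fderiv ℂ (fun t => φ t i) t) t :=
    hasStrictFDerivAt_pi.2 fun i => (hφi i).hasStrictFDerivAt_of_isOpen hΩ ht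
  refine ⟨φ t, ?_⟩
  rw [← hstrict.map_nhds_eq_of_surj]
  · exact image_mem_map (hΩ.mem_nhds ht)
  · rw [LinearMap.range_eq_top]
    refine LinearMap.surjective_of_injective ((injective_iff_map_eq_zero _).2 fun d hd => hinj d ?_)
    intro i
    exact congrFun hd i

variable {n s : ℕ} {E : Set (Fin n → ℂ)} {Z : Set ((Fin n → ℂ) × (Fin s → ℂ))}

theorem interior_image_fst_nonempty (hZE : ∀ p ∈ Z, p.1 ∈ E)
    (hfin : ∀ x ∈ E, {v | (x, v) ∈ Z}.Finite) (hdim : PureDim Z n)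
    {p : (Fin n → ℂ) × (Fin s → ℂ)} (hp : p ∈ Z) {O : Set ((Fin n → ℂ) × (Fin s → ℂ))}
    (hO : IsOpen O) (hpO : p ∈ O) : (interior (Prod.fst '' (Z ∩ O))).Nonempty := by
  obtain ⟨q, hqO, hqZ, U, hU, hqU, e, Λ, Ω, g, hΩ, hg, hgr⟩ :=
    mem_closure_iff.1 (hdim.1 p hp) O hO hpO
  set γ : (Fin n → ℂ) → (Fin n → ℂ) × (Fin s → ℂ) := fun t => Λ.symm (t, g t) with hγ
  have hγd : DifferentiableOn ℂ γ Ω :=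
    Λ.symm.differentiable.comp_differentiableOn (differentiableOn_id.prodMk hg)
  have hγZ : ∀ t ∈ Ω, γ t ∈ Z ∩ U := fun t ht => by
    have : (t, g t) ∈ Λ '' (Z ∩ U) := by rw [hgr]; exact ⟨ht, rfl⟩
    obtain ⟨z, hz, hzt⟩ := this
    rw [hγ]
    simpa [← hzt] using hz
  have hγi : ∀ t t', γ t = γ t' → t = t' := fun t t' h => congrArg Prod.fst (Λ.symm.injective h)
  obtain ⟨c, hc⟩ := exists_image_mem_nhds (n := n) (Ω := Ω ∩ γ ⁻¹' O)
    (hγd.continuousOn.isOpen_inter_preimage hΩ hO) (by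
      have : Λ q ∈ Λ '' (Z ∩ U) := ⟨q, ⟨hqZ, hqU⟩, rfl⟩
      rw [hgr] at this
      refine ⟨(Λ q).1, this.1, ?_⟩
      have h2 : ((Λ q).1, g (Λ q).1) = Λ q := Prod.ext rfl this.2.symm
      change Λ.symm ((Λ q).1, g (Λ q).1) ∈ O
      rw [h2]
      simpa using hqO)
    (φ := fun t => (γ t).1) ((differentiable_fst.comp_differentiableOn hγd).mono
      Set.inter_subset_left) (by
      intro c
      by_cases hc : c ∈ E
      · refine (((hfin c hc).image fun v => (c, v)).preimage (f := γ)
          fun a _ b _ hab => hγi a b hab).subset ?_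
        rintro t ⟨⟨ht, -⟩, rfl⟩
        exact ⟨(γ t).2, (hγZ t ht).1, rfl⟩
      · refine Set.finite_empty.subset ?_
        rintro t ⟨⟨ht, -⟩, rfl⟩
        exact hc (hZE _ (hγZ t ht).1))
  refine ⟨c, mem_interior_iff_mem_nhds.2 (mem_of_superset hc ?_)⟩
  rintro _ ⟨t, ⟨ht, htO⟩, rfl⟩
  exact ⟨γ t, ⟨(hγZ t ht).1, htO⟩, rfl⟩

/-- The projection of a pure-dimensional analytic set with proper projection is open. -/
theorem image_fst_mem_nhds (hE : IsOpen E) (hZ : IsAnalyticIn (E ×ˢ Set.univ) Z)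
    (hp : ProperProjOn E Z) (hdim : PureDim Z n)
    {x₀ : Fin n → ℂ} {v₀ : Fin s → ℂ} (hmem : (x₀, v₀) ∈ Z)
    {O : Set ((Fin n → ℂ) × (Fin s → ℂ))}
    (hO : IsOpen O) (hpO : (x₀, v₀) ∈ O) : Prod.fst '' (Z ∩ O) ∈ 𝓝 x₀ := by
  have hfin := (isAnalyticIn_image_fst_and_finite_fiber s hE hZ hp).2
  have hx₀ : x₀ ∈ E := (hZ.1 hmem).1
  obtain ⟨r, hr, hrO, hrZ⟩ : ∃ r > 0, (∀ v ∈ Metric.closedBall v₀ r, (x₀, v) ∈ O) ∧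
      ∀ v ∈ Metric.closedBall v₀ r, (x₀, v) ∈ Z → v = v₀ := by
    have h1 : ∀ᶠ v in 𝓝 v₀, (x₀, v) ∈ O :=
      (hO.preimage (by fun_prop : Continuous fun v : Fin s → ℂ => (x₀, v))).mem_nhds hpO
    have h2 : ∀ᶠ v in 𝓝 v₀, v ∉ {v | (x₀, v) ∈ Z} \ {v₀} :=
      ((hfin x₀ hx₀).subset Set.sdiff_subset).isClosed.isOpen_compl.mem_nhds (by simp)
    obtain ⟨r, hr, h⟩ := Metric.nhds_basis_closedBall.eventually_iff.1 (h1.and h2)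
    refine ⟨r, hr, fun v hv => (h hv).1, fun v hv hvZ => ?_⟩
    by_contra hne
    exact (h hv).2 ⟨hvZ, hne⟩
  obtain ⟨ρ, hρ, hρE, hρO⟩ := hp.exists_ball hE hx₀
    (O := (Set.univ ×ˢ Metric.sphere v₀ r)ᶜ ∩ (O ∪ (Set.univ ×ˢ Metric.closedBall v₀ r)ᶜ))
    (((isClosed_univ.prod Metric.isClosed_sphere).isOpen_compl).inter
      (hO.union (isClosed_univ.prod Metric.isClosed_closedBall).isOpen_compl)) (by
      intro v hv
      refine ⟨fun h => ?_, ?_⟩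
      · have h1 := hrZ v (Metric.sphere_subset_closedBall h.2) hv
        have h2 : dist v v₀ = r := h.2
        rw [h1, dist_self] at h2
        linarith
      · by_cases hvr : v ∈ Metric.closedBall v₀ r
        · exact Or.inl (hrO v hvr)
        · exact Or.inr fun h => hvr h.2)
  set W := Metric.ball x₀ ρ
  set K := Z ∩ (W ×ˢ Metric.ball v₀ r)
  have hKc : ∀ q : (Fin n → ℂ) × (Fin s → ℂ), q ∈ Z → q.1 ∈ W → q.2 ∈ Metric.closedBall v₀ r →
      q.2 ∈ Metric.ball v₀ r := fun q hq hqW hqr => by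
    have h1 : q.2 ∉ Metric.sphere v₀ r := fun h => (hρO q hq hqW).1 ⟨trivial, h⟩
    exact lt_of_le_of_ne hqr h1
  have hWo : IsOpen W := Metric.isOpen_ball
  have hKa : IsAnalyticIn (W ×ˢ Set.univ) K := by
    refine .of_local (fun q hq => ⟨hq.2.1, trivial⟩) fun q hq => ?_
    by_cases hqb : q.2 ∈ Metric.ball v₀ r
    · refine ⟨W ×ˢ Metric.ball v₀ r, hWo.prod Metric.isOpen_ball, ⟨hq.1, hqb⟩, ?_⟩
      have := hZ.restrict (Ω' := W ×ˢ Metric.ball v₀ r) (hWo.prod Metric.isOpen_ball)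
        fun p hp => ⟨hρE hp.1, trivial⟩
      convert this using 1
      ext p
      simp only [K, Set.mem_inter_iff]
      tauto
    · refine ⟨((E ×ˢ Set.univ) \ Z) ∪ (Set.univ ×ˢ Metric.closedBall v₀ r)ᶜ,
        (hZ.isOpen_diff (hE.prod isOpen_univ)).union
          (isClosed_univ.prod Metric.isClosed_closedBall).isOpen_compl, ?_, ?_⟩
      · by_cases hqZ : q ∈ Z
        · exact Or.inr fun h => hqb (hKc q hqZ hq.1 h.2)
        · exact Or.inl ⟨⟨hρE hq.1, trivial⟩, hqZ⟩
      · convert IsAnalyticIn.empty _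
        refine Set.eq_empty_of_forall_notMem ?_
        rintro p ⟨hp1 | hp1, hp2⟩
        · exact hp1.2 hp2.1
        · exact hp1 ⟨trivial, Metric.ball_subset_closedBall hp2.2.2⟩
  have hKp : ProperProjOn W K := by
    intro C hC hCc
    have := (hp C (hC.trans hρE) hCc).inter_right
      (isClosed_univ.prod (Metric.isClosed_closedBall (x := v₀) (ε := r)))
    convert this using 1
    ext q
    constructor
    · rintro ⟨⟨hqZ, hqW⟩, hqC⟩
      exact ⟨⟨hqZ, hqC⟩, trivial, Metric.ball_subset_closedBall hqW.2⟩
    · rintro ⟨⟨hqZ, hqC⟩, -, hqr⟩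
      exact ⟨⟨hqZ, hC hqC, hKc q hqZ (hC hqC) hqr⟩, hqC⟩
  have hA := (isAnalyticIn_image_fst_and_finite_fiber s hWo hKa hKp).1
  have hintgr := interior_image_fst_nonempty (fun p hp => (hZ.1 hp).1) hfin hdim hmem
    (O := W ×ˢ Metric.ball v₀ r) (hWo.prod Metric.isOpen_ball)
    ⟨Metric.mem_ball_self hρ, Metric.mem_ball_self hr⟩
  have hAW := hA.eq_of_interior_nonempty (convex_ball x₀ ρ).isPreconnected hintgr
  refine mem_of_superset (hWo.mem_nhds (Metric.mem_ball_self hρ)) fun x hx => ?_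
  rw [← hAW] at hx
  obtain ⟨q, hq, rfl⟩ := hx
  refine ⟨q, ⟨hq.1, ?_⟩, rfl⟩
  exact (hρO q hq.1 hq.2.1).2.resolve_right fun h =>
    h ⟨trivial, Metric.ball_subset_closedBall hq.2.2⟩

end OpenImage

section ContinuousRoots

variable {V : Type} [NormedAddCommGroup V] [NormedSpace ℂ V] [FiniteDimensional ℂ V]

theorem differentiableAt_of_implicit {f : V × ℂ → ℂ} {f' : V × ℂ →L[ℂ] ℂ} {x : V} {h : V → ℂ}
    (hf : HasStrictFDerivAt f f' (x, h x)) (hne : f' (0, 1) ≠ 0) (hc : ContinuousAt h x)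
    (h0 : ∀ᶠ y in 𝓝 x, f (y, h y) = 0) : DifferentiableAt ℂ h x := by
  have := FiniteDimensional.complete ℂ V
  set c := f' (0, 1) with hcdef
  have hsplit : ∀ v w, f' (v, w) = f' (v, 0) + w * c := fun v w => by
    have h1 : ((v, w) : V × ℂ) = (v, 0) + w • (0, 1) := by simp
    rw [h1, map_add, map_smul, smul_eq_mul]
  set A : (V × ℂ) ≃L[ℂ] (V × ℂ) := LinearEquiv.toContinuousLinearEquiv
    { toFun := fun q => (q.1, f' q)
      map_add' := fun a b => by simp
      map_smul' := fun a b => by simp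
      invFun := fun q => (q.1, (q.2 - f' (q.1, 0)) * c⁻¹)
      left_inv := fun q => by
        obtain ⟨v, w⟩ := q
        simp only [hsplit v w, add_sub_cancel_left]
        rw [mul_assoc, mul_inv_cancel₀ hne, mul_one]
      right_inv := fun q => by
        obtain ⟨v, w⟩ := q
        simp only [hsplit v ((w - f' (v, 0)) * c⁻¹)]
        rw [mul_assoc, inv_mul_cancel₀ hne, mul_one, add_sub_cancel] }
  have hΦ : HasStrictFDerivAt (fun q : V × ℂ => (q.1, f q)) (A : (V × ℂ) →L[ℂ] (V × ℂ)) (x, h x) := by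
    have h1 : HasStrictFDerivAt (fun q : V × ℂ => (q.1, f q))
      ((ContinuousLinearMap.fst ℂ V ℂ).prod f') (x, h x) := hasStrictFDerivAt_fst.prodMk hf
    have h2 : (A : (V × ℂ) →L[ℂ] (V × ℂ)) = (ContinuousLinearMap.fst ℂ V ℂ).prod f' :=
      ContinuousLinearMap.ext fun q => rfl
    rwa [h2]
  have h1 := hΦ.to_localInverse.hasFDerivAt.differentiableAt
  have h2 := hΦ.eventually_left_inverse
  have h3 : Tendsto (fun y => (y, h y)) (𝓝 x) (𝓝 (x, h x)) := (continuousAt_id.prodMk hc)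
  have h0x : f (x, h x) = 0 := h0.self_of_nhds
  simp only [h0x] at h1
  have h4 : DifferentiableAt ℂ (fun y : V => (y, (0 : ℂ))) x := by fun_prop
  refine ((h1.comp x h4).snd).congr_of_eventuallyEq ?_
  filter_upwards [h3.eventually h2, h0] with y hy hy0
  rw [hy0] at hy
  simp only [Function.comp]
  rw [hy]

theorem differentiableOn_of_continuousOn_root {W : Set V} (hW : IsOpen W) {h : V → ℂ}
    (hc : ContinuousOn h W) (hgr : IsAnalyticIn (W ×ˢ Set.univ) {q : V × ℂ | q.1 ∈ W ∧ q.2 = h q.1})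
    {x₀ : V} (hx₀ : x₀ ∈ W) {O : Set (V × ℂ)} (hO : IsOpen O) (hmem : (x₀, h x₀) ∈ O) (k : ℕ) :
    ∀ {f : V × ℂ → ℂ}, DifferentiableOn ℂ f O →
    (∃ ρ > 0, ∀ x ∈ Metric.ball x₀ ρ, f (x, h x) = 0) →
    (∃ g : ℂ → ℂ, AnalyticAt ℂ g (h x₀) ∧ g (h x₀) ≠ 0 ∧
      ∀ᶠ w in 𝓝 (h x₀), f (x₀, w) = (w - h x₀) ^ k * g w) →
    ∃ ρ > 0, DifferentiableOn ℂ h (Metric.ball x₀ ρ) := by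
  induction k with
  | zero =>
    rintro f hf ⟨ρ, hρ, h0⟩ ⟨g, hg, hg0, hfg⟩
    refine absurd ?_ hg0
    have := hfg.self_of_nhds
    rw [h0 x₀ (Metric.mem_ball_self hρ)] at this
    simpa using this.symm
  | succ k ih =>
    rintro f hf ⟨ρ₁, hρ₁, h0⟩ ⟨g, hg, hg0, hfg⟩
    set f₁ : V × ℂ → ℂ := fun q => fderiv ℂ f q (0, 1) with hf₁
    have hf₁d : DifferentiableOn ℂ f₁ O := hf.fderiv_apply_of_isOpen hO _
    have hcx : ContinuousAt h x₀ := hc.continuousAt (hW.mem_nhds hx₀)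
    have hgO : ∀ᶠ x in 𝓝 x₀, x ∈ W ∧ (x, h x) ∈ O ∧ x ∈ Metric.ball x₀ ρ₁ ∧ ‖h x‖ ≤ ‖h x₀‖ + 1 := by
      have h1 : Tendsto (fun x => (x, h x)) (𝓝 x₀) (𝓝 (x₀, h x₀)) := continuousAt_id.prodMk hcx
      filter_upwards [hW.mem_nhds hx₀, h1.eventually (hO.mem_nhds hmem), Metric.ball_mem_nhds x₀ hρ₁,
        hcx.norm.eventually (ge_mem_nhds (lt_add_one ‖h x₀‖))] with x a b c d
      exact ⟨a, b, c, d⟩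
    obtain ⟨ρ, hρ, hρs⟩ := Metric.eventually_nhds_iff_ball.1 hgO
    set B := Metric.ball x₀ ρ
    have hBo : IsOpen B := Metric.isOpen_ball
    have hx₀B : x₀ ∈ B := Metric.mem_ball_self hρ
    have hcB : ContinuousOn h B := hc.mono fun x hx => (hρs x hx).1
    set A : Set V := {x | x ∈ B ∧ f₁ (x, h x) = 0} with hA
    have hAan : IsAnalyticIn B A := by
      have hBO : IsOpen ((B ×ˢ (Set.univ : Set ℂ)) ∩ O) := (hBo.prod isOpen_univ).inter hO
      have hKan : IsAnalyticIn (B ×ˢ Set.univ) {q : V × ℂ | q.1 ∈ A ∧ q.2 = h q.1} := by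
        refine .of_local (fun q hq => ⟨hq.1.1, trivial⟩) fun q hq => ?_
        by_cases hqh : q.2 = h q.1
        · refine ⟨(B ×ˢ Set.univ) ∩ O, hBO, ⟨hq, ?_⟩, ?_⟩
          · have := (hρs q.1 hq.1).2.1
            rwa [← hqh] at this
          · have h1 := (hgr.restrict hBO fun p hp => ⟨(hρs p.1 hp.1.1).1, trivial⟩).inter
              (IsAnalyticIn.zeroSet hBO (hf₁d.mono Set.inter_subset_right))
            convert h1 using 1
            ext ⟨x, w⟩
            constructor
            · rintro ⟨hxO, ⟨hxB, hx1⟩, hx2⟩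
              obtain rfl : w = h x := hx2
              exact ⟨⟨hxO, (hρs x hxB).1, rfl⟩, hxO, hx1⟩
            · rintro ⟨⟨hxO, -, hx2⟩, -, hx1⟩
              obtain rfl : w = h x := hx2
              exact ⟨hxO, ⟨hxO.1.1, hx1⟩, rfl⟩
        · refine ⟨(B ×ˢ Set.univ) ∩ (fun q : V × ℂ => q.2 - h q.1) ⁻¹' {0}ᶜ, ?_,
            ⟨hq, by simpa [sub_eq_zero] using hqh⟩, ?_⟩
          · refine ContinuousOn.isOpen_inter_preimage ?_ (hBo.prod isOpen_univ)
              isOpen_compl_singleton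
            exact continuousOn_snd.sub (hcB.comp continuousOn_fst fun q hq => hq.1)
          · convert IsAnalyticIn.empty _
            refine Set.eq_empty_of_forall_notMem ?_
            rintro p ⟨⟨-, hp⟩, -, hp'⟩
            exact hp (by simpa [sub_eq_zero] using hp')
      have hKp : ProperProjOn B {q : V × ℂ | q.1 ∈ A ∧ q.2 = h q.1} := by
        intro C hC hCc
        have h1 : IsClosed {x : C | f₁ (x, h x) = 0} := by
          have : ContinuousOn (fun x => f₁ (x, h x)) C :=
            hf₁d.continuousOn.comp (continuousOn_id.prodMk (hcB.mono hC)) fun x hx =>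
              (hρs x (hC hx)).2.1
          exact isClosed_eq this.domRestrict continuous_const
        have := isCompact_iff_compactSpace.1 hCc
        have h2 := h1.isCompact.image (f := fun x : C => ((x : V), h x))
          (continuous_subtype_val.prodMk (hcB.mono hC).domRestrict)
        convert h2 using 1
        ext ⟨x, w⟩
        constructor
        · rintro ⟨⟨⟨-, hx⟩, hw⟩, hxC⟩
          obtain rfl : w = h x := hw
          exact ⟨⟨x, hxC⟩, hx, rfl⟩
        · rintro ⟨⟨y, hyC⟩, hy, hyx⟩
          simp only [Prod.mk.injEq] at hyx
          obtain ⟨rfl, rfl⟩ := hyx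
          exact ⟨⟨⟨hC hyC, hy⟩, rfl⟩, hyC⟩
      have := isAnalyticIn_image_fst_one hBo hKan hKp
      convert this using 1
      ext x
      constructor
      · intro hx; exact ⟨(x, h x), ⟨hx, rfl⟩, rfl⟩
      · rintro ⟨q, hq, rfl⟩; exact hq.1
    by_cases hAB : A = B
    · refine ih hf₁d ⟨ρ, hρ, fun x hx => ?_⟩ ?_
      · have : x ∈ A := hAB ▸ hx
        exact this.2
      · refine ⟨fun w => ((k : ℂ) + 1) * g w + (w - h x₀) * deriv g w, ?_, ?_, ?_⟩
        · have := hg.deriv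
          fun_prop
        · have : (k : ℂ) + 1 ≠ 0 := by exact_mod_cast k.succ_ne_zero
          simpa using ⟨this, hg0⟩
        · have hwO : ∀ᶠ w in 𝓝 (h x₀), (x₀, w) ∈ O :=
            (hO.preimage (by fun_prop : Continuous fun w : ℂ => (x₀, w))).mem_nhds hmem
          filter_upwards [hfg.eventually_nhds, hg.eventually_analyticAt, hwO] with w h1 h2 h3
          have h4 : HasDerivAt (fun w : ℂ => (x₀, w)) ((0 : V), (1 : ℂ)) w :=
            (hasDerivAt_const w x₀).prodMk (hasDerivAt_id w)
          have h5 : HasDerivAt (fun w => f (x₀, w)) (f₁ (x₀, w)) w :=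
            (hf.differentiableAt (hO.mem_nhds h3)).hasFDerivAt.comp_hasDerivAt w h4
          have h6 : HasDerivAt (fun w => (w - h x₀) ^ (k + 1) * g w)
              ((((k + 1 : ℕ) : ℂ) * (w - h x₀) ^ k * 1) * g w + (w - h x₀) ^ (k + 1) * deriv g w) w :=
            (((hasDerivAt_id w).sub_const (h x₀)).pow (k + 1)).mul h2.differentiableAt.hasDerivAt
          rw [h5.unique (h6.congr_of_eventuallyEq h1)]
          push_cast
          ring
    · have hAint := hAan.interior_eq_empty (convex_ball x₀ ρ).isPreconnected hAB
      have hBA := hAan.isOpen_diff hBo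
      have hdiff : DifferentiableOn ℂ h (B \ A) := by
        intro x hx
        refine (differentiableAt_of_implicit (hf.hasStrictFDerivAt_of_isOpen hO (hρs x hx.1).2.1)
          (fun h1 => hx.2 ⟨hx.1, h1⟩) (hcB.continuousAt (hBo.mem_nhds hx.1)) ?_).differentiableWithinAt
        filter_upwards [hBo.mem_nhds hx.1] with y hy
        exact h0 y (hρs y hy).2.2.1
      obtain ⟨δ, hδ, hδB, F, hF, hFh⟩ := exists_local_extension hBo hAan hAint hdiff
        (fun x hx => (hρs x hx.1).2.2.2) hx₀B
      refine ⟨δ, hδ, hF.congr fun x hx => ?_⟩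
      have hcl : x ∈ closure (Metric.ball x₀ δ \ A) := by
        rw [mem_closure_iff]
        intro N hN hxN
        by_contra hcon
        have h1 : N ∩ Metric.ball x₀ δ ⊆ interior A := interior_maximal (fun y hy => by
          by_contra hyA
          exact hcon ⟨y, hy.1, hy.2, hyA⟩) (hN.inter Metric.isOpen_ball)
        rw [hAint] at h1
        exact h1 ⟨hxN, hx⟩
      have := mem_closure_iff_nhdsWithin_neBot.1 hcl
      have h1 : Tendsto F (𝓝[Metric.ball x₀ δ \ A] x) (𝓝 (F x)) :=
        (hF.continuousOn.continuousAt (Metric.isOpen_ball.mem_nhds hx)).mono_left nhdsWithin_le_nhds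
      have h2 : Tendsto h (𝓝[Metric.ball x₀ δ \ A] x) (𝓝 (h x)) :=
        (hcB.continuousAt (hBo.mem_nhds (hδB hx))).mono_left nhdsWithin_le_nhds
      refine tendsto_nhds_unique (h2.congr' ?_) h1 
      filter_upwards [self_mem_nhdsWithin] with y hy
      exact (hFh y hy).symm

/-- A continuous function with analytic graph is holomorphic. -/
theorem differentiableOn_of_isAnalyticIn_graph {W : Set V} (hW : IsOpen W) {h : V → ℂ}
    (hc : ContinuousOn h W) (hgr : IsAnalyticIn (W ×ˢ Set.univ) {q : V × ℂ | q.1 ∈ W ∧ q.2 = h q.1}) :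
    DifferentiableOn ℂ h W := by
  intro x₀ hx₀
  obtain ⟨O, hO, hxO, N, g, hg, hgG⟩ := hgr.exists_eqns (z := (x₀, h x₀)) ⟨hx₀, trivial⟩
  have hwO : ∀ᶠ w in 𝓝 (h x₀), (x₀, w) ∈ O :=
    (hO.preimage (by fun_prop : Continuous fun w : ℂ => (x₀, w))).mem_nhds hxO
  obtain ⟨i, hi⟩ : ∃ i, ¬ ∀ᶠ w in 𝓝 (h x₀), g i (x₀, w) = 0 := by
    by_contra! hcon
    have : {h x₀} ∈ 𝓝 (h x₀) := by
      filter_upwards [eventually_all.2 hcon, hwO] with w h1 h2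
      exact ((hgG _ h2).2 h1).2
    exact infinite_of_mem_nhds _ this (Set.finite_singleton _)
  have han : AnalyticAt ℂ (fun w => g i (x₀, w)) (h x₀) := by
    have hs : IsOpen {w : ℂ | (x₀, w) ∈ O} := hO.preimage (by fun_prop)
    exact ((hg i).comp (t := O) (s := {w : ℂ | (x₀, w) ∈ O}) (by fun_prop)
      fun w hw => hw).analyticAt (hs.mem_nhds hxO)
  obtain ⟨k, u, hu, hu0, huf⟩ := han.exists_eventuallyEq_pow_smul_nonzero_iff.2 hi
  have h1 : Tendsto (fun x => (x, h x)) (𝓝 x₀) (𝓝 (x₀, h x₀)) :=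
    continuousAt_id.prodMk (hc.continuousAt (hW.mem_nhds hx₀))
  obtain ⟨ρ, hρ, hρs⟩ := Metric.eventually_nhds_iff_ball.1
    ((h1.eventually (hO.mem_nhds hxO)).and (hW.mem_nhds hx₀))
  obtain ⟨δ, hδ, hd⟩ := differentiableOn_of_continuousOn_root hW hc hgr hx₀ hO hxO k (hg i)
    ⟨ρ, hρ, fun x hx => (hgG _ (hρs x hx).1).1 ⟨(hρs x hx).2, rfl⟩ i⟩ ⟨u, hu, hu0, huf⟩
  exact (hd.differentiableAt (Metric.ball_mem_nhds x₀ hδ)).differentiableWithinAt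

end ContinuousRoots

theorem exists_mem_notMem_of_interior_eq_empty {X : Type*} [TopologicalSpace X] {O T : Set X}
    (hO : IsOpen O) (hT : interior T = ∅) {x : X} (hx : x ∈ O) : ∃ y ∈ O, y ∉ T := by
  by_contra! h
  have h1 := interior_maximal h hO
  rw [hT] at h1
  exact h1 hx

section Complement

variable {V : Type} [NormedAddCommGroup V] [NormedSpace ℂ V] [FiniteDimensional ℂ V]

theorem IsAnalyticIn.isPreconnected_diff {E T : Set V} (hE : IsOpen E) (hEc : IsPreconnected E)
    (hT : IsAnalyticIn E T) (hT' : interior T = ∅) : IsPreconnected (E \ T) := by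
  classical
  have hE0 : IsOpen (E \ T) := hT.isOpen_diff hE
  rintro u v hu hv huv ⟨a, haE, hau⟩ ⟨b, hbE, hbv⟩
  by_contra hne
  have hdisj : ∀ x ∈ E \ T, x ∈ v → x ∉ u := fun x hx hxv hxu => hne ⟨x, hx, hxu, hxv⟩
  have hχ : DifferentiableOn ℂ (fun x => if x ∈ u then (1 : ℂ) else 0) (E \ T) := by
    intro x hx
    refine DifferentiableAt.differentiableWithinAt ?_
    rcases huv hx with hxu | hxv
    · refine (differentiableAt_const (1 : ℂ)).congr_of_eventuallyEq ?_
      filter_upwards [hu.mem_nhds hxu] with y hy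
      simp [hy]
    · refine (differentiableAt_const (0 : ℂ)).congr_of_eventuallyEq ?_
      filter_upwards [hv.mem_nhds hxv, hE0.mem_nhds hx] with y hy hyE
      simp [hdisj y hyE hy]
  set 𝒪 : Set V → Set V := fun w => ⋃₀ {O | IsOpen O ∧ O ⊆ E ∧ O \ T ⊆ w}
  have h𝒪 : ∀ w, IsOpen (𝒪 w) := fun w => isOpen_sUnion fun O hO => hO.1
  have key : E ⊆ 𝒪 u ∪ 𝒪 v := by
    intro x₀ hx₀
    obtain ⟨ρ, hρ, hρE, F, hF, hFχ⟩ := exists_local_extension hE hT hT' hχ (M := 1)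
      (fun x _ => by split_ifs <;> simp) hx₀
    have hFc : ContinuousAt F x₀ := hF.continuousOn.continuousAt (Metric.ball_mem_nhds x₀ hρ)
    obtain ⟨δ, hδ, hδs⟩ := Metric.eventually_nhds_iff_ball.1
      ((hFc.eventually (Metric.ball_mem_nhds (F x₀) one_half_pos)).and (Metric.ball_mem_nhds x₀ hρ))
    have hval : ∀ x ∈ Metric.ball x₀ δ \ T, ∀ y ∈ Metric.ball x₀ δ \ T, y ∈ u → x ∈ u := by
      intro x hx y hy hyu
      by_contra hxu
      have h1 := hδs x hx.1
      have h2 := hδs y hy.1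
      rw [hFχ x ⟨h1.2, hx.2⟩, if_neg hxu] at h1
      rw [hFχ y ⟨h2.2, hy.2⟩, if_pos hyu] at h2
      have h3 := dist_triangle_right (0 : ℂ) 1 (F x₀)
      have h4 := h1.1
      have h5 := h2.1
      have h6 : dist (0 : ℂ) 1 = 1 := by simp
      linarith
    have hsub : Metric.ball x₀ δ ⊆ E := fun x hx => hρE (hδs x hx).2
    obtain ⟨y, hy, hyT⟩ := exists_mem_notMem_of_interior_eq_empty Metric.isOpen_ball hT'
      (Metric.mem_ball_self hδ : x₀ ∈ Metric.ball x₀ δ)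
    by_cases hyu : y ∈ u
    · exact .inl ⟨_, ⟨Metric.isOpen_ball, hsub, fun x hx => hval x hx y ⟨hy, hyT⟩ hyu⟩,
        Metric.mem_ball_self hδ⟩
    · exact .inr ⟨_, ⟨Metric.isOpen_ball, hsub, fun x hx => (huv ⟨hsub hx.1, hx.2⟩).resolve_left
        fun hxu => hyu (hval y ⟨hy, hyT⟩ x hx hxu)⟩, Metric.mem_ball_self hδ⟩
  obtain ⟨x, -, ⟨O₁, ⟨hO₁, hO₁E, hO₁u⟩, hx₁⟩, ⟨O₂, ⟨hO₂, -, hO₂v⟩, hx₂⟩⟩ :=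
    hEc (𝒪 u) (𝒪 v) (h𝒪 u) (h𝒪 v) key
      ⟨a, haE.1, (key haE.1).resolve_right fun ⟨O, hO, haO⟩ =>
        hdisj a haE (hO.2.2 ⟨haO, haE.2⟩) hau⟩
      ⟨b, hbE.1, (key hbE.1).resolve_left fun ⟨O, hO, hbO⟩ =>
        hdisj b hbE hbv (hO.2.2 ⟨hbO, hbE.2⟩)⟩
  obtain ⟨y, hy, hyT⟩ := exists_mem_notMem_of_interior_eq_empty (hO₁.inter hO₂) hT' ⟨hx₁, hx₂⟩
  exact hdisj y ⟨hO₁E hy.1, hyT⟩ (hO₂v ⟨hy.2, hyT⟩) (hO₁u ⟨hy.1, hyT⟩)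

end Complement

/-- `D` is an unramified covering of `U`, locally a disjoint union of finitely many graphs of
holomorphic maps. -/
def IsSheetCover {A B : Type} [NormedAddCommGroup A] [NormedSpace ℂ A]
    [NormedAddCommGroup B] [NormedSpace ℂ B] (U : Set A) (D : Set (A × B)) : Prop :=
  (∀ p ∈ D, p.1 ∈ U) ∧ ∀ x₀ ∈ U, ∃ ρ > 0, Metric.ball x₀ ρ ⊆ U ∧ ∃ (t : ℕ) (g : Fin t → A → B),
    (∀ i, DifferentiableOn ℂ (g i) (Metric.ball x₀ ρ)) ∧
    (∀ x ∈ Metric.ball x₀ ρ, Function.Injective fun i => g i x) ∧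
    ∀ x ∈ Metric.ball x₀ ρ, ∀ v, (x, v) ∈ D ↔ ∃ i, g i x = v

theorem isSheetCover_of_ncard_eq {n s : ℕ} {E : Set (Fin n → ℂ)} (hE : IsOpen E)
    {Z : Set ((Fin n → ℂ) × (Fin s → ℂ))} (hZ : IsAnalyticIn (E ×ˢ (Set.univ : Set (Fin s → ℂ))) Z)
    (hdim : PureDim Z n) (hp : ProperProjOn E Z) {U : Set (Fin n → ℂ)} (hU : IsOpen U)
    (hUE : U ⊆ E) {k : ℕ} (hk : ∀ x ∈ U, Set.ncard {v | (x, v) ∈ Z} = k) :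
    IsSheetCover U {p | p ∈ Z ∧ p.1 ∈ U} := by
  refine ⟨fun p hp => hp.2, fun x₀ hx₀ => ?_⟩
  have hfin : ∀ x ∈ E, {v | (x, v) ∈ Z}.Finite :=
    (isAnalyticIn_image_fst_and_finite_fiber s hE hZ hp).2
  -- enumerate the central fibre
  have hfinx := (hfin x₀ (hUE hx₀)).to_subtype
  obtain ⟨e⟩ : Nonempty (Fin k ≃ {v | (x₀, v) ∈ Z}) :=
    ⟨(Finite.equivFinOfCardEq (by rw [← hk x₀ hx₀]; rfl)).symm⟩
  set a : Fin k → Fin s → ℂ := fun i => (e i : Fin s → ℂ) with ha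
  have hainj : Function.Injective a := Subtype.val_injective.comp e.injective
  have haZ : ∀ i, (x₀, a i) ∈ Z := fun i => (e i).2
  have hasurj : ∀ v, (x₀, v) ∈ Z → ∃ i, a i = v := fun v hv => ⟨e.symm ⟨v, hv⟩, by simp [ha]⟩
  -- separate the points
  obtain ⟨r, hr, hdisj⟩ : ∃ r > 0, ∀ i j, i ≠ j →
      Disjoint (Metric.ball (a i) r) (Metric.ball (a j) r) := by
    have : ∀ᶠ r in 𝓝[>] (0 : ℝ), ∀ i j, i ≠ j → r + r ≤ dist (a i) (a j) := by
      refine eventually_all.2 fun i => eventually_all.2 fun j => ?_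
      by_cases hij : i = j
      · exact .of_forall fun r h => absurd hij h
      · have h1 : 0 < dist (a i) (a j) / 2 := half_pos (dist_pos.2 fun h => hij (hainj h))
        filter_upwards [nhdsWithin_le_nhds (ge_mem_nhds h1)] with r hr _
        linarith
    obtain ⟨r, h1, h2⟩ := (this.and self_mem_nhdsWithin).exists
    exact ⟨r, h2, fun i j hij => Metric.ball_disjoint_ball (h1 i j hij)⟩
  -- each ball captures exactly one point of nearby fibres
  have hnear : ∀ r' > 0, ∀ i, ∀ᶠ x in 𝓝 x₀, ∃ v ∈ Metric.ball (a i) r', (x, v) ∈ Z := by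
    intro r' hr' i
    have h1 := image_fst_mem_nhds hE hZ hp hdim (haZ i)
      (O := Set.univ ×ˢ Metric.ball (a i) r') (isOpen_univ.prod Metric.isOpen_ball)
      ⟨trivial, Metric.mem_ball_self hr'⟩
    filter_upwards [h1]
    rintro _ ⟨⟨x, v⟩, hq, rfl⟩
    exact ⟨v, hq.2.2, hq.1⟩
  obtain ⟨ρ, hρ, hρs⟩ := Metric.eventually_nhds_iff_ball.1
    ((eventually_all.2 (hnear r hr)).and (hU.mem_nhds hx₀))
  set B := Metric.ball x₀ ρ with hB
  have hBo : IsOpen B := Metric.isOpen_ball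
  have hBU : B ⊆ U := fun x hx => (hρs x hx).2
  have hex : ∀ i x, ∃ v, x ∈ B → v ∈ Metric.ball (a i) r ∧ (x, v) ∈ Z := by
    intro i x
    by_cases hx : x ∈ B
    · obtain ⟨v, h1, h2⟩ := (hρs x hx).1 i
      exact ⟨v, fun _ => ⟨h1, h2⟩⟩
    · exact ⟨0, fun h => absurd h hx⟩
  choose g hg using hex
  have hginj : ∀ x ∈ B, Function.Injective fun i => g i x := by
    intro x hx i j hij
    by_contra hne
    exact Set.disjoint_left.1 (hdisj i j hne) (hg i x hx).1 (by
      have : g i x = g j x := hij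
      rw [this]; exact (hg j x hx).1)
  have hgsurj : ∀ x ∈ B, ∀ v, (x, v) ∈ Z → ∃ i, g i x = v := by
    intro x hx v hv
    have h1 : Set.range (fun i => g i x) ⊆ {v | (x, v) ∈ Z} := by
      rintro _ ⟨i, rfl⟩
      exact (hg i x hx).2
    have h2 : (Set.range fun i => g i x).ncard = k := by
      rw [← Set.image_univ, Set.ncard_image_of_injective _ (hginj x hx), Set.ncard_univ,
        Nat.card_eq_fintype_card, Fintype.card_fin]
    have h3 := Set.eq_of_subset_of_ncard_le h1 (by rw [h2, hk x (hBU hx)])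
      (hfin x (hUE (hBU hx)))
    have h4 : v ∈ Set.range fun i => g i x := h3 ▸ hv
    exact h4
  have hguniq : ∀ i, ∀ x ∈ B, ∀ v ∈ Metric.ball (a i) r, (x, v) ∈ Z → v = g i x := by
    intro i x hx v hv hvZ
    obtain ⟨j, rfl⟩ := hgsurj x hx v hvZ
    by_cases hij : i = j
    · rw [hij]
    · exact absurd (hg j x hx).1 (Set.disjoint_left.1 (hdisj i j hij) hv)
  have hgc : ∀ i, ContinuousOn (g i) B := by
    intro i x₁ hx₁
    refine ContinuousAt.continuousWithinAt ?_
    rw [ContinuousAt, Metric.tendsto_nhds]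
    intro ε hε
    have h1 := image_fst_mem_nhds hE hZ hp hdim (hg i x₁ hx₁).2
      (O := Set.univ ×ˢ (Metric.ball (g i x₁) ε ∩ Metric.ball (a i) r))
      (isOpen_univ.prod (Metric.isOpen_ball.inter Metric.isOpen_ball))
      ⟨trivial, Metric.mem_ball_self hε, (hg i x₁ hx₁).1⟩
    filter_upwards [h1, hBo.mem_nhds hx₁]
    rintro _ ⟨⟨x, v⟩, hq, rfl⟩ hxB
    rw [← hguniq i x hxB v hq.2.2.2 hq.1]
    exact hq.2.2.1
  have hgd : ∀ i, DifferentiableOn ℂ (g i) B := by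
    intro i
    set K : Set ((Fin n → ℂ) × (Fin s → ℂ)) := {q | q.1 ∈ B ∧ q.2 = g i q.1} with hK
    have hKan : IsAnalyticIn (B ×ˢ Set.univ) K := by
      refine .of_local (fun q hq => ⟨hq.1, trivial⟩) fun q hq => ?_
      by_cases hqr : q.2 = g i q.1
      · have hO : IsOpen (B ×ˢ Metric.ball (a i) r) := hBo.prod Metric.isOpen_ball
        refine ⟨_, hO, ⟨hq.1, hqr ▸ (hg i q.1 hq.1).1⟩, ?_⟩
        convert hZ.restrict hO (fun p hp => ⟨hUE (hBU hp.1), trivial⟩) using 1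
        ext ⟨x, v⟩
        constructor
        · rintro ⟨h1, h2, h3⟩
          obtain rfl : v = g i x := h3
          exact ⟨h1, (hg i x h2).2⟩
        · rintro ⟨h1, h2⟩
          exact ⟨h1, h1.1, hguniq i x h1.1 v h1.2 h2⟩
      · refine ⟨(B ×ˢ Set.univ) ∩ (fun q : (Fin n → ℂ) × (Fin s → ℂ) => q.2 - g i q.1) ⁻¹' {0}ᶜ, ?_,
          ⟨hq, by simpa [sub_eq_zero] using hqr⟩, ?_⟩
        · refine ContinuousOn.isOpen_inter_preimage ?_ (hBo.prod isOpen_univ) isOpen_compl_singleton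
          exact continuousOn_snd.sub ((hgc i).comp continuousOn_fst fun q hq => hq.1)
        · convert IsAnalyticIn.empty _
          refine Set.eq_empty_of_forall_notMem ?_
          rintro p ⟨⟨-, hp⟩, -, hp'⟩
          exact hp (by simpa [sub_eq_zero] using hp')
    have hKp : ProperProjOn B K := by
      intro C hC hCc
      have h2 := hCc.image_of_continuousOn (f := fun x => (x, g i x))
        (continuousOn_id.prodMk ((hgc i).mono hC))
      convert h2 using 1
      ext ⟨x, w⟩
      constructor
      · rintro ⟨⟨-, hw⟩, hxC⟩
        exact ⟨x, hxC, Prod.ext rfl hw.symm⟩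
      · rintro ⟨y, hyC, hyx⟩
        simp only [Prod.mk.injEq] at hyx
        obtain ⟨rfl, rfl⟩ := hyx
        exact ⟨⟨hC hyC, rfl⟩, hyC⟩
    refine differentiableOn_pi.2 fun j => ?_
    have hgr := hKan.image_linear hBo hKp (LinearMap.proj j)
    refine differentiableOn_of_isAnalyticIn_graph hBo (continuousOn_pi.1 (hgc i) j) ?_
    convert hgr using 1
    ext ⟨x, w⟩
    constructor
    · rintro ⟨h1, h2⟩
      exact ⟨(x, g i x), ⟨h1, rfl⟩, Prod.ext rfl h2.symm⟩
    · rintro ⟨⟨y, v⟩, ⟨hy, hv⟩, h⟩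
      simp only [Prod.mk.injEq, LinearMap.proj_apply] at h
      obtain ⟨rfl, rfl⟩ := h
      exact ⟨hy, congrFun hv j⟩
  refine ⟨ρ, hρ, hBU, k, g, hgd, hginj, fun x hx v => ⟨fun h => hgsurj x hx v h.1, ?_⟩⟩
  rintro ⟨i, rfl⟩
  exact ⟨(hg i x hx).2, hBU hx⟩

section SheetCover

variable {A B : Type} [NormedAddCommGroup A] [NormedSpace ℂ A]
  [NormedAddCommGroup B] [NormedSpace ℂ B]

theorem IsSheetCover.finite_fiber {U : Set A} {D : Set (A × B)} (hD : IsSheetCover U D) {x : A}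
    (hx : x ∈ U) : {v | (x, v) ∈ D}.Finite := by
  obtain ⟨ρ, hρ, -, t, g, -, -, hg⟩ := hD.2 x hx
  have : {v | (x, v) ∈ D} = Set.range fun i => g i x :=
    Set.ext fun v => hg x (Metric.mem_ball_self hρ) v
  rw [this]
  exact Set.finite_range _

theorem IsSheetCover.exists_ncard_eq {U : Set A} {D : Set (A × B)} (hD : IsSheetCover U D)
    (hU : IsPreconnected U) : ∃ t : ℕ, ∀ x ∈ U, Set.ncard {v | (x, v) ∈ D} = t := by
  have hc : ContinuousOn (fun x => Set.ncard {v | (x, v) ∈ D}) U := by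
    intro x₀ hx₀
    obtain ⟨ρ, hρ, -, t, g, -, hinj, hg⟩ := hD.2 x₀ hx₀
    have h1 : ∀ x ∈ Metric.ball x₀ ρ, Set.ncard {v | (x, v) ∈ D} = t := by
      intro x hx
      have : {v | (x, v) ∈ D} = Set.range fun i => g i x := Set.ext fun v => hg x hx v
      rw [this, ← Set.image_univ, Set.ncard_image_of_injective _ (hinj x hx), Set.ncard_univ,
        Nat.card_eq_fintype_card, Fintype.card_fin]
    refine ContinuousAt.continuousWithinAt (continuousAt_const (y := t) |>.congr ?_)
    filter_upwards [Metric.ball_mem_nhds x₀ hρ] with x hx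
    exact (h1 x hx).symm
  rcases U.eq_empty_or_nonempty with rfl | ⟨x₀, hx₀⟩
  · exact ⟨0, fun x hx => hx.elim⟩
  · exact ⟨_, fun x hx => hU.constant hc hx hx₀⟩

theorem IsSheetCover.inter_of_isOpen {U : Set A} {D : Set (A × B)} (hD : IsSheetCover U D)
    {O O' : Set (A × B)} (hO : IsOpen O) (hO' : IsOpen O') (hOO : D ⊆ O ∪ O')
    (hdisj : D ∩ (O ∩ O') = ∅) : IsSheetCover U (D ∩ O) := by
  classical
  refine ⟨fun p hp => hD.1 p hp.1, fun x₀ hx₀ => ?_⟩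
  obtain ⟨ρ, hρ, hρU, t, g, hgd, hinj, hg⟩ := hD.2 x₀ hx₀
  have hsheet : ∀ i, (∀ x ∈ Metric.ball x₀ ρ, (x, g i x) ∈ O) ∨
      ∀ x ∈ Metric.ball x₀ ρ, (x, g i x) ∈ O' := by
    intro i
    have h1 : IsPreconnected ((fun x => (x, g i x)) '' Metric.ball x₀ ρ) :=
      (convex_ball x₀ ρ).isPreconnected.image _ (continuousOn_id.prodMk (hgd i).continuousOn)
    have h2 : (fun x => (x, g i x)) '' Metric.ball x₀ ρ ⊆ D := by
      rintro _ ⟨x, hx, rfl⟩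
      exact (hg x hx _).2 ⟨i, rfl⟩
    have h3 := isPreconnected_iff_subset_of_disjoint.1 h1 O O' hO hO' (h2.trans hOO)
      (Set.subset_eq_empty (Set.inter_subset_inter_left _ h2) hdisj)
    simpa [Set.image_subset_iff, Set.subset_def] using h3
  set I := {i : Fin t // ∀ x ∈ Metric.ball x₀ ρ, (x, g i x) ∈ O}
  obtain ⟨e⟩ : Nonempty (Fin (Fintype.card I) ≃ I) := ⟨(Fintype.equivFin I).symm⟩
  refine ⟨ρ, hρ, hρU, _, fun j => g (e j), fun j => hgd _, fun x hx i j hij =>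
    e.injective (Subtype.ext (hinj x hx hij)), fun x hx v => ⟨?_, ?_⟩⟩
  · rintro ⟨hv, hvO⟩
    obtain ⟨i, rfl⟩ := (hg x hx v).1 hv
    have hi : ∀ x ∈ Metric.ball x₀ ρ, (x, g i x) ∈ O := by
      refine (hsheet i).resolve_right fun h => ?_
      have : (x, g i x) ∈ D ∩ (O ∩ O') := ⟨hv, hvO, h x hx⟩
      rw [hdisj] at this
      exact this
    exact ⟨e.symm ⟨i, hi⟩, by simp⟩
  · rintro ⟨j, rfl⟩
    exact ⟨(hg x hx _).2 ⟨_, rfl⟩, (e j).2 x hx⟩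

theorem IsSheetCover.ncard_pos {U : Set A} {D : Set (A × B)} (hD : IsSheetCover U D)
    (hU : IsPreconnected U) (hne : D.Nonempty) {x : A} (hx : x ∈ U) :
    0 < Set.ncard {v | (x, v) ∈ D} := by
  obtain ⟨t, ht⟩ := hD.exists_ncard_eq hU
  obtain ⟨⟨y, v⟩, hp⟩ := hne
  have hy : y ∈ U := hD.1 _ hp
  rw [ht x hx, ← ht y hy, Set.ncard_pos (hD.finite_fiber hy)]
  exact ⟨v, hp⟩

/-- A finite covering of a connected base is a finite disjoint union of connected coverings. -/
theorem IsSheetCover.exists_decomposition {U : Set A} (hU : IsPreconnected U) {x₀ : A}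
    (hx₀ : x₀ ∈ U) (t : ℕ) : ∀ {D : Set (A × B)}, IsSheetCover U D →
    Set.ncard {v | (x₀, v) ∈ D} = t → ∃ 𝒟 : Set (Set (A × B)), 𝒟.Finite ∧ ⋃₀ 𝒟 = D ∧
      𝒟.PairwiseDisjoint id ∧ ∀ C ∈ 𝒟, IsSheetCover U C ∧ C.Nonempty ∧ IsPreconnected C := by
  induction t using Nat.strong_induction_on with
  | _ t ih =>
  intro D hD ht
  rcases D.eq_empty_or_nonempty with rfl | hne
  · exact ⟨∅, Set.finite_empty, by simp, by simp, by simp⟩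
  by_cases hc : IsPreconnected D
  · exact ⟨{D}, Set.finite_singleton _, by simp, by simp, by simpa using ⟨hD, hne, hc⟩⟩
  rw [isPreconnected_iff_subset_of_disjoint] at hc
  push Not at hc
  obtain ⟨O, O', hO, hO', hOO, hdisj, hn1, hn2⟩ := hc
  have hD1 := hD.inter_of_isOpen hO hO' hOO hdisj
  have hD2 := hD.inter_of_isOpen hO' hO (Set.union_comm O O' ▸ hOO) (Set.inter_comm O O' ▸ hdisj)
  have hne1 : (D ∩ O).Nonempty := by
    obtain ⟨p, hp, hpn⟩ := Set.not_subset.1 hn2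
    exact ⟨p, hp, (hOO hp).resolve_right hpn⟩
  have hne2 : (D ∩ O').Nonempty := by
    obtain ⟨p, hp, hpn⟩ := Set.not_subset.1 hn1
    exact ⟨p, hp, (hOO hp).resolve_left hpn⟩
  have hun : D ∩ O ∪ D ∩ O' = D := by rw [← Set.inter_union_distrib_left, Set.inter_eq_left.2 hOO]
  have hdj : Disjoint (D ∩ O) (D ∩ O') := by
    rw [Set.disjoint_left]
    intro p hp hp'
    have : p ∈ D ∩ (O ∩ O') := ⟨hp.1, hp.2, hp'.2⟩
    rw [hdisj] at this
    exact this
  have hcard : Set.ncard {v | (x₀, v) ∈ D ∩ O} + Set.ncard {v | (x₀, v) ∈ D ∩ O'} = t := by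
    rw [← ht, ← Set.ncard_union_eq (s := {v | (x₀, v) ∈ D ∩ O}) (t := {v | (x₀, v) ∈ D ∩ O'})
      (Set.disjoint_left.2 fun v h h' => Set.disjoint_left.1 hdj h h')
      (hD1.finite_fiber hx₀) (hD2.finite_fiber hx₀)]
    congr 1
    ext v
    exact Set.ext_iff.1 hun (x₀, v)
  have hp1 := hD1.ncard_pos hU hne1 hx₀
  have hp2 := hD2.ncard_pos hU hne2 hx₀
  obtain ⟨𝒟₁, hf1, hu1, hd1, h1⟩ := ih _ (by omega) hD1 rfl
  obtain ⟨𝒟₂, hf2, hu2, hd2, h2⟩ := ih _ (by omega) hD2 rfl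
  refine ⟨𝒟₁ ∪ 𝒟₂, hf1.union hf2, by rw [Set.sUnion_union, hu1, hu2, hun], ?_, ?_⟩
  · rw [Set.pairwiseDisjoint_union]
    refine ⟨hd1, hd2, fun C hC C' hC' _ => hdj.mono ?_ ?_⟩
    · exact hu1 ▸ Set.subset_sUnion_of_mem hC
    · exact hu2 ▸ Set.subset_sUnion_of_mem hC'
  · rintro C (hC | hC)
    exacts [h1 C hC, h2 C hC]

/-- A covering of `U` is relatively closed over `U`. -/
theorem IsSheetCover.mem_of_mem_closure {U : Set A} {D : Set (A × B)} (hD : IsSheetCover U D)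
    {p : A × B} (hp : p ∈ closure D) (hpU : p.1 ∈ U) : p ∈ D := by
  obtain ⟨x₀, v₀⟩ := p
  obtain ⟨ρ, hρ, -, t, g, hgd, -, hg⟩ := hD.2 x₀ hpU
  refine (hg x₀ (Metric.mem_ball_self hρ) v₀).2 ?_
  by_contra! hcon
  have hev : ∀ᶠ q in 𝓝 (x₀, v₀), q.1 ∈ Metric.ball x₀ ρ ∧ ∀ i, g i q.1 ≠ q.2 := by
    refine ((continuousAt_fst (p := (x₀, v₀))).eventually
      (p := fun x => x ∈ Metric.ball x₀ ρ) (Metric.ball_mem_nhds x₀ hρ)).and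
      (eventually_all.2 fun i => ?_)
    have h1 : ContinuousAt (g i) x₀ :=
      (hgd i).continuousOn.continuousAt (Metric.ball_mem_nhds x₀ hρ)
    have h2 : ContinuousAt (fun q : A × B => g i q.1) (x₀, v₀) :=
      ContinuousAt.comp (f := Prod.fst) (x := (x₀, v₀)) h1 continuousAt_fst
    exact (h2.ne_iff_eventually_ne continuousAt_snd).1 (hcon i)
  obtain ⟨q, hqD, hq1, hq2⟩ := ((mem_closure_iff_frequently.1 hp).and_eventually hev).exists
  obtain ⟨i, hi⟩ := (hg q.1 hq1 q.2).1 hqD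
  exact hq2 i hi

end SheetCover

theorem IsSheetCover.exists_chart {A B : Type} [NormedAddCommGroup A] [NormedSpace ℂ A]
    [NormedAddCommGroup B] [NormedSpace ℂ B] {U : Set A} {D : Set (A × B)}
    (hD : IsSheetCover U D) {t : ℕ} (ht : ∀ x ∈ U, Set.ncard {v | (x, v) ∈ D} = t) {x₀ : A}
    (hx₀ : x₀ ∈ U) : ∃ ρ > 0, Metric.ball x₀ ρ ⊆ U ∧ ∃ g : Fin t → A → B,
      (∀ i, DifferentiableOn ℂ (g i) (Metric.ball x₀ ρ)) ∧
      (∀ x ∈ Metric.ball x₀ ρ, Function.Injective fun i => g i x) ∧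
      ∀ x ∈ Metric.ball x₀ ρ, {v | (x, v) ∈ D} = Set.range fun i => g i x := by
  obtain ⟨ρ, hρ, hρU, t', g, hgd, hinj, hg⟩ := hD.2 x₀ hx₀
  have h1 : ∀ x ∈ Metric.ball x₀ ρ, {v | (x, v) ∈ D} = Set.range fun i => g i x :=
    fun x hx => Set.ext fun v => hg x hx v
  have hx₀' := Metric.mem_ball_self hρ (x := x₀)
  obtain rfl : t' = t := by
    rw [← ht x₀ hx₀, h1 x₀ hx₀', ← Set.image_univ,
      Set.ncard_image_of_injective _ (hinj x₀ hx₀'), Set.ncard_univ, Nat.card_eq_fintype_card,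
      Fintype.card_fin]
  exact ⟨ρ, hρ, hρU, g, hgd, hinj, h1⟩

/-- The product over the points `u` of the fibre of `D` over `x` of the linear forms
`∑ i, l ^ i * (v i - u i)`. -/
noncomputable def fiberProd {V : Type} {s : ℕ} (D : Set (V × (Fin s → ℂ))) (l : ℕ) (q : V × (Fin s → ℂ)) : ℂ :=
  ∏ᶠ u ∈ {u | (q.1, u) ∈ D}, ∑ i : Fin s, (l : ℂ) ^ (i : ℕ) * (q.2 i - u i)

theorem fiberProd_eq {V : Type} {s : ℕ} {D : Set (V × (Fin s → ℂ))} {x : V} {t : ℕ} {u : Fin t → Fin s → ℂ}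
    (hu : Function.Injective u) (hD : {v | (x, v) ∈ D} = Set.range u) (l : ℕ) (v : Fin s → ℂ) :
    fiberProd D l (x, v) = ∏ j, ∑ i : Fin s, (l : ℂ) ^ (i : ℕ) * (v i - u j i) := by
  rw [fiberProd]
  simp only [hD]
  rw [finprod_mem_range hu, finprod_eq_prod_of_fintype]

theorem norm_fiberProd_le {V : Type} {s : ℕ} {D : Set (V × (Fin s → ℂ))} {x : V} {t : ℕ} {u : Fin t → Fin s → ℂ}
    (hu : Function.Injective u) (hD : {v | (x, v) ∈ D} = Set.range u) (l : ℕ) {v : Fin s → ℂ}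
    {R : ℝ} (hR : ∀ j, ‖v - u j‖ ≤ R) :
    ‖fiberProd D l (x, v)‖ ≤ (∑ i : Fin s, (l : ℝ) ^ (i : ℕ) * R) ^ t := by
  rw [fiberProd_eq hu hD, norm_prod]
  refine (Finset.prod_le_prod (fun _ _ => norm_nonneg _) (g := fun _ =>
    ∑ i : Fin s, (l : ℝ) ^ (i : ℕ) * R) fun j _ => ?_).trans (by simp)
  refine (norm_sum_le _ _).trans (Finset.sum_le_sum fun i _ => ?_)
  rw [norm_mul, norm_pow, Complex.norm_natCast]
  gcongr
  exact (norm_le_pi_norm (v - u j) i).trans (hR j)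

theorem IsAnalyticIn.closure_inter_subset {V : Type} [NormedAddCommGroup V] [NormedSpace ℂ V]
    {Ω X D : Set V} (hX : IsAnalyticIn Ω X)
    (hΩ : IsOpen Ω) (hD : D ⊆ X) : closure D ∩ Ω ⊆ X := by
  rintro z ⟨hz, hzΩ⟩
  by_contra hzX
  obtain ⟨y, hy, hyD⟩ := mem_closure_iff.1 hz _ (hX.isOpen_diff hΩ) ⟨hzΩ, hzX⟩
  exact hy.2 (hD hyD)

section Closure

variable {V : Type} [NormedAddCommGroup V] [NormedSpace ℂ V] {s : ℕ}

theorem IsSheetCover.differentiableOn_fiberProd {U : Set V} {D : Set (V × (Fin s → ℂ))}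
    (hD : IsSheetCover U D) (l : ℕ) :
    DifferentiableOn ℂ (fiberProd D l) (U ×ˢ Set.univ) := by
  rintro ⟨x₀, v₀⟩ ⟨hx₀, -⟩
  obtain ⟨ρ, hρ, -, t, g, hgd, hinj, hg⟩ := hD.2 x₀ hx₀
  refine DifferentiableAt.differentiableWithinAt ?_
  have hB : Metric.ball x₀ ρ ×ˢ (Set.univ : Set (Fin s → ℂ)) ∈ 𝓝 (x₀, v₀) :=
    prod_mem_nhds (Metric.ball_mem_nhds x₀ hρ) univ_mem
  have h1 : fiberProd D l =ᶠ[𝓝 (x₀, v₀)]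
      fun q => ∏ j, ∑ i : Fin s, (l : ℂ) ^ (i : ℕ) * (q.2 i - g j q.1 i) := by
    filter_upwards [hB]
    rintro ⟨x, v⟩ ⟨hx, -⟩
    exact fiberProd_eq (hinj x hx) (Set.ext fun v => hg x hx v) l v
  refine DifferentiableAt.congr_of_eventuallyEq ?_ h1
  have h2 : ∀ j (i : Fin s), DifferentiableAt ℂ (fun q : V × (Fin s → ℂ) => g j q.1 i) (x₀, v₀) := by
    intro j i
    have h3 := ((hgd j).differentiableAt (Metric.ball_mem_nhds x₀ hρ))
    have h4 : DifferentiableAt ℂ (fun x => g j x i) x₀ := differentiableAt_pi.1 h3 i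
    exact h4.comp (x₀, v₀) (f := Prod.fst) differentiableAt_fst
  classical
  have h5 : ∀ j, DifferentiableAt ℂ (fun q : V × (Fin s → ℂ) =>
      ∑ i : Fin s, (l : ℂ) ^ (i : ℕ) * (q.2 i - g j q.1 i)) (x₀, v₀) := fun j =>
    .fun_sum fun i _ => (DifferentiableAt.sub (by fun_prop) (h2 j i)).const_mul _
  exact (HasFDerivAt.finsetProd fun j _ => (h5 j).hasFDerivAt).differentiableAt

variable [FiniteDimensional ℂ V]

/-- The closure of a covering over the complement of a thin analytic set is analytic, if it is
contained in a set which is proper over the base. -/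
theorem IsSheetCover.isAnalyticIn_closure {E T : Set V} (hE : IsOpen E) (hEc : IsPreconnected E)
    (hT : IsAnalyticIn E T) (hT' : interior T = ∅) {Z D : Set (V × (Fin s → ℂ))}
    (hp : ProperProjOn E Z) (hD : IsSheetCover (E \ T) D) (hDZ : D ⊆ Z) :
    IsAnalyticIn (E ×ˢ Set.univ) (closure D ∩ E ×ˢ Set.univ) := by
  have := FiniteDimensional.proper ℂ V
  obtain ⟨t, ht⟩ := hD.exists_ncard_eq (hT.isPreconnected_diff hE hEc hT')
  have hfib : ∀ x ∈ E \ T, ∃ u : Fin t → Fin s → ℂ,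
      Function.Injective u ∧ {v | (x, v) ∈ D} = Set.range u := by
    intro x hx
    obtain ⟨ρ, hρ, -, g, -, hinj, hg⟩ := hD.exists_chart ht hx
    exact ⟨_, hinj x (Metric.mem_ball_self hρ), hg x (Metric.mem_ball_self hρ)⟩
  refine .of_finite Set.inter_subset_right ?_
  rintro ⟨x₀, v₀⟩ ⟨hx₀, -⟩
  obtain ⟨r, hr, hrE⟩ := Metric.nhds_basis_closedBall.mem_iff.1 (hE.mem_nhds hx₀)
  obtain ⟨R, hR⟩ := (hp _ hrE (isCompact_closedBall x₀ r)).exists_bound_of_continuousOn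
    (f := Prod.snd) continuousOn_snd
  set W := Metric.ball x₀ r ×ˢ Metric.ball v₀ 1 with hW
  have hWo : IsOpen W := Metric.isOpen_ball.prod Metric.isOpen_ball
  have hWE : ∀ q ∈ W, q.1 ∈ E := fun q hq => hrE (Metric.ball_subset_closedBall hq.1)
  have hTW : IsAnalyticIn W (W ∩ Prod.fst ⁻¹' T) :=
    hT.preimage hWo differentiableOn_fst hWE
  have hTW' : interior (W ∩ Prod.fst ⁻¹' T) = ∅ := by
    by_contra hne
    obtain ⟨q, hq⟩ := Set.nonempty_iff_ne_empty.2 hne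
    have h1 : Prod.fst '' interior (W ∩ Prod.fst ⁻¹' T) ⊆ interior T := by
      refine interior_maximal ?_ (isOpenMap_fst _ isOpen_interior)
      rintro _ ⟨p, hp, rfl⟩
      exact (interior_subset hp).2
    rw [hT'] at h1
    exact h1 ⟨q, hq, rfl⟩
  have hDR : ∀ x ∈ Metric.ball x₀ r, ∀ u, (x, u) ∈ D → ‖u‖ ≤ R := fun x hx u hu =>
    hR (x, u) ⟨hDZ hu, Metric.ball_subset_closedBall hx⟩
  have hvR : ∀ v ∈ Metric.ball v₀ 1, ‖v‖ ≤ ‖v₀‖ + 1 := by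
    intro v hv
    have h1 := norm_le_norm_add_norm_sub' v v₀
    rw [mem_ball_iff_norm] at hv
    linarith
  have hWT : ∀ q ∈ W \ (W ∩ Prod.fst ⁻¹' T), q.1 ∈ E \ T := fun q hq =>
    ⟨hWE q hq.1, fun h => hq.2 ⟨hq.1, h⟩⟩
  have hext : ∀ l : Fin (t * s + 1), ∃ ρ > 0, Metric.ball (x₀, v₀) ρ ⊆ W ∧
      ∃ F : V × (Fin s → ℂ) → ℂ, DifferentiableOn ℂ F (Metric.ball (x₀, v₀) ρ) ∧
      ∀ q ∈ Metric.ball (x₀, v₀) ρ \ (W ∩ Prod.fst ⁻¹' T), F q = fiberProd D l q := by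
    intro l
    refine exists_local_extension hWo hTW hTW'
      ((hD.differentiableOn_fiberProd l).mono fun q hq => ⟨hWT q hq, trivial⟩)
      (M := (∑ i : Fin s, ((l : ℕ) : ℝ) ^ (i : ℕ) * (‖v₀‖ + 1 + R)) ^ t) ?_
      ⟨Metric.mem_ball_self hr, Metric.mem_ball_self one_pos⟩
    rintro ⟨x, v⟩ hq
    obtain ⟨u, hu, hDu⟩ := hfib x (hWT _ hq)
    refine norm_fiberProd_le hu hDu l fun j => (norm_sub_le _ _).trans
      (add_le_add (hvR v hq.1.2) (hDR x hq.1.1 _ ?_))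
    have : u j ∈ {v | (x, v) ∈ D} := hDu ▸ Set.mem_range_self j
    exact this
  choose ρ hρ hρW F hF hFf using hext
  set U := ⋂ l, Metric.ball (x₀, v₀) (ρ l) with hU
  have hUo : IsOpen U := isOpen_iInter_of_finite fun l => Metric.isOpen_ball
  have hUl : ∀ l, U ⊆ Metric.ball (x₀, v₀) (ρ l) := fun l => Set.iInter_subset _ l
  have hUW : U ⊆ W := (hUl 0).trans (hρW 0)
  refine ⟨U, hUo, Set.mem_iInter.2 fun l => Metric.mem_ball_self (hρ l), Fin (t * s + 1),
    inferInstance, F, fun l => (hF l).mono (hUl l), ?_⟩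
  rintro ⟨x, v⟩ hxvU
  have hFc : ∀ l, ContinuousAt (F l) (x, v) := fun l =>
    (hF l).continuousOn.continuousAt (Metric.isOpen_ball.mem_nhds (hUl l hxvU))
  constructor
  · rintro ⟨hcl, -⟩ l
    by_contra hne
    obtain ⟨⟨y, w⟩, hqD, hq0, hqU⟩ := ((mem_closure_iff_frequently.1 hcl).and_eventually
      (((hFc l).eventually_ne hne).and (hUo.mem_nhds hxvU))).exists
    have hy : y ∈ E \ T := hD.1 _ hqD
    obtain ⟨u, hu, hDu⟩ := hfib y hy
    obtain ⟨j, rfl⟩ : w ∈ Set.range u := hDu ▸ hqD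
    refine hq0 ?_
    rw [hFf l _ ⟨hUl l hqU, fun h => hy.2 h.2⟩, fiberProd_eq hu hDu]
    exact Finset.prod_eq_zero (Finset.mem_univ j) (by simp)
  · intro hz
    refine ⟨?_, hWE _ (hUW hxvU), trivial⟩
    by_contra hcl
    obtain ⟨ε, hε, hεD⟩ : ∃ ε > 0, ∀ q ∈ D, ε ≤ dist (x, v) q := by
      simpa [Metric.mem_closure_iff] using hcl
    -- a compact set of differences on which the products cannot all be small
    set 𝒞 : Set (Fin t → Fin s → ℂ) := Set.univ.pi fun _ =>
      Metric.closedBall 0 (‖v₀‖ + 1 + R) ∩ {w | ε ≤ ‖w‖} with h𝒞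
    have h𝒞c : IsCompact 𝒞 := isCompact_univ_pi fun _ =>
      (isCompact_closedBall _ _).inter_right (isClosed_le continuous_const continuous_norm)
    obtain ⟨δ, hδ, hδ𝒞⟩ := h𝒞c.exists_forall_le' (a := 0)
      (f := fun c => ∑ l : Fin (t * s + 1),
        ‖∏ j, ∑ i : Fin s, ((l : ℕ) : ℂ) ^ (i : ℕ) * c j i‖) (by fun_prop) (by
        intro c hc
        refine (Finset.sum_nonneg fun l _ => norm_nonneg _).lt_of_ne' fun h0 => ?_
        rw [Finset.sum_eq_zero_iff_of_nonneg fun l _ => norm_nonneg _] at h0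
        obtain ⟨j, hj⟩ := (exists_forall_eq_zero_iff_prod c).2 fun l =>
          norm_eq_zero.1 (h0 l (Finset.mem_univ l))
        have h1 : ε ≤ ‖c j‖ := (hc j trivial).2
        rw [show c j = 0 from funext hj, norm_zero] at h1
        linarith)
    have hev : ∀ᶠ y in 𝓝 x, (y, v) ∈ U ∧ ∑ l, ‖F l (y, v)‖ < δ ∧ dist x y < ε := by
      have h1 : ContinuousAt (fun y => (y, v)) x := by fun_prop
      have h2 : ∀ l, ContinuousAt (fun y => F l (y, v)) x := fun l =>
        ContinuousAt.comp (f := fun y => (y, v)) (x := x) (hFc l) h1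
      have h3 : ContinuousAt (fun y => ∑ l, ‖F l (y, v)‖) x := by fun_prop
      have h4 : ContinuousAt (fun y => dist x y) x := by fun_prop
      refine (h1.eventually (hUo.mem_nhds hxvU)).and ((h3.eventually_lt_const ?_).and
        (h4.eventually_lt_const (by simpa using hε)))
      simpa [hz] using hδ
    obtain ⟨O, hOs, hO, hxO⟩ := eventually_nhds_iff.1 hev
    obtain ⟨y, hyO, hyT⟩ := exists_mem_notMem_of_interior_eq_empty hO hT' hxO
    obtain ⟨hyU, hyδ, hyε⟩ := hOs y hyO
    obtain ⟨u, hu, hDu⟩ := hfib y ⟨hWE _ (hUW hyU), hyT⟩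
    have huD : ∀ j, (y, u j) ∈ D := fun j => by
      have : u j ∈ {v | (y, v) ∈ D} := hDu ▸ Set.mem_range_self j
      exact this
    refine absurd (hδ𝒞 (fun j => v - u j) fun j _ => ⟨?_, ?_⟩) (not_le.2 ?_)
    · rw [mem_closedBall_zero_iff]
      exact (norm_sub_le _ _).trans
        (add_le_add (hvR v (hUW hyU).2) (hDR y (hUW hyU).1 _ (huD j)))
    · have h1 := hεD _ (huD j)
      rw [Prod.dist_eq, le_max_iff] at h1
      have h2 := h1.resolve_left (not_le.2 hyε)
      rwa [dist_eq_norm] at h2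
    · refine lt_of_eq_of_lt (Finset.sum_congr rfl fun l _ => ?_) hyδ
      rw [hFf l _ ⟨hUl l hyU, fun h => hyT h.2⟩, fiberProd_eq hu hDu]
      rfl

end Closure

section Irreducible

variable {A B : Type} [NormedAddCommGroup A] [NormedSpace ℂ A]
  [NormedAddCommGroup B] [NormedSpace ℂ B]

theorem IsSheetCover.exists_local_graph {U : Set A} {D : Set (A × B)} (hD : IsSheetCover U D)
    {p : A × B} (hp : p ∈ D) : ∃ ρ > 0, Metric.ball p.1 ρ ⊆ U ∧ ∃ g : A → B,
      DifferentiableOn ℂ g (Metric.ball p.1 ρ) ∧ ∃ O : Set (A × B), IsOpen O ∧ p ∈ O ∧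
        ∀ q, q ∈ D ∩ O ↔ q.1 ∈ Metric.ball p.1 ρ ∧ q.2 = g q.1 := by
  obtain ⟨x₀, v₀⟩ := p
  obtain ⟨ρ, hρ, hρU, t, g, hgd, hinj, hg⟩ := hD.2 x₀ (hD.1 _ hp)
  have hx₀ : x₀ ∈ Metric.ball x₀ ρ := Metric.mem_ball_self hρ
  have hgc : ∀ i, ContinuousAt (g i) x₀ := fun i =>
    (hgd i).continuousOn.continuousAt (Metric.ball_mem_nhds x₀ hρ)
  obtain ⟨i, rfl⟩ := (hg x₀ hx₀ v₀).1 hp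
  have hev : ∀ᶠ q in 𝓝 (x₀, g i x₀), ∀ j, j ≠ i → g j q.1 ≠ q.2 := by
    refine eventually_all.2 fun j => ?_
    by_cases hji : j = i
    · exact .of_forall fun q h => absurd hji h
    · have h2 : ContinuousAt (fun q : A × B => g j q.1) (x₀, g i x₀) :=
        ContinuousAt.comp (f := Prod.fst) (x := (x₀, g i x₀)) (hgc j) continuousAt_fst
      filter_upwards [(h2.ne_iff_eventually_ne continuousAt_snd).1
        fun h => hji (hinj x₀ hx₀ h)] with q hq _
      exact hq
  obtain ⟨O, hOs, hO, hpO⟩ := eventually_nhds_iff.1 hev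
  have h1 : ContinuousAt (fun x => (x, g i x)) x₀ := continuousAt_id.prodMk (hgc i)
  obtain ⟨δ, hδ, hδs⟩ := Metric.eventually_nhds_iff_ball.1
    ((h1.eventually (hO.mem_nhds hpO)).and (Metric.ball_mem_nhds x₀ hρ))
  have hδρ : Metric.ball x₀ δ ⊆ Metric.ball x₀ ρ := fun x hx => (hδs x hx).2
  refine ⟨δ, hδ, hδρ.trans hρU, g i, (hgd i).mono hδρ, O ∩ Prod.fst ⁻¹' Metric.ball x₀ δ,
    hO.inter (Metric.isOpen_ball.preimage continuous_fst), ⟨hpO, Metric.mem_ball_self hδ⟩, ?_⟩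
  rintro ⟨x, v⟩
  constructor
  · rintro ⟨hxD, hxO, hx⟩
    obtain ⟨j, rfl⟩ := (hg x (hδρ hx) v).1 hxD
    refine ⟨hx, ?_⟩
    by_contra hne
    exact hOs _ hxO j (fun h => hne (by rw [h])) rfl
  · rintro ⟨hx, hv⟩
    obtain rfl : v = g i x := hv
    exact ⟨(hg x (hδρ hx) _).2 ⟨i, rfl⟩, (hδs x hx).1, hx⟩

/-- A connected covering contained in an analytic set near one point is contained in it. -/
theorem IsSheetCover.subset_of_nhds {U : Set A} {D : Set (A × B)} (hD : IsSheetCover U D)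
    (hDc : IsPreconnected D) {Ω X : Set (A × B)} (hX : IsAnalyticIn Ω X) (hDΩ : D ⊆ Ω)
    {p : A × B} (hp : p ∈ D) {O : Set (A × B)} (hO : IsOpen O) (hpO : p ∈ O) (hOX : D ∩ O ⊆ X) :
    D ⊆ X := by
  set P : Set (A × B) := ⋃₀ {O | IsOpen O ∧ D ∩ O ⊆ X} with hP
  have hPo : IsOpen P := isOpen_sUnion fun O h => h.1
  set Q : Set (A × B) := ⋃₀ {O | IsOpen O ∧ D ∩ O ∩ P = ∅} with hQ
  have hQo : IsOpen Q := isOpen_sUnion fun O h => h.1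
  have hPQ : D ⊆ P ∪ Q := by
    intro p hp
    obtain ⟨ρ, hρ, hρU, g, hgd, O, hO, hpO, hDO⟩ := hD.exists_local_graph hp
    by_cases hne : D ∩ O ∩ P = ∅
    · exact .inr ⟨O, ⟨hO, hne⟩, hpO⟩
    obtain ⟨⟨x, v⟩, hq, N, ⟨hN, hNX⟩, hqN⟩ := Set.nonempty_iff_ne_empty.2 hne
    refine .inl ⟨O, ⟨hO, ?_⟩, hpO⟩
    have hgD : ∀ x ∈ Metric.ball p.1 ρ, (x, g x) ∈ D := fun x hx => ((hDO (x, g x)).2 ⟨hx, rfl⟩).1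
    obtain ⟨hx, hv⟩ := (hDO _).1 hq
    obtain rfl : v = g x := hv
    have hA := hX.preimage (Ω' := Metric.ball p.1 ρ) Metric.isOpen_ball
      (f := fun x => (x, g x)) (differentiableOn_id.prodMk hgd) fun x hx => hDΩ (hgD x hx)
    have hAeq := hA.eq_of_interior_nonempty (convex_ball p.1 ρ).isPreconnected ⟨x, by
      rw [mem_interior_iff_mem_nhds]
      have h1 : ContinuousAt (fun x => (x, g x)) x :=
        continuousAt_id.prodMk (hgd.continuousOn.continuousAt (Metric.isOpen_ball.mem_nhds hx))
      filter_upwards [h1.eventually (hN.mem_nhds hqN), Metric.isOpen_ball.mem_nhds hx] with y h2 h3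
      exact ⟨h3, hNX ⟨hgD y h3, h2⟩⟩⟩
    rintro ⟨y, w⟩ hyw
    obtain ⟨hy, hw⟩ := (hDO _).1 hyw
    obtain rfl : w = g y := hw
    exact (hAeq.symm ▸ hy : y ∈ Metric.ball p.1 ρ ∩ _).2
  have hdisj : D ∩ (P ∩ Q) = ∅ := by
    refine Set.eq_empty_of_forall_notMem ?_
    rintro q ⟨hqD, hqP, N, ⟨-, hN⟩, hqN⟩
    have : q ∈ D ∩ N ∩ P := ⟨⟨hqD, hqN⟩, hqP⟩
    rw [hN] at this
    exact this
  have hpP : p ∈ P := ⟨O, ⟨hO, hOX⟩, hpO⟩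
  rcases isPreconnected_iff_subset_of_disjoint.1 hDc P Q hPo hQo hPQ hdisj with h | h
  · intro q hq
    obtain ⟨N, ⟨-, hN⟩, hqN⟩ := h hq
    exact hN ⟨hq, hqN⟩
  · have : p ∈ D ∩ (P ∩ Q) := ⟨hp, hpP, h hp⟩
    rw [hdisj] at this
    exact this.elim

/-- The closure of a connected covering is irreducible. -/
theorem IsSheetCover.irredAnalyticIn_closure {U : Set A} {D : Set (A × B)}
    (hD : IsSheetCover U D) (hDc : IsPreconnected D) (hne : D.Nonempty) {Ω : Set (A × B)}
    (hΩ : IsOpen Ω) (hDΩ : D ⊆ Ω) (han : IsAnalyticIn Ω (closure D ∩ Ω)) :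
    IrredAnalyticIn Ω (closure D ∩ Ω) := by
  have hsub : D ⊆ closure D ∩ Ω := fun p hp => ⟨subset_closure hp, hDΩ hp⟩
  refine ⟨han, hne.mono hsub, fun X₁ X₂ h₁ h₂ hX => ?_⟩
  suffices D ⊆ X₁ ∨ D ⊆ X₂ by
    refine this.imp (fun h => ?_) fun h => ?_
    · exact (h₁.closure_inter_subset hΩ h).antisymm (hX ▸ Set.subset_union_left)
    · exact (h₂.closure_inter_subset hΩ h).antisymm (hX ▸ Set.subset_union_right)
  obtain ⟨p, hp⟩ := hne
  obtain ⟨ρ, hρ, hρU, g, hgd, O, hO, hpO, hDO⟩ := hD.exists_local_graph hp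
  have hgD : ∀ x ∈ Metric.ball p.1 ρ, (x, g x) ∈ D ∩ O := fun x hx => (hDO (x, g x)).2 ⟨hx, rfl⟩
  have hA : ∀ X, IsAnalyticIn Ω X → IsAnalyticIn (Metric.ball p.1 ρ)
      (Metric.ball p.1 ρ ∩ (fun x => (x, g x)) ⁻¹' X) := fun X h =>
    h.preimage Metric.isOpen_ball (differentiableOn_id.prodMk hgd) fun x hx => hDΩ (hgD x hx).1
  have key : ∀ X, IsAnalyticIn Ω X →
      (interior (Metric.ball p.1 ρ ∩ (fun x => (x, g x)) ⁻¹' X)).Nonempty → D ⊆ X := by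
    rintro X h ⟨x, hx⟩
    refine hD.subset_of_nhds hDc h hDΩ (hgD x (interior_subset hx).1).1
      (hO.inter (isOpen_interior.preimage continuous_fst)) ⟨(hgD x (interior_subset hx).1).2, hx⟩ ?_
    rintro ⟨y, w⟩ ⟨hyD, hyO, hy⟩
    obtain ⟨-, hw⟩ := (hDO _).1 ⟨hyD, hyO⟩
    obtain rfl : w = g y := hw
    exact (interior_subset hy).2
  by_contra! hcon
  have h3 := (hA X₁ h₁).interior_union_eq_empty Metric.isOpen_ball (hA X₂ h₂).1
    (Set.not_nonempty_iff_eq_empty.1 fun h => hcon.1 (key X₁ h₁ h))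
    (Set.not_nonempty_iff_eq_empty.1 fun h => hcon.2 (key X₂ h₂ h))
  have h4 : Metric.ball p.1 ρ ∩ (fun x => (x, g x)) ⁻¹' (closure D ∩ Ω) = Metric.ball p.1 ρ :=
    Set.inter_eq_left.2 fun x hx => hsub (hgD x hx).1
  rw [← Set.inter_union_distrib_left, ← Set.preimage_union, ← hX, h4,
    Metric.isOpen_ball.interior_eq] at h3
  exact Set.notMem_empty p.1 (h3 ▸ Metric.mem_ball_self hρ)

end Irreducible

theorem IrredAnalyticIn.exists_subset_of_subset_sUnion {V : Type} [NormedAddCommGroup V]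
    [NormedSpace ℂ V] {Ω S : Set V} (hS : IrredAnalyticIn Ω S) {𝒢 : Set (Set V)} (hfin : 𝒢.Finite)
    (han : ∀ G ∈ 𝒢, IsAnalyticIn Ω G) (hsub : S ⊆ ⋃₀ 𝒢) : ∃ G ∈ 𝒢, S ⊆ G := by
  induction 𝒢, hfin using Set.Finite.induction_on with
  | empty =>
    obtain ⟨x, hx⟩ := hS.2.1
    simpa using hsub hx
  | @insert G 𝒢 hG hfin ih =>
    have h1 : IsAnalyticIn Ω (⋃₀ 𝒢) := by
      rw [Set.sUnion_eq_biUnion]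
      exact .biUnion hfin fun G hG => han G (Set.mem_insert_of_mem _ hG)
    rw [Set.sUnion_insert] at hsub
    rcases hS.2.2 _ _ (hS.1.inter (han G (Set.mem_insert _ _))) (hS.1.inter h1)
      (by rw [← Set.inter_union_distrib_left, Set.inter_eq_left.2 hsub]) with h | h
    · exact ⟨G, Set.mem_insert _ _, Set.inter_eq_left.1 h.symm⟩
    · obtain ⟨G', hG', h'⟩ := ih (fun G hG => han G (Set.mem_insert_of_mem _ hG))
        (Set.inter_eq_left.1 h.symm)
      exact ⟨G', Set.mem_insert_of_mem _ hG', h'⟩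

theorem IrredAnalyticIn.image {V V' : Type} [NormedAddCommGroup V] [NormedSpace ℂ V]
    [NormedAddCommGroup V'] [NormedSpace ℂ V'] {Ω G : Set V} {Ω' : Set V'}
    (hG : IrredAnalyticIn Ω G) (hΩ : IsOpen Ω) {f : V → V'} (hf : DifferentiableOn ℂ f Ω)
    (hmap : Set.MapsTo f Ω Ω') (han : IsAnalyticIn Ω' (f '' G)) : IrredAnalyticIn Ω' (f '' G) := by
  refine ⟨han, hG.2.1.image f, fun X₁ X₂ h₁ h₂ hX => ?_⟩
  have key : ∀ X, G = G ∩ (Ω ∩ f ⁻¹' X) → f '' G ⊆ X := by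
    rintro X h _ ⟨x, hx, rfl⟩
    rw [h] at hx
    exact hx.2.2
  refine (hG.2.2 _ _ (hG.1.inter (h₁.preimage hΩ hf hmap)) (hG.1.inter (h₂.preimage hΩ hf hmap))
    ?_).imp (fun h => (key _ h).antisymm (hX ▸ Set.subset_union_left))
      fun h => (key _ h).antisymm (hX ▸ Set.subset_union_right)
  rw [← Set.inter_union_distrib_left, ← Set.inter_union_distrib_left, ← Set.preimage_union, ← hX,
    eq_comm, Set.inter_eq_left]
  exact fun x hx => ⟨hG.1.1 hx, x, hx, rfl⟩

theorem stmt_4 (n s : ℕ) (E : Set (Fin n → ℂ)) (hE : IsOpen E) (hEc : IsConnected E)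
    (L : (Fin s → ℂ) →ₗ[ℂ] ℂ)
    (Z : Set ((Fin n → ℂ) × (Fin s → ℂ)))
    (hZ : IsAnalyticIn (E ×ˢ (Set.univ : Set (Fin s → ℂ))) Z)
    (hZdim : PureDim Z n)
    (hZprop : ProperProjOn E Z)
    (sZ : ℕ) (hsZ : GenFiberCard E Z sZ)
    (hsPsi : GenFiberCard E
      ((fun p : (Fin n → ℂ) × (Fin s → ℂ) => (p.1, L p.2)) '' Z) sZ) :
    ∀ S : Set ((Fin n → ℂ) × ℂ),
      IsIrredComp (E ×ˢ (Set.univ : Set ℂ))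
        ((fun p : (Fin n → ℂ) × (Fin s → ℂ) => (p.1, L p.2)) '' Z) S →
      ∃ G : Set ((Fin n → ℂ) × (Fin s → ℂ)),
        IsIrredComp (E ×ˢ (Set.univ : Set (Fin s → ℂ))) Z G ∧
        (fun p : (Fin n → ℂ) × (Fin s → ℂ) => (p.1, L p.2)) '' G = S ∧
        ∃ t : ℕ, GenFiberCard E G t ∧ GenFiberCard E S t := by
  classical
  intro S hS
  obtain ⟨T₁, hT₁, hT₁E, hc₁⟩ := hsZ
  obtain ⟨T₂, hT₂, hT₂E, hc₂⟩ := hsPsi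
  set Ψ : (Fin n → ℂ) × (Fin s → ℂ) → (Fin n → ℂ) × ℂ := fun p => (p.1, L p.2) with hΨ
  have hΩ : IsOpen (E ×ˢ (Set.univ : Set (Fin s → ℂ))) := hE.prod isOpen_univ
  set T := T₁ ∪ T₂ with hTdef
  have hT : IsAnalyticIn E T := hT₁.union hT₂
  have hT' : interior T = ∅ := hT₁.interior_union_eq_empty hE hT₂.1
    (hT₁.interior_eq_empty hEc.isPreconnected hT₁E) (hT₂.interior_eq_empty hEc.isPreconnected hT₂E)
  obtain ⟨a, ha⟩ := hEc.nonempty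
  obtain ⟨x₀, hx₀E, hx₀T⟩ := exists_mem_notMem_of_interior_eq_empty hE hT' ha
  have hTE : T ≠ E := fun h => hx₀T (h ▸ hx₀E)
  have hU : IsOpen (E \ T) := hT.isOpen_diff hE
  have hUc : IsPreconnected (E \ T) := hT.isPreconnected_diff hE hEc.isPreconnected hT'
  have hk₁ : ∀ x ∈ E \ T, Set.ncard {v | (x, v) ∈ Z} = sZ := fun x hx =>
    hc₁ x ⟨hx.1, fun h => hx.2 (.inl h)⟩
  have hk₂ : ∀ x ∈ E \ T, Set.ncard {v | (x, v) ∈ Ψ '' Z} = sZ := fun x hx =>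
    hc₂ x ⟨hx.1, fun h => hx.2 (.inr h)⟩
  have hcov := isSheetCover_of_ncard_eq hE hZ hZdim hZprop hU Set.sdiff_subset hk₁
  obtain ⟨𝒟, h𝒟fin, h𝒟Z, h𝒟d, h𝒟⟩ := hcov.exists_decomposition hUc ⟨hx₀E, hx₀T⟩ _ rfl
  -- the irreducible components of `Z`
  set cl : Set ((Fin n → ℂ) × (Fin s → ℂ)) → Set ((Fin n → ℂ) × (Fin s → ℂ)) :=
    fun C => closure C ∩ E ×ˢ Set.univ with hcl
  have hCZ : ∀ C ∈ 𝒟, C ⊆ Z := fun C hC p hp => by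
    have : p ∈ ⋃₀ 𝒟 := ⟨C, hC, hp⟩
    rw [h𝒟Z] at this
    exact this.1
  have hclZ : ∀ C ∈ 𝒟, cl C ⊆ Z := fun C hC => hZ.closure_inter_subset hΩ (hCZ C hC)
  have hsubcl : ∀ C ∈ 𝒟, C ⊆ cl C := fun C hC p hp => ⟨subset_closure hp, hZ.1 (hCZ C hC hp)⟩
  have hclan : ∀ C ∈ 𝒟, IsAnalyticIn (E ×ˢ Set.univ) (cl C) := fun C hC =>
    (h𝒟 C hC).1.isAnalyticIn_closure hE hEc.isPreconnected hT hT' hZprop (hCZ C hC)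
  have hclirr : ∀ C ∈ 𝒟, IrredAnalyticIn (E ×ˢ Set.univ) (cl C) := fun C hC =>
    (h𝒟 C hC).1.irredAnalyticIn_closure (h𝒟 C hC).2.2 (h𝒟 C hC).2.1 hΩ
      ((hCZ C hC).trans hZ.1) (hclan C hC)
  have hclfib : ∀ C ∈ 𝒟, ∀ p, p.1 ∈ E \ T → (p ∈ cl C ↔ p ∈ C) := fun C hC p hp =>
    ⟨fun h => (h𝒟 C hC).1.mem_of_mem_closure h.1 hp, fun h => hsubcl C hC h⟩
  have hZcl : Z ⊆ ⋃₀ (cl '' 𝒟) := by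
    intro p hp
    have h1 : p ∈ closure (⋃₀ 𝒟) := by
      rw [mem_closure_iff]
      intro O hO hpO
      have h2 := image_fst_mem_nhds hE hZ hZprop hZdim hp hO hpO
      obtain ⟨N, hNs, hN, hpN⟩ := mem_nhds_iff.1 h2
      obtain ⟨y, hyN, hyT⟩ := exists_mem_notMem_of_interior_eq_empty hN hT' hpN
      obtain ⟨q, hq, rfl⟩ := hNs hyN
      refine ⟨q, hq.2, ?_⟩
      rw [h𝒟Z]
      exact ⟨hq.1, (hZ.1 hq.1).1, hyT⟩
    rw [h𝒟fin.closure_sUnion] at h1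
    obtain ⟨C, hC, hpC⟩ := Set.mem_iUnion₂.1 h1
    exact ⟨cl C, ⟨C, hC, rfl⟩, hpC, hZ.1 hp⟩
  have hcomp : ∀ C ∈ 𝒟, IsIrredComp (E ×ˢ Set.univ) Z (cl C) := by
    refine fun C hC => ⟨hclirr C hC, hclZ C hC, fun C' hC' hsub hC'Z => ?_⟩
    obtain ⟨-, ⟨C₂, hC₂, rfl⟩, hC'C₂⟩ := hC'.exists_subset_of_subset_sUnion (h𝒟fin.image cl)
      (by rintro _ ⟨C, hC, rfl⟩; exact hclan C hC) (hC'Z.trans hZcl)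
    obtain ⟨p, hp⟩ := (h𝒟 C hC).2.1
    have hp₂ : p ∈ C₂ := (hclfib C₂ hC₂ p ((h𝒟 C hC).1.1 p hp)).1
      (hC'C₂ (hsub (hsubcl C hC hp)))
    have hCC₂ : C = C₂ := by
      by_contra hne
      exact Set.disjoint_left.1 (h𝒟d hC hC₂ hne) hp hp₂
    rw [← hCC₂] at hC'C₂
    exact hC'C₂.antisymm hsub
  -- their images
  have hΨd : Differentiable ℂ Ψ := by
    have : Differentiable ℂ L := L.toContinuousLinearMap.differentiable
    exact differentiable_fst.prodMk (this.comp differentiable_snd)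
  have hclp : ∀ C ∈ 𝒟, ProperProjOn E (cl C) := by
    intro C hC K hK hKc
    have h1 := (hZprop K hK hKc).inter_right (isClosed_closure (s := C))
    convert h1 using 1
    ext p
    constructor
    · exact fun hp => ⟨⟨hclZ C hC hp.1, hp.2⟩, hp.1.1⟩
    · exact fun hp => ⟨⟨hp.2, hZ.1 hp.1.1⟩, hp.1.2⟩
  have hΨan : ∀ C ∈ 𝒟, IsAnalyticIn (E ×ˢ Set.univ) (Ψ '' cl C) := fun C hC =>
    (hclan C hC).image_linear hE (hclp C hC) L
  obtain ⟨-, ⟨C, hC, rfl⟩, hSC⟩ := hS.1.exists_subset_of_subset_sUnion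
    (𝒢 := (fun C => Ψ '' cl C) '' 𝒟) (h𝒟fin.image _) (by rintro _ ⟨C, hC, rfl⟩; exact hΨan C hC) (by
      intro y hy
      obtain ⟨p, hp, rfl⟩ := hS.2.1 hy
      obtain ⟨-, ⟨C, hC, rfl⟩, hpC⟩ := hZcl hp
      exact ⟨_, ⟨C, hC, rfl⟩, p, hpC, rfl⟩)
  have hCS : Ψ '' cl C = S := hS.2.2 _ ((hclirr C hC).image hΩ hΨd.differentiableOn
    (fun p hp => ⟨hp.1, trivial⟩) (hΨan C hC)) hSC (Set.image_mono (hclZ C hC))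
  obtain ⟨t, ht⟩ := (h𝒟 C hC).1.exists_ncard_eq hUc
  have hfib : ∀ x ∈ E \ T, {v | (x, v) ∈ cl C} = {v | (x, v) ∈ C} := fun x hx =>
    Set.ext fun v => hclfib C hC (x, v) hx
  have himg : ∀ X : Set ((Fin n → ℂ) × (Fin s → ℂ)), ∀ x,
      {w | (x, w) ∈ Ψ '' X} = L '' {v | (x, v) ∈ X} := by
    intro X x
    ext w
    constructor
    · rintro ⟨⟨y, v⟩, hyv, h⟩
      simp only [hΨ, Prod.mk.injEq] at h
      obtain ⟨rfl, rfl⟩ := h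
      exact ⟨v, hyv, rfl⟩
    · rintro ⟨v, hv, rfl⟩
      exact ⟨(x, v), hv, rfl⟩
  refine ⟨cl C, hcomp C hC, hCS, t, ⟨T, hT, hTE, fun x hx => ?_⟩, T, hT, hTE, fun x hx => ?_⟩
  · rw [hfib x hx, ht x hx]
  · have hZfin : {v | (x, v) ∈ Z}.Finite :=
      (isAnalyticIn_image_fst_and_finite_fiber s hE hZ hZprop).2 x hx.1
    have hinj : Set.InjOn L {v | (x, v) ∈ Z} :=
      Set.injOn_of_ncard_image_eq (by rw [← himg, hk₂ x hx, hk₁ x hx]) hZfin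
    have hsub : {v | (x, v) ∈ C} ⊆ {v | (x, v) ∈ Z} := fun v hv => hCZ C hC hv
    rw [← hCS, himg, hfib x hx, (hinj.mono hsub).ncard_image, ht x hx]
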